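/- Let X ⊂ ℙ³ be a smooth cubic surface. The ideal I_{Z,X} ⊂ R_X of a general set Z of 5 points on X has graded minimal free resolution over R given by 0 → R(−5) → R(−3)^{6} → R(−2)^{5} → I_{Z,X} → 0, and the ideal I_{Z',X} of a general set Z' of 12 points on X has graded minimal free resolution over R given by 0 → R(−6)² → R(−4)^{9} → R(−3)^{7} → I_{Z',X} → 0. -/

import Mathlib

/-!
Common definitions for formalizing "The minimal resolution conjecture for points
on the cubic surface" (arXiv:math/0611137).

We work with `R = k[x₀,x₁,x₂,x₃]`, closed points of `ℙ³` modeled by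
`Projectivization k (Fin 4 → k)`, saturated ideals of sets of points as vanishing
ideals, genericity expressed by a nonempty basic open subset of the configuration
space, and graded minimal free resolutions expressed by explicit homogeneous
matrices whose entries have zero constant term (no nonzero scalar entries).
-/

open MvPolynomial

noncomputable section

/-- The polynomial ring `R = k[x₀,x₁,x₂,x₃]` in four variables over `k`. -/
abbrev R4 (k : Type) [Field k] : Type := MvPolynomial (Fin 4) k

/-- The (closed) points of the projective space `ℙ³` over `k`. -/
abbrev P3 (k : Type) [Field k] : Type := Projectivization k (Fin 4 → k)

variable (k : Type) [Field k]

/-- A polynomial vanishes at a projective point if it vanishes at every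
representative vector of that point. -/
def VanishesAt (f : R4 k) (p : P3 k) : Prop :=
  ∀ (v : Fin 4 → k) (hv : v ≠ 0), Projectivization.mk k v hv = p → eval v f = 0

/-- The saturated homogeneous ideal `I_Z ⊆ R` of a set `Z` of (reduced) points of
`ℙ³`: all polynomials vanishing at every point of `Z`. -/
def pointsIdeal (Zs : Set (P3 k)) : Ideal (R4 k) where
  carrier := {f | ∀ p ∈ Zs, VanishesAt k f p}
  zero_mem' := by
    intro p _ v hv _
    simp
  add_mem' := by
    intro a b ha hb p hp v hv hmk
    have h1 := ha p hp v hv hmk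
    have h2 := hb p hp v hv hmk
    simp [h1, h2]
  smul_mem' := by
    intro c a ha p hp v hv hmk
    have h1 := ha p hp v hv hmk
    simp [smul_eq_mul, h1]

/-- An ideal of `R` is homogeneous if it is generated by homogeneous elements. -/
def IsHomogIdeal (I : Ideal (R4 k)) : Prop :=
  ∃ G : Set (R4 k), (∀ g ∈ G, ∃ d : ℕ, g.IsHomogeneous d) ∧ I = Ideal.span G

/-- Saturation of an ideal with respect to the irrelevant maximal ideal
`(x₀,…,x₃)`. -/
def satIdeal (I : Ideal (R4 k)) : Ideal (R4 k) where
  carrier := {g | ∀ i : Fin 4, ∃ N : ℕ, (X i : R4 k) ^ N * g ∈ I}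
  zero_mem' := by
    intro i
    exact ⟨0, by simp⟩
  add_mem' := by
    intro a b ha hb i
    obtain ⟨N, hN⟩ := ha i
    obtain ⟨M, hM⟩ := hb i
    refine ⟨N + M, ?_⟩
    have h1 : (X i : R4 k) ^ (N + M) * (a + b)
        = X i ^ M * (X i ^ N * a) + X i ^ N * (X i ^ M * b) := by ring
    rw [h1]
    exact Ideal.add_mem _ (Ideal.mul_mem_left _ _ hN) (Ideal.mul_mem_left _ _ hM)
  smul_mem' := by
    intro c a ha i
    obtain ⟨N, hN⟩ := ha i
    refine ⟨N, ?_⟩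
    have h1 : (X i : R4 k) ^ N * (c • a) = c * (X i ^ N * a) := by
      rw [smul_eq_mul]; ring
    rw [h1]
    exact Ideal.mul_mem_left _ _ hN

/-- The colon ideal `(I : J) = {r | r·J ⊆ I}`. -/
def icolon (I J : Ideal (R4 k)) : Ideal (R4 k) where
  carrier := {r | ∀ x ∈ J, r * x ∈ I}
  zero_mem' := by
    intro x hx
    rw [zero_mul]; exact I.zero_mem
  add_mem' := by
    intro a b ha hb x hx
    rw [add_mul]
    exact Ideal.add_mem _ (ha x hx) (hb x hx)
  smul_mem' := by
    intro c a ha x hx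
    rw [smul_eq_mul, mul_assoc]
    exact Ideal.mul_mem_left _ _ (ha x hx)

/-- A smooth cubic surface `X ⊂ ℙ³`: an irreducible homogeneous cubic form with
no singular zero (Jacobian criterion). -/
structure SmoothCubicSurface (k : Type) [Field k] : Type where
  f : MvPolynomial (Fin 4) k
  homog : f.IsHomogeneous 3
  irred : Irreducible f
  smooth : ∀ v : Fin 4 → k, v ≠ 0 → eval v f = 0 →
    ∃ i : Fin 4, eval v (pderiv i f) ≠ 0

/-- A configuration of `t` distinct points lying on `X`. -/
def ConfigOn (S : SmoothCubicSurface k) {t : ℕ} (Z : Fin t → P3 k) : Prop :=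
  Function.Injective Z ∧ ∀ i, VanishesAt k S.f (Z i)

/-- A configuration avoids the (closed locus of the) polynomial `g` on the
product of the affine cones: some choice of representatives does not annihilate `g`. -/
def Avoids {t : ℕ} (g : MvPolynomial (Fin t × Fin 4) k) (Z : Fin t → P3 k) : Prop :=
  ∃ v : Fin t → Fin 4 → k,
    (∀ i, ∃ hv : v i ≠ 0, Projectivization.mk k (v i) hv = Z i) ∧
    eval (fun q : Fin t × Fin 4 => v q.1 q.2) g ≠ 0

/-- `P` holds for a *general* set of `t` points on `X`: it holds on a nonempty
(basic) Zariski-open subset of the family of all sets of `t` points of `X`. -/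
def GeneralPointsSatisfy (S : SmoothCubicSurface k) (t : ℕ)
    (P : (Fin t → P3 k) → Prop) : Prop :=
  ∃ g : MvPolynomial (Fin t × Fin 4) k,
    (∃ Z : Fin t → P3 k, ConfigOn k S Z ∧ Avoids k g Z) ∧
    (∀ Z : Fin t → P3 k, ConfigOn k S Z → Avoids k g Z → P Z)

/-- An admissible entry of a matrix in a graded **minimal** free resolution,
mapping a generator of degree `d` into a generator of degree `e`: the entry is
homogeneous of degree `d - e`, and it is not a nonzero scalar (zero constant
coefficient). -/
def EntryOk (d e : ℕ) (q : R4 k) : Prop :=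
  (q = 0 ∨ ∃ c : ℕ, d = e + c ∧ q.IsHomogeneous c) ∧ coeff 0 q = 0

/-- Integer-degree version of `EntryOk` (for modules with generators of
arbitrary integer degrees). -/
def EntryOkZ (d e : ℤ) (q : R4 k) : Prop :=
  (q = 0 ∨ ∃ c : ℕ, d = e + (c : ℤ) ∧ q.IsHomogeneous c) ∧ coeff 0 q = 0

/-- The body of a graded minimal free resolution of length 2 over `R` of the
`R`-module `I/J`:
`0 → ⊕ R(-d2 i) --M2--> ⊕ R(-d1 j) --g--> I/J → 0`.
The generators `g j ∈ I` are homogeneous of degree `d1 j` and generate `I` mod `J`;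
`M2` is a homogeneous matrix with no nonzero scalar entries whose rows generate the
kernel, and which is injective. -/
def Res2Body (J I : Ideal (R4 k)) {n1 n2 : ℕ}
    (d1 : Fin n1 → ℕ) (d2 : Fin n2 → ℕ)
    (g : Fin n1 → R4 k) (M2 : Fin n2 → Fin n1 → R4 k) : Prop :=
  (∀ j, g j ∈ I ∧ (g j).IsHomogeneous (d1 j)) ∧
  (∀ x ∈ I, ∃ w : Fin n1 → R4 k, x - ∑ j, w j * g j ∈ J) ∧
  (∀ i j, EntryOk k (d2 i) (d1 j) (M2 i j)) ∧
  (∀ w : Fin n1 → R4 k,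
    ((∑ j, w j * g j) ∈ J) ↔ ∃ u : Fin n2 → R4 k, ∀ j, w j = ∑ i, u i * M2 i j) ∧
  (∀ u : Fin n2 → R4 k, (∀ j, (∑ i, u i * M2 i j) = 0) → u = 0)

/-- `I/J` has a graded minimal free resolution
`0 → ⊕ R(-d2 i) → ⊕ R(-d1 j) → I/J → 0` over `R`. -/
def HasMinFreeRes2 (J I : Ideal (R4 k)) {n1 n2 : ℕ}
    (d1 : Fin n1 → ℕ) (d2 : Fin n2 → ℕ) : Prop :=
  ∃ (g : Fin n1 → R4 k) (M2 : Fin n2 → Fin n1 → R4 k), Res2Body k J I d1 d2 g M2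

/-- The body of a graded minimal free resolution of length 3 over `R` of the
`R`-module `I/J`:
`0 → ⊕ R(-d3 l) --M3--> ⊕ R(-d2 i) --M2--> ⊕ R(-d1 j) --g--> I/J → 0`. -/
def Res3Body (J I : Ideal (R4 k)) {n1 n2 n3 : ℕ}
    (d1 : Fin n1 → ℕ) (d2 : Fin n2 → ℕ) (d3 : Fin n3 → ℕ)
    (g : Fin n1 → R4 k) (M2 : Fin n2 → Fin n1 → R4 k)
    (M3 : Fin n3 → Fin n2 → R4 k) : Prop :=
  (∀ j, g j ∈ I ∧ (g j).IsHomogeneous (d1 j)) ∧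
  (∀ x ∈ I, ∃ w : Fin n1 → R4 k, x - ∑ j, w j * g j ∈ J) ∧
  (∀ i j, EntryOk k (d2 i) (d1 j) (M2 i j)) ∧
  (∀ i j, EntryOk k (d3 i) (d2 j) (M3 i j)) ∧
  (∀ w : Fin n1 → R4 k,
    ((∑ j, w j * g j) ∈ J) ↔ ∃ u : Fin n2 → R4 k, ∀ j, w j = ∑ i, u i * M2 i j) ∧
  (∀ u : Fin n2 → R4 k,
    (∀ j, (∑ i, u i * M2 i j) = 0) ↔ ∃ t : Fin n3 → R4 k, ∀ i, u i = ∑ l, t l * M3 l i) ∧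
  (∀ t : Fin n3 → R4 k, (∀ i, (∑ l, t l * M3 l i) = 0) → t = 0)

/-- `I/J` has a graded minimal free resolution
`0 → ⊕ R(-d3 l) → ⊕ R(-d2 i) → ⊕ R(-d1 j) → I/J → 0` over `R`.
Taking `J = ⊥` this is a resolution of the ideal `I ⊆ R`; taking `J = (f)` it is a
resolution of `I/(f) ⊆ R_X = R/(f)`; taking `J = I_C` a resolution of `I/I_C`. -/
def HasMinFreeRes3 (J I : Ideal (R4 k)) {n1 n2 n3 : ℕ}
    (d1 : Fin n1 → ℕ) (d2 : Fin n2 → ℕ) (d3 : Fin n3 → ℕ) : Prop :=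
  ∃ (g : Fin n1 → R4 k) (M2 : Fin n2 → Fin n1 → R4 k) (M3 : Fin n3 → Fin n2 → R4 k),
    Res3Body k J I d1 d2 d3 g M2 M3

/-- The Betti numbers read off from a minimal free resolution
`0 → F₃ → F₂ → F₁ → I_Z → 0` of the ideal of `Z` (so that
`F_i = ⊕_j R(-i-j)^{b_{i,j}}` in the resolution of `R/I_Z`, with `F₀ = R`). -/
def bettiCount {n1 n2 n3 : ℕ} (d1 : Fin n1 → ℕ) (d2 : Fin n2 → ℕ) (d3 : Fin n3 → ℕ)
    (i j : ℕ) : ℕ :=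
  if i = 0 then (if j = 0 then 1 else 0)
  else if i = 1 then (Finset.univ.filter fun l => d1 l = 1 + j).card
  else if i = 2 then (Finset.univ.filter fun l => d2 l = 2 + j).card
  else if i = 3 then (Finset.univ.filter fun l => d3 l = 3 + j).card
  else 0

/-- The Hilbert polynomial `P_X(t) = (3/2)t(t+1) + 1` of the cubic surface. -/
def PXcubic (t : ℕ) : ℕ := 3 * (t * (t + 1) / 2) + 1

/-- The saturated homogeneous ideal of an integral curve lying on `X`. -/
def IsCurveIdealOn (S : SmoothCubicSurface k) (I : Ideal (R4 k)) : Prop :=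
  IsHomogIdeal k I ∧ I.IsPrime ∧ S.f ∈ I ∧
    ringKrullDim (R4 k ⧸ I) = ((2 : ℕ∞) : WithBot ℕ∞)

/-- The Jacobian criterion at a point of the cone: some 2×2 minor of the Jacobian
matrix of elements of `I` is nonzero, i.e. the curve is smooth there. -/
def CurveSmoothAt (I : Ideal (R4 k)) (v : Fin 4 → k) : Prop :=
  ∃ g₁ ∈ I, ∃ g₂ ∈ I, ∃ i j : Fin 4,
    eval v (pderiv i g₁) * eval v (pderiv j g₂)
      - eval v (pderiv j g₁) * eval v (pderiv i g₂) ≠ 0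

/-- A smooth (integral) curve on `X`. -/
def IsSmoothCurveIdealOn (S : SmoothCubicSurface k) (I : Ideal (R4 k)) : Prop :=
  IsCurveIdealOn k S I ∧
  ∀ v : Fin 4 → k, v ≠ 0 → (∀ g ∈ I, eval v g = 0) → CurveSmoothAt k I v

/-- The coordinate ring `R/I` of a curve has depth 2 (a regular sequence of two
positive-degree homogeneous elements), i.e. the curve is arithmetically
Cohen–Macaulay. -/
def IsACMIdeal (I : Ideal (R4 k)) : Prop :=
  ∃ r₁ r₂ : R4 k,
    (∃ d₁ : ℕ, 0 < d₁ ∧ r₁.IsHomogeneous d₁) ∧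
    (∃ d₂ : ℕ, 0 < d₂ ∧ r₂.IsHomogeneous d₂) ∧
    (∀ x : R4 k, r₁ * x ∈ I → x ∈ I) ∧
    (∀ x : R4 k, r₂ * x ∈ I ⊔ Ideal.span {r₁} → x ∈ I ⊔ Ideal.span {r₁})

/-- The Hilbert function `t ↦ dim_k (R/I)_t`. -/
def hilbFn (I : Ideal (R4 k)) (t : ℕ) : ℕ :=
  Module.finrank k ↥(homogeneousSubmodule (Fin 4) k t) -
    Module.finrank k ↥(homogeneousSubmodule (Fin 4) k t ⊓
      Submodule.restrictScalars k I)

/-- The subscheme with saturated ideal `I` has degree `d` and (arithmetic) genus `g`,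
read off from the Hilbert polynomial `P(t) = d·t + 1 - g`. -/
def HasDegreeGenus (I : Ideal (R4 k)) (d : ℕ) (g : ℤ) : Prop :=
  ∃ N : ℕ, ∀ t : ℕ, N ≤ t → (hilbFn k I t : ℤ) = d * t + 1 - g

/-- Linear equivalence of divisors on `X`: the divisor with (divisorial) ideal `I`
is linearly equivalent to (divisor of `J`) + `a·H`, where `H` is the hyperplane
class.  Concretely, there are homogeneous forms `q, p` with `deg p = deg q + a`,
nonzero on `X`, with `q·I = p·J` in `R_X = R/(f)`.  (Taking `J = ⊤` expresses
that the divisor of `I` is linearly equivalent to `aH`.) -/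
def LinEquivOnX (S : SmoothCubicSurface k) (I J : Ideal (R4 k)) (a : ℤ) : Prop :=
  ∃ (mq mp : ℕ) (q p : R4 k), (mp : ℤ) = (mq : ℤ) + a ∧
    q.IsHomogeneous mq ∧ p.IsHomogeneous mp ∧
    q ∉ Ideal.span {S.f} ∧ p ∉ Ideal.span {S.f} ∧
    Ideal.span {q} * I ⊔ Ideal.span {S.f} = Ideal.span {p} * J ⊔ Ideal.span {S.f}

/-- Linear equivalence, on the curve `C` with ideal `IC`, of the divisor with
ideal `IG` to `r·H_C` (`H_C` the hyperplane section of `C`): there are homogeneous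
forms `q, p`, nonzero on `C`, with `deg p = deg q + r` and `q·I_{G,C} = (p)` in
`R/I_C`. -/
def DivOnCurveEquivH (IC IG : Ideal (R4 k)) (r : ℤ) : Prop :=
  ∃ (mq mp : ℕ) (q p : R4 k), (mp : ℤ) = (mq : ℤ) + r ∧
    q.IsHomogeneous mq ∧ p.IsHomogeneous mp ∧ q ∉ IC ∧ p ∉ IC ∧
    Ideal.span {q} * IG ⊔ IC = Ideal.span {p} ⊔ IC

/-- The saturated homogeneous ideal of a zero-dimensional subscheme of `ℙ³`. -/
def IsZeroDimIdeal (I : Ideal (R4 k)) : Prop :=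
  IsHomogIdeal k I ∧ satIdeal k I = I ∧
    ringKrullDim (R4 k ⧸ I) = ((1 : ℕ∞) : WithBot ℕ∞)

/-- An arithmetically Gorenstein zero-dimensional subscheme of `ℙ³`: its ideal has a
graded minimal free resolution of length 3 whose last free module has rank one. -/
def IsAGPointsIdeal (I : Ideal (R4 k)) : Prop :=
  IsZeroDimIdeal k I ∧
  ∃ (n1 n2 : ℕ) (d1 : Fin n1 → ℕ) (d2 : Fin n2 → ℕ) (s : ℕ),
    HasMinFreeRes3 k ⊥ I d1 d2 (fun _ : Fin 1 => s)

/-- `V₁` and `V₂` are directly Gorenstein linked by the arithmetically Gorenstein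
scheme with ideal `IG`: `I_G ⊆ I_{V₁} ∩ I_{V₂}`, `I_G : I_{V₁} = I_{V₂}` and
`I_G : I_{V₂} = I_{V₁}`. -/
def IsGLinked (IG I1 I2 : Ideal (R4 k)) : Prop :=
  IG ≤ I1 ⊓ I2 ∧ icolon k IG I1 = I2 ∧ icolon k IG I2 = I1

/-- The divisor `G` (with ideal `IG`) on the curve `C ⊂ X` (with ideal `IC`) is
linearly equivalent to `m·H_C - K_C`.  By adjunction on the cubic surface
(`K_X = -H`) this says `G + C|_C ∼ (m+1)·H_C` on `C`, where `C|_C` is realized as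
the scheme-theoretic intersection `C ∩ C'` with any curve `C' ∼ C`, `C' ≠ C`,
chosen disjoint from `G`. -/
def EquivHminusKC (S : SmoothCubicSurface k) (IC IG : Ideal (R4 k)) (m : ℤ) : Prop :=
  ∃ IC' : Ideal (R4 k), IsCurveIdealOn k S IC' ∧ IC' ≠ IC ∧
    LinEquivOnX k S IC' IC 0 ∧
    satIdeal k (satIdeal k (IC ⊔ IC') ⊔ IG) = ⊤ ∧
    DivOnCurveEquivH k IC (IG ⊓ satIdeal k (IC ⊔ IC')) (m + 1)

/-- A line on `X`: a smooth integral curve of degree 1, genus 0 on `X`. -/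
def IsLineOn (S : SmoothCubicSurface k) (I : Ideal (R4 k)) : Prop :=
  IsSmoothCurveIdealOn k S I ∧ HasDegreeGenus k I 1 0

/-- A smooth conic on `X`: a smooth integral curve of degree 2, genus 0 on `X`. -/
def IsConicOn (S : SmoothCubicSurface k) (I : Ideal (R4 k)) : Prop :=
  IsSmoothCurveIdealOn k S I ∧ HasDegreeGenus k I 2 0

/-- A twisted cubic on `X`: a smooth integral curve of degree 3, genus 0 on `X`. -/
def IsTwistedCubicOn (S : SmoothCubicSurface k) (I : Ideal (R4 k)) : Prop :=
  IsSmoothCurveIdealOn k S I ∧ HasDegreeGenus k I 3 0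

/-- The curve `C ⊂ X` moves in a linear system of (projective) dimension `dim`,
i.e. `h⁰(O_X(C)) = dim + 1`.  Global sections of `O_X(C)` are computed, for any
homogeneous `q ∈ I_C` of degree `s` not divisible by `f`, as the degree-`s` part of
the colon ideal `((q, f) : I_C)` modulo `(f)`. -/
def MovesInLinSysOfDim (S : SmoothCubicSurface k) (IC : Ideal (R4 k)) (dim : ℤ) : Prop :=
  ∀ (s : ℕ) (q : R4 k), q.IsHomogeneous s → q ∈ IC → q ∉ Ideal.span {S.f} →
    (Module.finrank k ↥(homogeneousSubmodule (Fin 4) k s ⊓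
        Submodule.restrictScalars k (icolon k (Ideal.span {q} ⊔ Ideal.span {S.f}) IC)) : ℤ)
      - (Module.finrank k ↥(homogeneousSubmodule (Fin 4) k s ⊓
        Submodule.restrictScalars k (icolon k (Ideal.span {q} ⊔ Ideal.span {S.f}) IC) ⊓
        Submodule.restrictScalars k (Ideal.span {S.f})) : ℤ) = dim + 1

/-- `I/(f₀)` is a maximal Cohen–Macaulay module over `R/(f₀)` (3-dimensional):
it admits a regular sequence of three positive-degree homogeneous elements. -/
def IsMCMQuotient (f0 : R4 k) (I : Ideal (R4 k)) : Prop :=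
  ∃ r₁ r₂ r₃ : R4 k,
    (∃ d : ℕ, 0 < d ∧ r₁.IsHomogeneous d) ∧
    (∃ d : ℕ, 0 < d ∧ r₂.IsHomogeneous d) ∧
    (∃ d : ℕ, 0 < d ∧ r₃.IsHomogeneous d) ∧
    (∀ x ∈ I, r₁ * x ∈ Ideal.span {f0} → x ∈ Ideal.span {f0}) ∧
    (∀ x ∈ I, r₂ * x ∈ Ideal.span {r₁} * I ⊔ Ideal.span {f0} →
      x ∈ Ideal.span {r₁} * I ⊔ Ideal.span {f0}) ∧
    (∀ x ∈ I, r₃ * x ∈ Ideal.span {r₁} * I ⊔ Ideal.span {r₂} * I ⊔ Ideal.span {f0} →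
      x ∈ Ideal.span {r₁} * I ⊔ Ideal.span {r₂} * I ⊔ Ideal.span {f0}) ∧
    (∃ x ∈ I, x ∉ Ideal.span {r₁} * I ⊔ Ideal.span {r₂} * I ⊔ Ideal.span {r₃} * I
      ⊔ Ideal.span {f0})

end

/-- A vector outside a subspace of `ι → k` is separated from it by a dot product. -/
theorem exists_dotProduct_separating {k ι : Type} [Field k] [Fintype ι]
    (U : Submodule k (ι → k)) (h : ι → k) (hU : h ∉ U) :
    ∃ c : ι → k, (∀ u ∈ U, ∑ i, c i * u i = 0) ∧ ∑ i, c i * h i ≠ 0 := by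
  classical
  obtain ⟨φ, hφ, hle⟩ := U.exists_le_ker_of_notMem hU
  have key : ∀ u : ι → k, ∑ i, φ (Pi.single i 1) * u i = φ u := by
    intro u
    conv_rhs => rw [LinearMap.pi_apply_eq_sum_univ φ u]
    refine Finset.sum_congr rfl fun i _ => ?_
    rw [smul_eq_mul, mul_comm]
    congr 2
    funext j
    simp [Pi.single_apply, eq_comm]
  refine ⟨fun i => φ (Pi.single i 1), fun u hu => ?_, ?_⟩
  · rw [key]; exact hle hu
  · rw [key]; exact hφ

theorem sum_swap_antisymm {k : Type} [Field k] (lam : Fin 4 → k) (d : Fin 4 → Fin 4 → k)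
    (hd : ∀ a b, d a b = - d b a) (h0 : ∀ a, d a a = 0) :
    ∑ a, lam a * ∑ b, lam b * d a b = 0 := by
  simp only [Fin.sum_univ_four, h0]
  rw [hd 1 0, hd 2 0, hd 3 0, hd 2 1, hd 3 1, hd 3 2]
  ring

section Duality

variable {k : Type} [Field k] {N : ℕ}

/-- Surjectivity of the Koszul-type map in degree one, dual to the injectivity hypothesis `hs`. -/
theorem exists_koszul_one (E : Submodule k (Fin N → k)) (x : Fin 4 → Fin N → k)
    (lam : Fin 4 → k) (hlam : ∀ i, ∑ m, lam m * x m i = 1)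
    (hs : ∀ w : Fin 4 → Fin N → k, (∀ m, ∀ q ∈ E, ∑ i, w m i * q i = 0) →
      (∀ i, ∑ m, x m i * w m i = 0) → w = 0)
    (h : Fin 4 → Fin N → k) (hh : ∀ i, ∑ m, x m i * h m i = 0) :
    ∃ β : Fin 4 → Fin 4 → Fin N → k, (∀ a b, β a b ∈ E) ∧
      ∀ a i, h a i = ∑ b, x b i * (β a b i - β b a i) := by
  classical
  let L : (Fin 4 → Fin 4 → E) →ₗ[k] (Fin 4 × Fin N → k) :=
    { toFun := fun β p => ∑ b, x b p.2 * ((β p.1 b : Fin N → k) p.2 - (β b p.1 : Fin N → k) p.2)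
      map_add' := by
        intro β γ; funext p
        simp only [Pi.add_apply, Submodule.coe_add, ← Finset.sum_add_distrib]
        exact Finset.sum_congr rfl fun _ _ => by ring
      map_smul' := by
        intro c β; funext p
        simp only [Pi.smul_apply, Submodule.coe_smul, smul_eq_mul, RingHom.id_apply,
          Finset.mul_sum]
        exact Finset.sum_congr rfl fun _ _ => by ring }
  by_cases hmem : (fun p : Fin 4 × Fin N => h p.1 p.2) ∈ LinearMap.range L
  · obtain ⟨β, hβ⟩ := hmem
    exact ⟨fun a b => β a b, fun a b => (β a b).2, fun a i => (congrFun hβ (a, i)).symm⟩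
  exfalso
  obtain ⟨c, hc, hch⟩ := exists_dotProduct_separating _ _ hmem
  apply hch
  have hw : ∀ a b, ∀ q ∈ E, ∑ i, (c (a, i) * x b i - c (b, i) * x a i) * q i = 0 := by
    intro a b q hq
    have h1 := hc _ ⟨fun a' b' => if a' = a ∧ b' = b then ⟨q, hq⟩ else 0, rfl⟩
    have h2 : ∀ (P : Prop) [Decidable P] (i : Fin N),
        ((if P then (⟨q, hq⟩ : E) else 0 : E) : Fin N → k) i = if P then q i else 0 := by
      intro P _ i; split_ifs <;> simp
    simp only [L, LinearMap.coe_mk, AddHom.coe_mk, h2, Fintype.sum_prod_type] at h1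
    rw [← h1, Finset.sum_comm]
    refine Finset.sum_congr rfl fun i _ => ?_
    simp only [mul_sub, Finset.sum_sub_distrib, mul_ite, mul_zero, ite_and, Finset.sum_ite_eq',
      Finset.mem_univ, if_true]
    have h3 : ∀ a' : Fin 4, (∑ b', if a' = a then if b' = b then x b' i * q i else 0 else 0)
        = if a' = a then x b i * q i else 0 := by
      intro a'; split_ifs <;> simp
    simp only [h3, mul_ite, mul_zero, Finset.sum_ite_eq', Finset.mem_univ, if_true]
    ring
  obtain ⟨δ, hδ⟩ : ∃ δ : Fin N → k, ∀ i, δ i = ∑ m, lam m * c (m, i) := ⟨_, fun _ => rfl⟩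
  obtain ⟨w, hwd⟩ : ∃ w : Fin 4 → Fin 4 → Fin N → k,
      ∀ a b i, w a b i = c (a, i) * x b i - c (b, i) * x a i := ⟨_, fun _ _ _ => rfl⟩
  obtain ⟨e, he⟩ : ∃ e : Fin 4 → Fin N → k, ∀ a i, e a i = c (a, i) - x a i * δ i :=
    ⟨_, fun _ _ => rfl⟩
  have hew : ∀ a i, e a i = ∑ b, lam b * w a b i := by
    intro a i
    simp only [he, hwd, hδ]
    have h1 := hlam i
    simp only [Fin.sum_univ_four] at h1 ⊢
    linear_combination (-c (a, i)) * h1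
  have hlame : ∀ i, ∑ a, lam a * e a i = 0 := by
    intro i
    simp only [he]
    have h1 := hlam i
    have h2 := hδ i
    simp only [Fin.sum_univ_four] at h1 h2 ⊢
    linear_combination (-δ i) * h1 - h2
  have hwE : ∀ a b, ∀ q ∈ E, ∑ i, w a b i * q i = 0 := by
    intro a b q hq; simp only [hwd]; exact hw a b q hq
  have heE : ∀ a, ∀ q ∈ E, ∑ i, e a i * q i = 0 := by
    intro a q hq
    have : ∑ i, e a i * q i = ∑ b, lam b * ∑ i, w a b i * q i := by
      simp only [hew, Finset.sum_mul, Finset.mul_sum]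
      rw [Finset.sum_comm]
      exact Finset.sum_congr rfl fun _ _ => Finset.sum_congr rfl fun _ _ => by ring
    rw [this]; simp [hwE a _ q hq]
  have hwe : ∀ a b i, w a b i = e a i * x b i - e b i * x a i := by
    intro a b i; simp only [hwd, he]; ring
  have hrel : ∀ a b m i, (if m = b then e a i else 0) - (if m = a then e b i else 0)
      - lam m * w a b i = 0 := by
    intro a b m i
    have := hs (fun m i => (if m = b then e a i else 0) - (if m = a then e b i else 0)
      - lam m * w a b i) ?_ ?_
    · exact congrFun (congrFun this m) i
    · intro m q hq
      have h1 := heE a q hq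
      have h2 := heE b q hq
      have h3 := hwE a b q hq
      simp only [sub_mul, Finset.sum_sub_distrib, mul_assoc, ← Finset.mul_sum, ite_mul, zero_mul,
        h3, mul_zero, sub_zero]
      split_ifs <;> simp [h1, h2]
    · intro i
      simp only [mul_sub, Finset.sum_sub_distrib, mul_ite, mul_zero, Finset.sum_ite_eq',
        Finset.mem_univ, if_true]
      have h1 := hlam i
      have h2 := hwe a b i
      simp only [Fin.sum_univ_four] at h1 ⊢
      linear_combination (-h2) - (w a b i) * h1
  have hezero : ∀ a i, e a i = 0 := by
    intro a i
    obtain ⟨m0, hm0⟩ : ∃ m, lam m ≠ 0 := by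
      by_contra hcon
      push Not at hcon
      have := hlam i
      simp [hcon] at this
    have hne : ∀ a, a ≠ m0 → e a i = 0 := by
      intro a ha
      obtain ⟨b, hb, hba⟩ := (by decide : ∀ m a : Fin 4, ∃ b, b ≠ m ∧ b ≠ a) m0 a
      have h1 := hrel a b m0 i
      have h2 := hrel a b b i
      simp only [hb.symm, ha.symm, if_false, sub_zero, zero_sub, neg_eq_zero] at h1
      have h3 : w a b i = 0 := (mul_eq_zero.mp h1).resolve_left hm0
      simpa [hba, h3] using h2
    by_cases ha : a = m0
    · have h1 := hlame i
      rw [Finset.sum_eq_single m0 (fun b _ hb => by rw [hne b hb, mul_zero]) (by simp)] at h1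
      rw [ha]; exact (mul_eq_zero.mp h1).resolve_left hm0
    · exact hne a ha
  rw [Fintype.sum_prod_type, Finset.sum_comm]
  refine Finset.sum_eq_zero fun i _ => ?_
  have h1 := hh i
  have h2 : ∀ a, c (a, i) = x a i * δ i := fun a => by
    have := he a i
    rw [hezero] at this
    linear_combination -this
  simp only [h2]
  rw [← mul_zero (δ i), ← h1, Finset.mul_sum]
  exact Finset.sum_congr rfl fun _ _ => by ring

/-- Surjectivity of the Koszul-type map in degree two, dual to the injectivity hypothesis `hs`. -/
theorem exists_koszul_two (E : Submodule k (Fin N → k)) (x : Fin 4 → Fin N → k)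
    (lam : Fin 4 → k) (hlam : ∀ i, ∑ m, lam m * x m i = 1)
    (hs : ∀ w : Fin 4 → Fin N → k, (∀ m, ∀ q ∈ E, ∑ i, w m i * q i = 0) →
      (∀ i, ∑ m, x m i * w m i = 0) → w = 0)
    (h : Fin 4 → Fin 4 → Fin N → k) (hanti : ∀ a b i, h a b i = - h b a i)
    (hdiag : ∀ a i, h a a i = 0) (hh : ∀ a i, ∑ b, x b i * h a b i = 0) :
    ∃ β : Fin 4 → Fin 4 → Fin 4 → Fin N → k, (∀ a b c, β a b c ∈ E) ∧
      ∀ a b i, h a b i = ∑ c, x c i * (β a b c i + β b c a i + β c a b i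
        - β b a c i - β a c b i - β c b a i) := by
  classical
  let L : (Fin 4 → Fin 4 → Fin 4 → E) →ₗ[k] ((Fin 4 × Fin 4) × Fin N → k) :=
    { toFun := fun β p => ∑ c, x c p.2 * ((β p.1.1 p.1.2 c : Fin N → k) p.2
          + (β p.1.2 c p.1.1 : Fin N → k) p.2 + (β c p.1.1 p.1.2 : Fin N → k) p.2
          - (β p.1.2 p.1.1 c : Fin N → k) p.2 - (β p.1.1 c p.1.2 : Fin N → k) p.2
          - (β c p.1.2 p.1.1 : Fin N → k) p.2)
      map_add' := by
        intro β γ; funext p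
        simp only [Pi.add_apply, Submodule.coe_add, ← Finset.sum_add_distrib]
        exact Finset.sum_congr rfl fun _ _ => by ring
      map_smul' := by
        intro c β; funext p
        simp only [Pi.smul_apply, Submodule.coe_smul, smul_eq_mul, RingHom.id_apply,
          Finset.mul_sum]
        exact Finset.sum_congr rfl fun _ _ => by ring }
  by_cases hmem : (fun p : (Fin 4 × Fin 4) × Fin N => h p.1.1 p.1.2 p.2) ∈ LinearMap.range L
  · obtain ⟨β, hβ⟩ := hmem
    exact ⟨fun a b c => β a b c, fun a b c => (β a b c).2,
      fun a b i => (congrFun hβ ((a, b), i)).symm⟩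
  exfalso
  obtain ⟨c', hc, hch⟩ := exists_dotProduct_separating _ _ hmem
  apply hch
  obtain ⟨c, hcc⟩ : ∃ c : Fin 4 → Fin 4 → Fin N → k, ∀ a b i, c a b i = c' ((a, b), i) :=
    ⟨_, fun _ _ _ => rfl⟩
  obtain ⟨d, hd⟩ : ∃ d : Fin 4 → Fin 4 → Fin N → k, ∀ a b i, d a b i = c a b i - c b a i :=
    ⟨_, fun _ _ _ => rfl⟩
  obtain ⟨w, hwd⟩ : ∃ w : Fin 4 → Fin 4 → Fin 4 → Fin N → k,
      ∀ a b m i, w a b m i = d a b i * x m i + d b m i * x a i + d m a i * x b i :=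
    ⟨_, fun _ _ _ _ => rfl⟩
  have hwE : ∀ a b m, ∀ q ∈ E, ∑ i, w a b m i * q i = 0 := by
    intro a b m q hq
    have h1 := hc _ ⟨fun a' b' m' => if a' = a then (if b' = b then (if m' = m then ⟨q, hq⟩
      else 0) else 0) else 0, rfl⟩
    have h2 : ∀ (P Q R : Prop) [Decidable P] [Decidable Q] [Decidable R] (i : Fin N),
        ((if P then (if Q then (if R then (⟨q, hq⟩ : E) else 0) else 0) else 0 : E) :
          Fin N → k) i = if P then (if Q then (if R then q i else 0) else 0) else 0 := by
      intro P Q R _ _ _ i; split_ifs <;> simp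
    simp only [L, LinearMap.coe_mk, AddHom.coe_mk, h2, Fintype.sum_prod_type] at h1
    have h4 : ∀ f : Fin 4 → Fin 4 → Fin N → k,
        ∑ a', ∑ b', ∑ i, f a' b' i = ∑ i, ∑ a', ∑ b', f a' b' i := by
      intro f
      rw [Finset.sum_comm]
      simp_rw [Finset.sum_comm (s := (Finset.univ : Finset (Fin 4)))
        (t := (Finset.univ : Finset (Fin N)))]
      exact Finset.sum_congr rfl fun i _ => Finset.sum_comm
    rw [h4] at h1
    rw [← h1]
    refine Finset.sum_congr rfl fun i _ => ?_
    simp only [hwd, hd, hcc]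
    simp only [mul_sub, mul_add, Finset.sum_sub_distrib, Finset.sum_add_distrib]
    have h5 : ∀ (u v : Fin 4) (z : Fin 4 → k), (∑ b', if b' = u then z b' else 0) = z u :=
      fun u v z => by simp
    have h6 : ∀ (P : Prop) [Decidable P] (z : Fin 4 → k),
        (∑ b', if P then z b' else 0) = if P then ∑ b', z b' else 0 := by
      intro P _ z; split_ifs <;> simp
    simp only [mul_ite, mul_zero, h6, Finset.sum_ite_eq', Finset.mem_univ, if_true]
    ring
  have hdanti : ∀ a b i, d a b i = - d b a i := fun a b i => by simp only [hd]; ring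
  have hddiag : ∀ a i, d a a i = 0 := fun a i => by simp only [hd]; ring
  obtain ⟨δ, hδ⟩ : ∃ δ : Fin 4 → Fin N → k, ∀ b i, δ b i = ∑ m, lam m * d m b i :=
    ⟨_, fun _ _ => rfl⟩
  have hlamδ : ∀ i, ∑ b, lam b * δ b i = 0 := by
    intro i
    have h1 := sum_swap_antisymm lam (fun a b => d b a i) (fun a b => hdanti b a i)
      (fun a => hddiag a i)
    simp only [hδ]
    exact h1
  obtain ⟨e, he⟩ : ∃ e : Fin 4 → Fin 4 → Fin N → k,
      ∀ a b i, e a b i = d a b i - (x a i * δ b i - x b i * δ a i) := ⟨_, fun _ _ _ => rfl⟩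
  have heanti : ∀ a b i, e a b i = - e b a i := fun a b i => by
    simp only [he]; rw [hdanti]; ring
  have hew : ∀ a b i, e a b i = ∑ m, lam m * w a b m i := by
    intro a b i
    have h1 := hlam i
    have h2 := hδ a i
    have h3 := hδ b i
    have h4 : ∀ m, d b m i = - d m b i := fun m => hdanti _ _ _
    simp only [he, hwd, h4]
    simp only [Fin.sum_univ_four] at h1 h2 h3 ⊢
    linear_combination (-(d a b i)) * h1 - x a i * h3 + x b i * h2
  have hlame : ∀ b i, ∑ a, lam a * e a b i = 0 := by
    intro b i
    have h1 := hlam i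
    have h2 := hδ b i
    have h3 := hlamδ i
    simp only [he]
    simp only [Fin.sum_univ_four] at h1 h2 h3 ⊢
    linear_combination (-δ b i) * h1 - h2 + x b i * h3
  have heE : ∀ a b, ∀ q ∈ E, ∑ i, e a b i * q i = 0 := by
    intro a b q hq
    have : ∑ i, e a b i * q i = ∑ m, lam m * ∑ i, w a b m i * q i := by
      simp only [hew, Finset.sum_mul, Finset.mul_sum]
      rw [Finset.sum_comm]
      exact Finset.sum_congr rfl fun _ _ => Finset.sum_congr rfl fun _ _ => by ring
    rw [this]; simp [hwE a b _ q hq]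
  have hwe : ∀ a b m i, w a b m i = e a b i * x m i + e b m i * x a i + e m a i * x b i := by
    intro a b m i; simp only [hwd, he]; ring
  have hrel : ∀ a b m l i, (if l = m then e a b i else 0) + (if l = a then e b m i else 0)
      + (if l = b then e m a i else 0) - lam l * w a b m i = 0 := by
    intro a b m l i
    have := hs (fun l i => (if l = m then e a b i else 0) + (if l = a then e b m i else 0)
      + (if l = b then e m a i else 0) - lam l * w a b m i) ?_ ?_
    · exact congrFun (congrFun this l) i
    · intro l q hq
      have h1 := heE a b q hq
      have h2 := heE b m q hq
      have h3 := heE m a q hq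
      have h4 := hwE a b m q hq
      simp only [sub_mul, add_mul, Finset.sum_sub_distrib, Finset.sum_add_distrib, mul_assoc,
        ← Finset.mul_sum, ite_mul, zero_mul, h4, mul_zero, sub_zero]
      split_ifs <;> simp [h1, h2, h3]
    · intro i
      simp only [mul_sub, mul_add, Finset.sum_sub_distrib, Finset.sum_add_distrib, mul_ite,
        mul_zero, Finset.sum_ite_eq', Finset.mem_univ, if_true]
      have h1 := hlam i
      have h2 := hwe a b m i
      simp only [Fin.sum_univ_four] at h1 ⊢
      linear_combination (-h2) - (w a b m i) * h1
  have hezero : ∀ a b i, e a b i = 0 := by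
    intro a b i
    obtain ⟨m0, hm0⟩ : ∃ m, lam m ≠ 0 := by
      by_contra hcon
      push Not at hcon
      have := hlam i
      simp [hcon] at this
    have hself : ∀ a, e a a i = 0 := by
      intro a; simp [he, hddiag]
    have hne : ∀ a b, a ≠ m0 → b ≠ m0 → e a b i = 0 := by
      intro a b ha hb
      by_cases hab : a = b
      · rw [hab]; exact hself b
      obtain ⟨m, hm, hma, hmb⟩ :=
        (by decide : ∀ u a b : Fin 4, ∃ m, m ≠ u ∧ m ≠ a ∧ m ≠ b) m0 a b
      have h1 := hrel a b m m0 i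
      have h2 := hrel a b m m i
      simp only [hm.symm, ha.symm, hb.symm, if_false, zero_sub, neg_eq_zero, add_zero] at h1
      have h3 : w a b m i = 0 := (mul_eq_zero.mp h1).resolve_left hm0
      simpa [hma, hmb, h3] using h2
    have hm0b : ∀ b, e m0 b i = 0 := by
      intro b
      by_cases hb : b = m0
      · rw [hb]; exact hself m0
      have h1 := hlame b i
      rw [Finset.sum_eq_single m0 (fun a _ ha => by rw [hne a b ha hb, mul_zero]) (by simp)] at h1
      exact (mul_eq_zero.mp h1).resolve_left hm0
    by_cases ha : a = m0
    · rw [ha]; exact hm0b b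
    · by_cases hb : b = m0
      · rw [heanti, hb, hm0b, neg_zero]
      · exact hne a b ha hb
  have hcd : ∀ a b i, c a b i = c b a i + (x a i * δ b i - x b i * δ a i) := fun a b i => by
    have h1 := hezero a b i
    rw [he, hd] at h1
    linear_combination h1
  have hfin : ∀ i, ∑ a, ∑ b, c a b i * h a b i = 0 := by
    intro i
    have hz : ∀ b, ∑ a, x a i * h b a i = 0 := fun b => hh b i
    have z0 := hz 0
    have z1 := hz 1
    have z2 := hz 2
    have z3 := hz 3
    simp only [Fin.sum_univ_four, hdiag, hanti 1 0, hanti 2 0, hanti 3 0, hanti 2 1, hanti 3 1,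
      hanti 3 2] at z0 z1 z2 z3 ⊢
    rw [hcd 0 1, hcd 0 2, hcd 0 3, hcd 1 2, hcd 1 3, hcd 2 3]
    linear_combination (-δ 0 i) * z0 - δ 1 i * z1 - δ 2 i * z2 - δ 3 i * z3
  rw [Fintype.sum_prod_type, Fintype.sum_prod_type]
  simp only [← hcc]
  calc ∑ a, ∑ b, ∑ i, c a b i * h a b i = ∑ i, ∑ a, ∑ b, c a b i * h a b i := by
        rw [Finset.sum_comm]
        simp_rw [Finset.sum_comm (s := (Finset.univ : Finset (Fin 4)))
          (t := (Finset.univ : Finset (Fin N)))]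
        exact Finset.sum_congr rfl fun i _ => Finset.sum_comm
    _ = 0 := Finset.sum_eq_zero fun i _ => hfin i

end Duality

section Homogeneous

variable {k : Type} [Field k]

theorem homogeneousComponent_add_mul {σ : Type} {a : MvPolynomial σ k} {c : ℕ}
    (ha : a.IsHomogeneous c) (q : MvPolynomial σ k) (d : ℕ) :
    homogeneousComponent (c + d) (a * q) = a * homogeneousComponent d q := by
  classical
  have hq := sum_homogeneousComponent q
  conv_lhs => rw [← hq, Finset.mul_sum, map_sum]
  have h1 : ∀ i ∈ Finset.range (q.totalDegree + 1),
      homogeneousComponent (c + d) (a * homogeneousComponent i q) =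
        if i = d then a * homogeneousComponent d q else 0 := by
    intro i _
    have hm : (a * homogeneousComponent i q).IsHomogeneous (c + i) :=
      ha.mul (homogeneousComponent_isHomogeneous i q)
    rw [homogeneousComponent_of_mem hm]
    by_cases h : i = d
    · subst h; simp
    · rw [if_neg h, if_neg (by omega)]
  rw [Finset.sum_congr rfl h1, Finset.sum_ite_eq']
  split_ifs with h
  · rfl
  · rw [homogeneousComponent_eq_zero, mul_zero]
    simpa using h

/-- Homogeneous coefficients may be chosen in a homogeneous combination. -/
theorem sum_homogeneousComponent_mul {σ ι : Type} [Fintype ι] {c d : ℕ}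
    {a q : ι → MvPolynomial σ k} (ha : ∀ i, (a i).IsHomogeneous c)
    {p : MvPolynomial σ k} (hp : p.IsHomogeneous (c + d)) (h : p = ∑ i, a i * q i) :
    p = ∑ i, a i * homogeneousComponent d (q i) := by
  have h1 : homogeneousComponent (c + d) p = p := by
    rw [homogeneousComponent_of_mem hp, if_pos rfl]
  calc p = homogeneousComponent (c + d) p := h1.symm
    _ = _ := by
      rw [h, map_sum]
      exact Finset.sum_congr rfl fun i _ => homogeneousComponent_add_mul (ha i) _ _

theorem homogeneousComponent_sum_mul_eq_zero {σ ι : Type} [Fintype ι] {c : ℕ}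
    {a q : ι → MvPolynomial σ k} (ha : ∀ i, (a i).IsHomogeneous c)
    (h : ∑ i, q i * a i = 0) (d : ℕ) :
    ∑ i, homogeneousComponent d (q i) * a i = 0 := by
  have h' : (0 : MvPolynomial σ k) = ∑ i, a i * q i := by
    rw [← h]; exact Finset.sum_congr rfl fun i _ => mul_comm _ _
  have := sum_homogeneousComponent_mul (d := d) ha (isHomogeneous_zero _ _ _) h'
  rw [this]
  exact Finset.sum_congr rfl fun i _ => mul_comm _ _

theorem sum_range_homogeneousComponent {σ : Type} (p : MvPolynomial σ k) {D : ℕ}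
    (hD : p.totalDegree < D) : ∑ d ∈ Finset.range D, homogeneousComponent d p = p := by
  conv_rhs => rw [← sum_homogeneousComponent p]
  refine (Finset.sum_subset ?_ ?_).symm
  · intro i hi; simp at hi ⊢; omega
  · intro i _ hi
    exact homogeneousComponent_eq_zero _ _ (by simpa using hi)

/-- A vector all of whose homogeneous components are combinations of the rows of a matrix is
itself such a combination. -/
theorem exists_combination_of_components {σ : Type} {a b : ℕ}
    (A : Fin a → Fin b → MvPolynomial σ k) (u : Fin b → MvPolynomial σ k)
    (h : ∀ d, ∃ t : Fin a → MvPolynomial σ k,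
      ∀ i, homogeneousComponent d (u i) = ∑ l, t l * A l i) :
    ∃ t : Fin a → MvPolynomial σ k, ∀ i, u i = ∑ l, t l * A l i := by
  choose t ht using h
  let D := (Finset.univ.sup fun i => (u i).totalDegree) + 1
  refine ⟨fun l => ∑ d ∈ Finset.range D, t d l, fun i => ?_⟩
  have hD : (u i).totalDegree < D :=
    Nat.lt_succ_of_le (Finset.le_sup (f := fun i => (u i).totalDegree) (Finset.mem_univ i))
  conv_lhs => rw [← sum_range_homogeneousComponent (u i) hD]
  simp_rw [ht, Finset.sum_mul]
  exact Finset.sum_comm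

theorem exists_eq_sum_X_mul {p : R4 k} {d : ℕ} (hp : p.IsHomogeneous (d + 1)) :
    ∃ q : Fin 4 → R4 k, (∀ i, (q i).IsHomogeneous d) ∧ p = ∑ i, X i * q i := by
  have hmem : p ∈ Ideal.span ((X : Fin 4 → R4 k) '' Set.univ) := by
    rw [mem_ideal_span_X_image]
    intro m hm
    by_contra hcon
    push Not at hcon
    have hm0 : m = 0 := by
      ext i; simpa using hcon i (Set.mem_univ i)
    have := hp (mem_support_iff.mp hm)
    subst hm0
    simp at this
  rw [Set.image_univ, Ideal.mem_span_range_iff_exists_fun] at hmem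
  obtain ⟨c, hc⟩ := hmem
  refine ⟨fun i => homogeneousComponent d (c i), fun i => homogeneousComponent_isHomogeneous _ _, ?_⟩
  refine sum_homogeneousComponent_mul (fun i => isHomogeneous_X k i) (by rwa [add_comm]) ?_
  rw [← hc]
  exact Finset.sum_congr rfl fun i _ => mul_comm _ _

theorem mem_span_X_image_of_mul_X {s : Set (Fin 4)} {i : Fin 4} (hi : i ∉ s) {p : R4 k}
    (h : X i * p ∈ Ideal.span ((X : Fin 4 → R4 k) '' s)) :
    p ∈ Ideal.span ((X : Fin 4 → R4 k) '' s) := by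
  rw [mem_ideal_span_X_image] at h ⊢
  intro m hm
  have hm' : Finsupp.single i 1 + m ∈ (X i * p).support := by
    rw [mem_support_iff, coeff_X_mul]
    exact mem_support_iff.mp hm
  obtain ⟨j, hj, hne⟩ := h _ hm'
  refine ⟨j, hj, ?_⟩
  have hij : i ≠ j := fun h => hi (h ▸ hj)
  simpa [Finsupp.single_apply, hij] using hne

/-- Exactness of the Koszul complex of the variables in degree one. -/
theorem exists_koszul_X (f : Fin 4 → R4 k) (hf : ∑ i, X i * f i = 0) :
    ∃ η : Fin 4 → Fin 4 → R4 k, ∀ i, f i = ∑ j, X j * (η i j - η j i) := by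
  rw [Fin.sum_univ_four] at hf
  have h3 : f 3 ∈ Ideal.span ((X : Fin 4 → R4 k) '' {0, 1, 2}) := by
    apply mem_span_X_image_of_mul_X (i := 3) (by decide)
    rw [Set.image_insert_eq, Set.image_pair]
    rw [Ideal.mem_span_insert']
    refine ⟨f 0, ?_⟩
    rw [Ideal.mem_span_pair]
    exact ⟨-f 1, -f 2, by linear_combination -hf⟩
  rw [Set.image_insert_eq, Set.image_pair, Ideal.mem_span_insert'] at h3
  obtain ⟨a0, h3⟩ := h3
  rw [Ideal.mem_span_pair] at h3
  obtain ⟨a1, a2, h3⟩ := h3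
  have h2 : f 2 + X 3 * a2 ∈ Ideal.span ((X : Fin 4 → R4 k) '' {0, 1}) := by
    apply mem_span_X_image_of_mul_X (i := 2) (by decide)
    rw [Set.image_pair, Ideal.mem_span_pair]
    exact ⟨-f 0 + X 3 * a0, -f 1 - X 3 * a1, by linear_combination -hf - X 3 * h3⟩
  rw [Set.image_pair, Ideal.mem_span_pair] at h2
  obtain ⟨b0, b1, h2⟩ := h2
  have h1 : f 1 + X 3 * a1 + X 2 * b1 ∈ Ideal.span ((X : Fin 4 → R4 k) '' {0}) := by
    apply mem_span_X_image_of_mul_X (i := 1) (by decide)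
    rw [Set.image_singleton, Ideal.mem_span_singleton']
    exact ⟨-f 0 + X 3 * a0 - X 2 * b0, by linear_combination -hf - X 3 * h3 - X 2 * h2⟩
  rw [Set.image_singleton, Ideal.mem_span_singleton'] at h1
  obtain ⟨c, h1⟩ := h1
  have h0 : f 0 - X 3 * a0 + X 2 * b0 + X 1 * c = 0 := by
    have hX : (X 0 : R4 k) ≠ 0 := X_ne_zero 0
    apply mul_left_cancel₀ hX
    linear_combination hf + X 3 * h3 + X 2 * h2 + X 1 * h1
  refine ⟨fun i j => if i = 3 then (if j = 0 then -a0 else if j = 1 then a1 else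
    if j = 2 then a2 else 0) else if i = 2 then (if j = 0 then b0 else if j = 1 then b1 else 0)
    else if i = 1 then (if j = 0 then c else 0) else 0, fun i => ?_⟩
  fin_cases i
  · simp [Fin.sum_univ_four]; linear_combination h0
  · simp [Fin.sum_univ_four]; linear_combination -h1
  · simp [Fin.sum_univ_four]; linear_combination -h2
  · simp [Fin.sum_univ_four]; linear_combination -h3

theorem exists_koszul_X_homogeneous {d : ℕ} (f : Fin 4 → R4 k)
    (hd : ∀ i, (f i).IsHomogeneous (d + 1)) (hf : ∑ i, X i * f i = 0) :
    ∃ η : Fin 4 → Fin 4 → R4 k, (∀ i j, (η i j).IsHomogeneous d) ∧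
      ∀ i, f i = ∑ j, X j * (η i j - η j i) := by
  obtain ⟨η, hη⟩ := exists_koszul_X f hf
  refine ⟨fun i j => homogeneousComponent d (η i j),
    fun i j => homogeneousComponent_isHomogeneous _ _, fun i => ?_⟩
  have := sum_homogeneousComponent_mul (fun i => isHomogeneous_X k i)
    (by rw [add_comm]; exact hd i) (hη i)
  simpa [map_sub] using this

end Homogeneous

section VanishingForms

variable {k : Type} [Field k] {N : ℕ}

/-- Evaluation of polynomials at finitely many vectors. -/
noncomputable def evalMap (v : Fin N → Fin 4 → k) : R4 k →ₗ[k] (Fin N → k) :=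
  LinearMap.pi fun i => (aeval (v i) : R4 k →ₐ[k] k).toLinearMap

@[simp]
theorem evalMap_apply (v : Fin N → Fin 4 → k) (p : R4 k) (i : Fin N) :
    evalMap v p i = eval (v i) p := by
  simp [evalMap]

/-- The forms of degree `d` vanishing at the given vectors. -/
noncomputable def vanishingForms (v : Fin N → Fin 4 → k) (d : ℕ) : Submodule k (R4 k) :=
  homogeneousSubmodule (Fin 4) k d ⊓ LinearMap.ker (evalMap v)

theorem mem_vanishingForms {v : Fin N → Fin 4 → k} {d : ℕ} {p : R4 k} :
    p ∈ vanishingForms v d ↔ p.IsHomogeneous d ∧ ∀ i, eval (v i) p = 0 := by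
  simp [vanishingForms, funext_iff]

/-- The values at the given vectors of the forms of degree `d`. -/
noncomputable def formValues (v : Fin N → Fin 4 → k) (d : ℕ) : Submodule k (Fin N → k) :=
  (homogeneousSubmodule (Fin 4) k d).map (evalMap v)

theorem mem_formValues {v : Fin N → Fin 4 → k} {d : ℕ} {y : Fin N → k} :
    y ∈ formValues v d ↔ ∃ p : R4 k, p.IsHomogeneous d ∧ ∀ i, eval (v i) p = y i := by
  simp [formValues, funext_iff]

/-- The linear system on relations among the values of forms of degree `d` that controls the
linearity of the resolution of the ideal of the given points. -/
def KoszulCondition (v : Fin N → Fin 4 → k) (d : ℕ) : Prop :=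
  ∀ w : Fin 4 → Fin N → k,
    (∀ m, ∀ q : R4 k, q.IsHomogeneous d → ∑ i, w m i * eval (v i) q = 0) →
    (∀ i, ∑ m, v i m * w m i = 0) → w = 0

variable {v : Fin N → Fin 4 → k} {lam : Fin 4 → k} {d : ℕ}

theorem KoszulCondition.formValues_succ (hs : KoszulCondition v d)
    (hlam : ∀ i, ∑ m, lam m * v i m = 1) : formValues v (d + 1) = ⊤ := by
  by_contra hne
  obtain ⟨y, hy⟩ : ∃ y, y ∉ formValues v (d + 1) := by
    by_contra hcon
    push Not at hcon
    exact hne (Submodule.eq_top_iff'.mpr hcon)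
  obtain ⟨c, hc, hcy⟩ := exists_dotProduct_separating _ y hy
  -- the relation `c` times a suitable tuple of linear forms lies in the kernel of the system
  have hc' : ∀ p : R4 k, p.IsHomogeneous (d + 1) → ∑ i, c i * eval (v i) p = 0 := fun p hp =>
    hc _ (mem_formValues.mpr ⟨p, hp, fun i => rfl⟩)
  have key : ∀ (b : Fin 4) (i : Fin N), c i * v i b = 0 := by
    intro b i
    obtain ⟨a, hab⟩ := exists_ne b
    have := hs (fun m i => if m = a then c i * v i b else if m = b then -(c i * v i a) else 0)
      ?_ ?_
    · have := congrFun (congrFun this a) i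
      simpa using this
    · intro m q hq
      have h1 : ∀ l : Fin 4, ∑ i, c i * v i l * eval (v i) q = 0 := by
        intro l
        have := hc' (X l * q) (by rw [add_comm]; exact (isHomogeneous_X k l).mul hq)
        simpa [mul_assoc] using this
      by_cases hme : m = a
      · simp [hme, h1]
      · by_cases hmb : m = b
        · simp [hmb, hab.symm, h1]
        · simp [hme, hmb]
    · intro j
      rw [Finset.sum_eq_add a b hab]
      · simp [hab.symm]; ring
      · intro l _ hl; simp [hl.1, hl.2]
      · simp
      · simp
  have hc0 : c = 0 := by
    funext i
    have h1 : c i * ∑ m, lam m * v i m = 0 := by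
      rw [Finset.mul_sum]
      refine Finset.sum_eq_zero fun m _ => ?_
      have := key m i
      linear_combination lam m * this
    rwa [hlam, mul_one] at h1
  exact hcy (by simp [hc0])

theorem KoszulCondition.of_formValues_eq_top (h : formValues v d = ⊤) : KoszulCondition v d := by
  classical
  intro w hw _
  funext m i
  obtain ⟨p, hp, hpe⟩ := mem_formValues.mp (h ▸ Submodule.mem_top : Pi.single i 1 ∈ formValues v d)
  have := hw m p hp
  simpa [hpe, Pi.single_apply] using this

theorem KoszulCondition.add (hs : KoszulCondition v d) (hlam : ∀ i, ∑ m, lam m * v i m = 1)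
    (e : ℕ) : KoszulCondition v (d + e) := by
  induction e with
  | zero => exact hs
  | succ e ih => exact KoszulCondition.of_formValues_eq_top (ih.formValues_succ hlam)

theorem KoszulCondition.kernel_eq_zero (hs : KoszulCondition v d) (w : Fin 4 → Fin N → k)
    (h1 : ∀ m, ∀ q ∈ formValues v d, ∑ i, w m i * q i = 0)
    (h2 : ∀ i, ∑ m, v i m * w m i = 0) : w = 0 :=
  hs w (fun m q hq => h1 m _ (mem_formValues.mpr ⟨q, hq, fun _ => rfl⟩)) h2

theorem sum_X_mul_sum_X_mul_eq_zero (θ : Fin 4 → Fin 4 → R4 k) (hθ : ∀ a b, θ a b = -θ b a)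
    (hdiag : ∀ a, θ a a = 0) : ∑ a, X a * ∑ b, X b * θ a b = 0 := by
  simp only [Fin.sum_univ_four, hdiag]
  rw [hθ 1 0, hθ 2 0, hθ 3 0, hθ 2 1, hθ 3 1, hθ 3 2]
  ring

/-- A form vanishing at the points is a combination of the variables with coefficients vanishing
at the points. -/
theorem KoszulCondition.exists_eq_sum_X_mul (hs : KoszulCondition v d)
    (hlam : ∀ i, ∑ m, lam m * v i m = 1) {p : R4 k} (hp : p ∈ vanishingForms v (d + 2)) :
    ∃ q : Fin 4 → R4 k, (∀ i, q i ∈ vanishingForms v (d + 1)) ∧ p = ∑ i, X i * q i := by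
  rw [mem_vanishingForms] at hp
  obtain ⟨q, hq, hpq⟩ := _root_.exists_eq_sum_X_mul (d := d + 1) hp.1
  obtain ⟨β, hβ, hqβ⟩ := exists_koszul_one (formValues v d) (fun m i => v i m) lam hlam
    hs.kernel_eq_zero (fun m i => eval (v i) (q m)) (fun i => by
      have := hp.2 i
      rw [hpq] at this
      simpa using this)
  choose B hBh hBe using fun a b => mem_formValues.mp (hβ a b)
  refine ⟨fun a => q a - ∑ b, X b * (B a b - B b a), fun a => mem_vanishingForms.mpr ⟨?_, ?_⟩, ?_⟩
  · refine (hq a).sub (IsHomogeneous.sum _ _ _ fun b _ => ?_)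
    rw [add_comm]
    exact (isHomogeneous_X k b).mul ((hBh a b).sub (hBh b a))
  · intro i
    simp [hBe, hqβ]
  · rw [hpq]
    have := sum_X_mul_sum_X_mul_eq_zero (fun a b => B a b - B b a) (fun a b => by ring)
      (fun a => by ring)
    simp only [mul_sub, Finset.sum_sub_distrib] at this ⊢
    rw [this, sub_zero]

/-- A linear syzygy among the variables with coefficients vanishing at the points is a
combination of Koszul syzygies with coefficients vanishing at the points. -/
theorem KoszulCondition.exists_koszul (hs : KoszulCondition v d)
    (hlam : ∀ i, ∑ m, lam m * v i m = 1) (f : Fin 4 → R4 k)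
    (hf : ∀ i, f i ∈ vanishingForms v (d + 2)) (hf0 : ∑ i, X i * f i = 0) :
    ∃ h : Fin 4 → Fin 4 → R4 k, (∀ i j, h i j ∈ vanishingForms v (d + 1)) ∧
      ∀ i, f i = ∑ j, X j * (h i j - h j i) := by
  simp only [mem_vanishingForms] at hf
  obtain ⟨η, hη, hfη⟩ := exists_koszul_X_homogeneous (d := d + 1) f (fun i => (hf i).1) hf0
  obtain ⟨β, hβ, hηβ⟩ := exists_koszul_two (formValues v d) (fun m i => v i m) lam hlam
    hs.kernel_eq_zero (fun a b i => eval (v i) (η a b - η b a)) (fun a b i => by simp)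
    (fun a i => by simp) (fun a i => by
      have := (hf a).2 i
      rw [hfη] at this
      simpa using this)
  choose B hBh hBe using fun a b c => mem_formValues.mp (hβ a b c)
  let alt : Fin 4 → Fin 4 → Fin 4 → R4 k := fun a b c =>
    B a b c + B b c a + B c a b - B b a c - B a c b - B c b a
  have halt : ∀ a b c, (alt a b c).IsHomogeneous d := fun a b c =>
    (((((hBh a b c).add (hBh b c a)).add (hBh c a b)).sub (hBh b a c)).sub (hBh a c b)).sub
      (hBh c b a)
  let θ : Fin 4 → Fin 4 → R4 k := fun a b => η a b - η b a - ∑ c, X c * alt a b c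
  have hθa : ∀ a b, θ a b = -θ b a := by
    intro a b
    have h1 : ∑ c, X c * alt a b c = -∑ c, X c * alt b a c := by
      rw [← Finset.sum_neg_distrib]
      exact Finset.sum_congr rfl fun c _ => by simp only [alt]; ring
    simp only [θ, h1]; ring
  have hθd : ∀ a, θ a a = 0 := by
    intro a
    have h1 : ∑ c, X c * alt a a c = 0 :=
      Finset.sum_eq_zero fun c _ => by simp only [alt]; ring
    simp only [θ, h1]; ring
  have hθv : ∀ a b, θ a b ∈ vanishingForms v (d + 1) := by
    intro a b
    refine mem_vanishingForms.mpr ⟨?_, fun i => ?_⟩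
    · refine ((hη a b).sub (hη b a)).sub (IsHomogeneous.sum _ _ _ fun c _ => ?_)
      rw [add_comm]
      exact (isHomogeneous_X k c).mul (halt a b c)
    · have := hηβ a b i
      simp only [eval_sub] at this
      simp [θ, alt, hBe, this]
  have hfθ : ∀ a, f a = ∑ b, X b * θ a b := by
    intro a
    have h0 := sum_X_mul_sum_X_mul_eq_zero (fun b c => alt a b c)
      (fun b c => by simp only [alt]; ring) (fun b => by simp only [alt]; ring)
    rw [hfη a]
    simp only [θ]
    have : ∀ b, X b * (η a b - η b a - ∑ c, X c * alt a b c) =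
        X b * (η a b - η b a) - X b * ∑ c, X c * alt a b c := fun b => by ring
    rw [Finset.sum_congr rfl fun b _ => this b, Finset.sum_sub_distrib, h0, sub_zero]
  refine ⟨fun a b => if a < b then θ a b else 0, fun a b => ?_, fun a => ?_⟩
  · dsimp only
    split_ifs
    · exact hθv a b
    · exact Submodule.zero_mem _
  · rw [hfθ a]
    refine Finset.sum_congr rfl fun b _ => ?_
    congr 1
    rcases lt_trichotomy a b with h | h | h
    · simp [h, not_lt_of_gt h]
    · subst h; simp [hθd]
    · simp [h, not_lt_of_gt h, hθa a b]

end VanishingForms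

section Generation

variable {k : Type} [Field k] {N : ℕ} {v : Fin N → Fin 4 → k} {lam : Fin 4 → k} {d : ℕ}

/-- Spanning forms of the least relevant degree generate all forms vanishing at the points. -/
theorem KoszulCondition.exists_combination (hs : KoszulCondition v d)
    (hlam : ∀ i, ∑ m, lam m * v i m = 1) {n : ℕ} (g : Fin n → R4 k)
    (hg : vanishingForms v (d + 1) ≤ Submodule.span k (Set.range g)) (e : ℕ) :
    ∀ p ∈ vanishingForms v (d + 1 + e),
      ∃ w : Fin n → R4 k, (∀ j, (w j).IsHomogeneous e) ∧ p = ∑ j, w j * g j := by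
  induction e with
  | zero =>
    intro p hp
    obtain ⟨c, hc⟩ := (Submodule.mem_span_range_iff_exists_fun k).mp (hg hp)
    exact ⟨fun j => C (c j), fun j => isHomogeneous_C _ _, by simp [← hc, smul_eq_C_mul]⟩
  | succ e ih =>
    intro p hp
    obtain ⟨q, hq, rfl⟩ := (hs.add hlam e).exists_eq_sum_X_mul hlam (p := p)
      (by convert hp using 2; ring)
    choose w hw hqw using fun i => ih (q i) (by convert hq i using 2; ring)
    refine ⟨fun j => ∑ i, X i * w i j, fun j => IsHomogeneous.sum _ _ _ fun i _ => ?_, ?_⟩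
    · rw [add_comm]
      exact (isHomogeneous_X k i).mul (hw i j)
    · simp_rw [hqw, Finset.mul_sum, Finset.sum_mul]
      rw [Finset.sum_comm]
      simp [mul_assoc]

/-- Spanning linear syzygies generate all syzygies. -/
theorem KoszulCondition.exists_syzygy_combination (hs : KoszulCondition v d)
    (hlam : ∀ i, ∑ m, lam m * v i m = 1) {n n' : ℕ} (g : Fin n → R4 k)
    (hg : vanishingForms v (d + 1) ≤ Submodule.span k (Set.range g))
    (hgv : ∀ j, g j ∈ vanishingForms v (d + 1))
    (M : Fin n' → Fin n → R4 k)
    (hM : ∀ w : Fin n → R4 k, (∀ j, (w j).IsHomogeneous 1) → ∑ j, w j * g j = 0 →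
      w ∈ Submodule.span k (Set.range M)) (e : ℕ) :
    ∀ w : Fin n → R4 k, (∀ j, (w j).IsHomogeneous (e + 1)) → ∑ j, w j * g j = 0 →
      ∃ u : Fin n' → R4 k, (∀ i, (u i).IsHomogeneous e) ∧ ∀ j, w j = ∑ i, u i * M i j := by
  induction e with
  | zero =>
    intro w hw hw0
    obtain ⟨c, hc⟩ := (Submodule.mem_span_range_iff_exists_fun k).mp (hM w (by simpa using hw) hw0)
    exact ⟨fun j => C (c j), fun j => isHomogeneous_C _ _, fun j => by
      simp [← hc, smul_eq_C_mul]⟩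
  | succ e ih =>
    intro w hw hw0
    choose q hq hwq using fun j => _root_.exists_eq_sum_X_mul (hw j)
    obtain ⟨h, hh, hfh⟩ := (hs.add hlam e).exists_koszul hlam (fun i => ∑ j, q j i * g j)
      (fun i => mem_vanishingForms.mpr ⟨IsHomogeneous.sum _ _ _ fun j _ => by
        have := (hq j i).mul (mem_vanishingForms.mp (hgv j)).1
        convert this using 1; ring, fun l => by
          simp [(mem_vanishingForms.mp (hgv _)).2 l]⟩)
      (by
        rw [← hw0]
        simp_rw [Finset.mul_sum]
        rw [Finset.sum_comm]
        refine Finset.sum_congr rfl fun j _ => ?_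
        rw [hwq j, Finset.sum_mul]
        exact Finset.sum_congr rfl fun i _ => by ring)
    choose c hc hhc using fun a b => hs.exists_combination hlam g hg e (h a b)
      (by convert hh a b using 2; ring)
    choose u hu hqu using fun i => ih (fun j => q j i - ∑ b, X b * (c i b j - c b i j))
      (fun j => (hq j i).sub (IsHomogeneous.sum _ _ _ fun b _ => by
        rw [add_comm]
        exact (isHomogeneous_X k b).mul ((hc i b j).sub (hc b i j))))
      (by
        have h1 := hfh i
        simp_rw [hhc] at h1
        simp_rw [sub_mul]
        rw [Finset.sum_sub_distrib, h1, sub_eq_zero]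
        simp_rw [Finset.sum_mul]
        rw [Finset.sum_comm]
        refine Finset.sum_congr rfl fun b _ => ?_
        rw [← Finset.sum_sub_distrib, Finset.mul_sum]
        exact Finset.sum_congr rfl fun j _ => by ring)
    refine ⟨fun l => ∑ i, X i * u i l, fun l => IsHomogeneous.sum _ _ _ fun i _ => ?_,
      fun j => ?_⟩
    · rw [add_comm]
      exact (isHomogeneous_X k i).mul (hu i l)
    · have h0 := sum_X_mul_sum_X_mul_eq_zero (fun b a => c b a j - c a b j)
        (fun b a => by ring) (fun b => by ring)
      have h1 : w j = ∑ i, X i * (q j i - ∑ b, X b * (c i b j - c b i j)) := by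
        simp_rw [mul_sub (X _) (q j _)]
        rw [Finset.sum_sub_distrib, h0, sub_zero, hwq]
      rw [h1]
      simp_rw [hqu, Finset.mul_sum, Finset.sum_mul]
      rw [Finset.sum_comm]
      simp [mul_assoc]

end Generation

section Dimension

variable {k : Type} [Field k]

theorem homogeneousSubmodule_eq_span_monomial (d : ℕ) :
    homogeneousSubmodule (Fin 4) k d = Submodule.span k (Set.range fun
      m : {m // m ∈ (Finset.univ : Finset (Fin 4)).finsuppAntidiag d} =>
        (monomial m.1 1 : R4 k)) := by
  have hmem : ∀ m : Fin 4 →₀ ℕ,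
      m ∈ (Finset.univ : Finset (Fin 4)).finsuppAntidiag d ↔ m.degree = d := by
    intro m
    simp [Finset.mem_finsuppAntidiag, Finsupp.degree_eq_sum]
  apply le_antisymm
  · intro p hp
    rw [p.as_sum]
    refine Submodule.sum_mem _ fun m hm => ?_
    have hmd : m.degree = d := by
      rw [Finsupp.degree_eq_weight_one]
      exact hp (mem_support_iff.mp hm)
    have : (monomial m (coeff m p) : R4 k) = coeff m p • monomial m 1 := by
      rw [smul_monomial, smul_eq_mul, mul_one]
    rw [this]
    exact Submodule.smul_mem _ _ (Submodule.subset_span ⟨⟨m, (hmem m).mpr hmd⟩, rfl⟩)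
  · rw [Submodule.span_le]
    rintro _ ⟨m, rfl⟩
    exact isHomogeneous_monomial 1 ((hmem _).mp m.2)

theorem finrank_homogeneousSubmodule (d : ℕ) :
    Module.finrank k (homogeneousSubmodule (Fin 4) k d) = (d + 3).choose 3 := by
  rw [homogeneousSubmodule_eq_span_monomial, finrank_span_eq_card]
  · rw [Fintype.card_coe, Finset.card_finsuppAntidiag_nat_eq_choose]
    simp only [Finset.card_univ, Fintype.card_fin]
    rw [show 4 + d - 1 = d + 3 by omega, ← Nat.choose_symm_add]
  · exact (basisMonomials (Fin 4) k).linearIndependent.comp _ Subtype.val_injective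

instance (d : ℕ) : Module.Finite k (homogeneousSubmodule (Fin 4) k d) :=
  Module.Finite.iff_fg.mpr (homogeneousSubmodule_fg (Fin 4) k d)

end Dimension

section DimensionCount

variable {k : Type} [Field k]

theorem finrank_map_add_finrank_inf_ker {V W : Type} [AddCommGroup V] [Module k V]
    [AddCommGroup W] [Module k W] (p : Submodule k V) [Module.Finite k p] (f : V →ₗ[k] W) :
    Module.finrank k (p.map f) + Module.finrank k ↥(p ⊓ LinearMap.ker f) = Module.finrank k p := by
  have h := LinearMap.finrank_range_add_finrank_ker (f.domRestrict p)
  rw [LinearMap.range_domRestrict, LinearMap.ker_domRestrict] at h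
  rw [← h, ← Submodule.map_comap_subtype, Submodule.finrank_map_subtype_eq]

/-- Tuples of forms of degree `e`. -/
noncomputable def formTuples (k : Type) [Field k] (n e : ℕ) : Submodule k (Fin n → R4 k) :=
  Submodule.pi Set.univ fun _ => homogeneousSubmodule (Fin 4) k e

theorem mem_formTuples {n e : ℕ} {w : Fin n → R4 k} :
    w ∈ formTuples k n e ↔ ∀ j, (w j).IsHomogeneous e := by
  simp [formTuples]

theorem formTuples_eq_range (n e : ℕ) : formTuples k n e = LinearMap.range
    (LinearMap.pi (fun i => (homogeneousSubmodule (Fin 4) k e).subtype ∘ₗ LinearMap.proj i) :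
      (Fin n → homogeneousSubmodule (Fin 4) k e) →ₗ[k] (Fin n → R4 k)) := by
  ext w
  rw [mem_formTuples]
  constructor
  · intro h
    exact ⟨fun j => ⟨w j, h j⟩, rfl⟩
  · rintro ⟨u, rfl⟩ j
    exact (u j).2

instance (n e : ℕ) : Module.Finite k (formTuples k n e) := by
  rw [formTuples_eq_range]
  infer_instance

theorem finrank_formTuples (n e : ℕ) :
    Module.finrank k (formTuples k n e) = n * (e + 3).choose 3 := by
  rw [formTuples_eq_range, LinearMap.finrank_range_of_inj]
  · rw [Module.finrank_pi_fintype]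
    simp [finrank_homogeneousSubmodule]
  · intro a b h
    funext j
    exact Subtype.ext (congrFun h j)

/-- The combination of the rows of a matrix with given coefficients. -/
noncomputable def rowCombination {a b : ℕ} (A : Fin a → Fin b → R4 k) :
    (Fin a → R4 k) →ₗ[k] (Fin b → R4 k) where
  toFun t := fun i => ∑ l, t l * A l i
  map_add' x y := by funext i; simp [add_mul, Finset.sum_add_distrib]
  map_smul' c x := by funext i; simp [Finset.smul_sum]

@[simp]
theorem rowCombination_apply {a b : ℕ} (A : Fin a → Fin b → R4 k) (t : Fin a → R4 k)
    (i : Fin b) : rowCombination A t i = ∑ l, t l * A l i := rfl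

/-- The combination of polynomials with given coefficients. -/
noncomputable def polyCombination {a : ℕ} (g : Fin a → R4 k) : (Fin a → R4 k) →ₗ[k] R4 k where
  toFun t := ∑ l, t l * g l
  map_add' x y := by simp [add_mul, Finset.sum_add_distrib]
  map_smul' c x := by simp [Finset.smul_sum]

@[simp]
theorem polyCombination_apply {a : ℕ} (g : Fin a → R4 k) (t : Fin a → R4 k) :
    polyCombination g t = ∑ l, t l * g l := rfl

variable {N : ℕ} {v : Fin N → Fin 4 → k} {lam : Fin 4 → k} {d : ℕ}

instance (v : Fin N → Fin 4 → k) (d : ℕ) : Module.Finite k (vanishingForms v d) :=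
  Submodule.finiteDimensional_of_le (S₂ := homogeneousSubmodule (Fin 4) k d) inf_le_left

theorem finrank_vanishingForms (h : formValues v d = ⊤) :
    Module.finrank k (vanishingForms v d) + N = (d + 3).choose 3 := by
  have h1 := finrank_map_add_finrank_inf_ker (homogeneousSubmodule (Fin 4) k d) (evalMap v)
  change Module.finrank k (formValues v d) + Module.finrank k (vanishingForms v d) = _ at h1
  rw [h, finrank_homogeneousSubmodule, finrank_top, Module.finrank_fin_fun] at h1
  omega

theorem KoszulCondition.finrank_vanishingForms (hs : KoszulCondition v d)
    (hlam : ∀ i, ∑ m, lam m * v i m = 1) (e : ℕ) :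
    Module.finrank k (vanishingForms v (d + 1 + e)) + N = (d + 1 + e + 3).choose 3 := by
  apply _root_.finrank_vanishingForms
  rw [show d + 1 + e = d + e + 1 by ring]
  exact (hs.add hlam e).formValues_succ hlam

theorem KoszulCondition.map_polyCombination (hs : KoszulCondition v d)
    (hlam : ∀ i, ∑ m, lam m * v i m = 1) {n : ℕ} (g : Fin n → R4 k)
    (hgv : ∀ j, g j ∈ vanishingForms v (d + 1))
    (hg : vanishingForms v (d + 1) ≤ Submodule.span k (Set.range g)) (e : ℕ) :
    (formTuples k n e).map (polyCombination g) = vanishingForms v (d + 1 + e) := by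
  ext p
  constructor
  · rintro ⟨w, hw, rfl⟩
    have hw := mem_formTuples.mp hw
    refine mem_vanishingForms.mpr ⟨IsHomogeneous.sum _ _ _ fun j _ => ?_, fun i => ?_⟩
    · rw [add_comm]
      exact (hw j).mul (mem_vanishingForms.mp (hgv j)).1
    · simp [(mem_vanishingForms.mp (hgv _)).2 i]
  · intro hp
    obtain ⟨w, hw, rfl⟩ := hs.exists_combination hlam g hg e p hp
    exact ⟨w, mem_formTuples.mpr hw, rfl⟩

theorem KoszulCondition.finrank_syzygies (hs : KoszulCondition v d)
    (hlam : ∀ i, ∑ m, lam m * v i m = 1) {n : ℕ} (g : Fin n → R4 k)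
    (hgv : ∀ j, g j ∈ vanishingForms v (d + 1))
    (hg : vanishingForms v (d + 1) ≤ Submodule.span k (Set.range g)) (e : ℕ) :
    Module.finrank k ↥(formTuples k n e ⊓ LinearMap.ker (polyCombination g)) +
      (d + 1 + e + 3).choose 3 = n * (e + 3).choose 3 + N := by
  have h1 := finrank_map_add_finrank_inf_ker (formTuples k n e) (polyCombination g)
  rw [hs.map_polyCombination hlam g hgv hg, finrank_formTuples] at h1
  have := hs.finrank_vanishingForms hlam e
  omega

/-- A finite-dimensional subspace has a spanning family of cardinality its dimension, linearly
independent. -/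
theorem exists_basis_family {V : Type} [AddCommGroup V] [Module k V] (p : Submodule k V)
    [Module.Finite k p] {n : ℕ} (hn : Module.finrank k p = n) :
    ∃ b : Fin n → V, (∀ i, b i ∈ p) ∧ p = Submodule.span k (Set.range b) ∧
      LinearIndependent k b := by
  let B := Module.finBasisOfFinrankEq k p hn
  refine ⟨fun i => B i, fun i => (B i).2, ?_, ?_⟩
  · have := B.span_eq
    have h2 := congrArg (Submodule.map p.subtype) this
    rw [Submodule.map_span, ← Set.range_comp, Submodule.map_subtype_top] at h2
    exact h2.symm
  · exact B.linearIndependent.map' p.subtype p.ker_subtype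

theorem exists_basis_family_cons {V : Type} [AddCommGroup V] [Module k V] (p : Submodule k V)
    [Module.Finite k p] {n : ℕ} (hn : Module.finrank k p = n + 1) {x : V} (hx : x ∈ p)
    (hx0 : x ≠ 0) : ∃ b : Fin n → V, (∀ i, b i ∈ p) ∧
      p = Submodule.span k (Set.range (Fin.cons x b : Fin (n + 1) → V)) ∧
      LinearIndependent k (Fin.cons x b : Fin (n + 1) → V) := by
  obtain ⟨c, hc⟩ := Submodule.exists_isCompl (Submodule.span k {x})
  have hle : Submodule.span k {x} ≤ p := by simpa using hx
  have hsup : Submodule.span k {x} ⊔ c ⊓ p = p := by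
    rw [← sup_inf_assoc_of_le c hle, hc.sup_eq_top, top_inf_eq]
  have : Module.Finite k ↥(c ⊓ p) := Submodule.finiteDimensional_of_le (S₂ := p) inf_le_right
  have hinf : Submodule.span k {x} ⊓ (c ⊓ p) = ⊥ := by
    rw [← inf_assoc, hc.inf_eq_bot, bot_inf_eq]
  have hfin := Submodule.finrank_sup_add_finrank_inf_eq (Submodule.span k {x}) (c ⊓ p)
  rw [hsup, hinf, hn, finrank_bot, finrank_span_singleton hx0] at hfin
  obtain ⟨b, hb, hbs, -⟩ := exists_basis_family (c ⊓ p) (n := n) (by omega)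
  have hspan : p = Submodule.span k (Set.range (Fin.cons x b : Fin (n + 1) → V)) := by
    rw [Fin.range_cons, Submodule.span_insert, ← hbs, hsup]
  refine ⟨b, fun i => (hb i).2, hspan, ?_⟩
  rw [linearIndependent_iff_card_eq_finrank_span, Set.finrank, ← hspan, hn, Fintype.card_fin]

end DimensionCount

section Resolution

variable {k : Type} [Field k]

theorem totalDegree_eq_zero_of_relation {a b : ℕ} {M : Fin a → Fin b → R4 k}
    (hM : ∀ i j, (M i j).IsHomogeneous 1)
    (hK : ∀ e < 2, ∀ u ∈ formTuples k a e, rowCombination M u = 0 → u = 0)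
    {p q : R4 k} (hpq : IsRelPrime q p) (hq : q ≠ 0) {x y : Fin a → R4 k}
    (hx : x ∈ formTuples k a 2) (hxM : rowCombination M x = 0) (hx0 : x ≠ 0)
    (h : ∀ i, p * x i + q * y i = 0) : q.totalDegree = 0 := by
  have hdvd : ∀ i, q ∣ x i := fun i => hpq.dvd_of_dvd_mul_left
    ⟨-y i, by linear_combination h i⟩
  choose z hz using hdvd
  have hzM : ∀ j, ∑ i, z i * M i j = 0 := by
    intro j
    apply mul_left_cancel₀ hq
    have := congrFun hxM j
    rw [rowCombination_apply, Pi.zero_apply] at this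
    rw [Finset.mul_sum, mul_zero, ← this]
    exact Finset.sum_congr rfl fun i _ => by rw [hz i, mul_assoc]
  have hz2 : ∀ e < 2, ∀ i, homogeneousComponent e (z i) = 0 := by
    intro e he i
    have := hK e he (fun i => homogeneousComponent e (z i))
      (mem_formTuples.mpr fun i => homogeneousComponent_isHomogeneous _ _)
      (by
        funext j
        exact homogeneousComponent_sum_mul_eq_zero (fun i => hM i j) (hzM j) e)
    exact congrFun this i
  obtain ⟨i, hi⟩ := Function.ne_iff.mp hx0
  have hi : x i ≠ 0 := hi
  have hzi : z i ≠ 0 := fun h0 => hi (by rw [hz i, h0, mul_zero])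
  have hdeg := totalDegree_mul_of_isDomain hq hzi
  rw [← hz i, (mem_formTuples.mp hx i).totalDegree hi] at hdeg
  by_contra hne
  have h0 : z i = 0 := by
    rw [← sum_range_homogeneousComponent (z i) (D := 2) (by omega)]
    exact Finset.sum_eq_zero fun e he => hz2 e (Finset.mem_range.mp he) i
  exact hzi h0

/-- At most two `k`-linearly independent quadratic elements of the kernel of a matrix of linear
forms are independent over the polynomial ring, provided the kernel vanishes in lower degrees. -/
theorem eq_zero_of_rowCombination_eq_zero {a b n : ℕ} (hn : n ≤ 2) {M : Fin a → Fin b → R4 k}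
    (hM : ∀ i j, (M i j).IsHomogeneous 1)
    (hK : ∀ e < 2, ∀ u ∈ formTuples k a e, rowCombination M u = 0 → u = 0)
    {κ : Fin n → Fin a → R4 k} (hκ : ∀ l, κ l ∈ formTuples k a 2)
    (hκM : ∀ l, rowCombination M (κ l) = 0) (hli : LinearIndependent k κ)
    (t : Fin n → R4 k) (ht : ∀ i, ∑ l, t l * κ l i = 0) : t = 0 := by
  have hcancel : ∀ l (p : R4 k), (∀ i, p * κ l i = 0) → p = 0 := by
    intro l p hp
    obtain ⟨i, hi⟩ := Function.ne_iff.mp (hli.ne_zero l)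
    exact (mul_eq_zero.mp (hp i)).resolve_right hi
  interval_cases n
  · exact Subsingleton.elim _ _
  · funext l
    obtain rfl : l = 0 := Subsingleton.elim _ _
    exact hcancel 0 _ (by simpa using ht)
  · simp only [Fin.sum_univ_two] at ht
    by_cases h0 : t 0 = 0
    · have h1 : t 1 = 0 := hcancel 1 _ (by simpa [h0] using ht)
      funext l
      fin_cases l
      · exact h0
      · exact h1
    · exfalso
      obtain ⟨p, q, c, hpq, hp, hq⟩ :=
        UniqueFactorizationMonoid.exists_reduced_factors (t 0) h0 (t 1)
      have hc : c ≠ 0 := by rintro rfl; exact h0 (by rw [← hp, zero_mul])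
      have hrel : ∀ i, p * κ 0 i + q * κ 1 i = 0 := by
        intro i
        apply mul_left_cancel₀ hc
        have := ht i
        rw [← hp, ← hq] at this
        linear_combination this
      have hp0 : p ≠ 0 := by rintro rfl; exact h0 (by rw [← hp, mul_zero])
      have hq0 : q ≠ 0 := by
        rintro rfl
        exact hp0 (hcancel 0 _ (by simpa using hrel))
      have hqd := totalDegree_eq_zero_of_relation hM hK hpq.symm hq0 (hκ 0) (hκM 0)
        (hli.ne_zero 0) hrel
      have hpd := totalDegree_eq_zero_of_relation hM hK hpq hp0 (hκ 1) (hκM 1)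
        (hli.ne_zero 1) (fun i => by rw [add_comm]; exact hrel i)
      rw [totalDegree_eq_zero_iff_eq_C] at hqd hpd
      rw [hqd, hpd] at hrel
      have hzero : ∑ l, (![coeff 0 p, coeff 0 q] l) • κ l = 0 := by
        funext i
        simpa [smul_eq_C_mul, Fin.sum_univ_two] using hrel i
      have := Fintype.linearIndependent_iff.mp hli _ hzero 0
      exact hp0 (by rw [hpd, show coeff 0 p = 0 from this, C_0])

variable {N : ℕ} {v : Fin N → Fin 4 → k} {lam : Fin 4 → k} {d : ℕ}

theorem KoszulCondition.exists_resolution (hs : KoszulCondition v d)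
    (hlam : ∀ i, ∑ m, lam m * v i m = 1) {n n' n'' : ℕ} (hn'' : n'' ≤ 2) (g : Fin n → R4 k)
    (hgv : ∀ j, g j ∈ vanishingForms v (d + 1))
    (hg : vanishingForms v (d + 1) ≤ Submodule.span k (Set.range g))
    (hgli : LinearIndependent k g)
    (hdim : ∀ e, n' * (e + 3).choose 3 + (d + e + 5).choose 3 =
      n * (e + 4).choose 3 + N + n'' * (e + 1).choose 3) :
    ∃ (M : Fin n' → Fin n → R4 k) (κ : Fin n'' → Fin n' → R4 k),
      (∀ i j, (M i j).IsHomogeneous 1) ∧ (∀ l i, (κ l i).IsHomogeneous 2) ∧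
      (∀ i, ∑ j, M i j * g j = 0) ∧
      (∀ w : Fin n → R4 k, ∑ j, w j * g j = 0 → ∃ u : Fin n' → R4 k, ∀ j, w j = ∑ i, u i * M i j) ∧
      (∀ l j, ∑ i, κ l i * M i j = 0) ∧
      (∀ u : Fin n' → R4 k, (∀ j, ∑ i, u i * M i j = 0) →
        ∃ t : Fin n'' → R4 k, ∀ i, u i = ∑ l, t l * κ l i) ∧
      (∀ t : Fin n'' → R4 k, (∀ i, ∑ l, t l * κ l i = 0) → t = 0) := by
  have hrank := fun e => hs.finrank_syzygies hlam g hgv hg e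
  obtain ⟨M, hMs, hMspan, -⟩ := exists_basis_family
    (formTuples k n 1 ⊓ LinearMap.ker (polyCombination g)) (n := n') (by
      have h1 := hrank 1
      have h2 := hdim 0
      rw [show d + 1 + 1 + 3 = d + 5 by ring, show Nat.choose (1 + 3) 3 = 4 from rfl] at h1
      rw [add_zero, zero_add, zero_add, zero_add, show Nat.choose 3 3 = 1 from rfl,
        show Nat.choose 4 3 = 4 from rfl, show Nat.choose 1 3 = 0 from rfl] at h2
      omega)
  have hM1 : ∀ i j, (M i j).IsHomogeneous 1 := fun i => mem_formTuples.mp (hMs i).1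
  have hM0 : ∀ i, ∑ j, M i j * g j = 0 := fun i => LinearMap.mem_ker.mp (hMs i).2
  have hsyz : ∀ e, ∀ w : Fin n → R4 k, (∀ j, (w j).IsHomogeneous (e + 1)) →
      ∑ j, w j * g j = 0 →
      ∃ u : Fin n' → R4 k, (∀ i, (u i).IsHomogeneous e) ∧ ∀ j, w j = ∑ i, u i * M i j :=
    hs.exists_syzygy_combination hlam g hg hgv M (fun w hw hw0 => by
      rw [← hMspan]
      exact ⟨mem_formTuples.mpr hw, LinearMap.mem_ker.mpr hw0⟩)
  have hmul0 : ∀ u : Fin n' → R4 k, ∑ j, (∑ i, u i * M i j) * g j = 0 := by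
    intro u
    simp_rw [Finset.sum_mul]
    rw [Finset.sum_comm]
    refine Finset.sum_eq_zero fun i _ => ?_
    simp_rw [mul_assoc]
    rw [← Finset.mul_sum, hM0, mul_zero]
  have hmap : ∀ e, (formTuples k n' e).map (rowCombination M) =
      formTuples k n (e + 1) ⊓ LinearMap.ker (polyCombination g) := by
    intro e
    ext w
    constructor
    · rintro ⟨u, hu, rfl⟩
      exact ⟨mem_formTuples.mpr fun j => IsHomogeneous.sum _ _ _ fun i _ =>
        (mem_formTuples.mp hu i).mul (hM1 i j), LinearMap.mem_ker.mpr (hmul0 u)⟩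
    · rintro ⟨hw, hw0⟩
      obtain ⟨u, hu, hwu⟩ := hsyz e w (mem_formTuples.mp hw) (LinearMap.mem_ker.mp hw0)
      exact ⟨u, mem_formTuples.mpr hu, (funext hwu).symm⟩
  have hker : ∀ e, Module.finrank k ↥(formTuples k n' e ⊓ LinearMap.ker (rowCombination M)) =
      n'' * (e + 1).choose 3 := by
    intro e
    have h1 := finrank_map_add_finrank_inf_ker (formTuples k n' e) (rowCombination M)
    rw [hmap, finrank_formTuples] at h1
    have h2 := hrank (e + 1)
    have h3 := hdim e
    rw [show d + 1 + (e + 1) + 3 = d + e + 5 by ring, show e + 1 + 3 = e + 4 by ring] at h2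
    omega
  have hK : ∀ e < 2, ∀ u ∈ formTuples k n' e, rowCombination M u = 0 → u = 0 := by
    intro e he u hu hu0
    have h0 : Module.finrank k ↥(formTuples k n' e ⊓ LinearMap.ker (rowCombination M)) = 0 := by
      rw [hker, Nat.choose_eq_zero_of_lt (by omega), mul_zero]
    rw [Submodule.finrank_eq_zero] at h0
    have : u ∈ formTuples k n' e ⊓ LinearMap.ker (rowCombination M) :=
      ⟨hu, LinearMap.mem_ker.mpr hu0⟩
    rwa [h0, Submodule.mem_bot] at this
  obtain ⟨κ, hκ, hκspan, hκli⟩ := exists_basis_family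
    (formTuples k n' 2 ⊓ LinearMap.ker (rowCombination M)) (n := n'') (by
      rw [hker]; simp)
  have hκ2 : ∀ l i, (κ l i).IsHomogeneous 2 := fun l => mem_formTuples.mp (hκ l).1
  have hκ0 : ∀ l, rowCombination M (κ l) = 0 := fun l => LinearMap.mem_ker.mp (hκ l).2
  have hinj := eq_zero_of_rowCombination_eq_zero hn'' hM1 hK (fun l => (hκ l).1) hκ0 hκli
  have hgen : ∀ e, (formTuples k n'' e).map (rowCombination κ) =
      formTuples k n' (e + 2) ⊓ LinearMap.ker (rowCombination M) := by
    intro e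
    apply Submodule.eq_of_le_of_finrank_eq
    · rintro _ ⟨t, ht, rfl⟩
      refine ⟨mem_formTuples.mpr fun i => IsHomogeneous.sum _ _ _ fun l _ =>
        (mem_formTuples.mp ht l).mul (hκ2 l i), LinearMap.mem_ker.mpr ?_⟩
      funext j
      simp only [rowCombination_apply, Finset.sum_mul]
      rw [Finset.sum_comm]
      refine Finset.sum_eq_zero fun l _ => ?_
      simp_rw [mul_assoc]
      rw [← Finset.mul_sum, show ∑ i, κ l i * M i j = 0 from congrFun (hκ0 l) j, mul_zero]
    · have h1 := finrank_map_add_finrank_inf_ker (formTuples k n'' e) (rowCombination κ)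
      have h2 : formTuples k n'' e ⊓ LinearMap.ker (rowCombination κ) = ⊥ := by
        rw [eq_bot_iff]
        rintro t ⟨-, ht⟩
        exact hinj t (fun i => congrFun (LinearMap.mem_ker.mp ht) i)
      rw [h2, finrank_bot, finrank_formTuples] at h1
      rw [hker]
      exact h1
  refine ⟨M, κ, hM1, hκ2, hM0, fun w hw => ?_, fun l j => congrFun (hκ0 l) j, fun u hu => ?_, hinj⟩
  · refine exists_combination_of_components M w fun e => ?_
    have hwe := homogeneousComponent_sum_mul_eq_zero
      (fun j => (mem_vanishingForms.mp (hgv j)).1) hw e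
    cases e with
    | zero =>
      simp only [homogeneousComponent_zero, ← smul_eq_C_mul] at hwe
      have := Fintype.linearIndependent_iff.mp hgli _ hwe
      exact ⟨0, fun j => by simp [this j]⟩
    | succ e =>
      obtain ⟨u, -, hu⟩ := hsyz e _ (fun j => homogeneousComponent_isHomogeneous _ _) hwe
      exact ⟨u, hu⟩
  · refine exists_combination_of_components κ u fun e => ?_
    have hue : rowCombination M (fun i => homogeneousComponent e (u i)) = 0 := by
      funext j
      exact homogeneousComponent_sum_mul_eq_zero (fun i => hM1 i j) (hu j) e
    have hum : (fun i => homogeneousComponent e (u i)) ∈ formTuples k n' e :=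
      mem_formTuples.mpr fun i => homogeneousComponent_isHomogeneous _ _
    rcases lt_or_ge e 2 with he | he
    · have := hK e he _ hum hue
      exact ⟨0, fun i => by simpa using congrFun this i⟩
    · obtain ⟨e, rfl⟩ := Nat.exists_eq_add_of_le' he
      have : (fun i => homogeneousComponent (e + 2) (u i)) ∈
          formTuples k n' (e + 2) ⊓ LinearMap.ker (rowCombination M) :=
        ⟨hum, LinearMap.mem_ker.mpr hue⟩
      rw [← hgen] at this
      obtain ⟨t, -, ht⟩ := this
      exact ⟨t, fun i => (congrFun ht i).symm⟩

end Resolution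

section Assembly

variable {k : Type} [Field k]

theorem MvPolynomial.IsHomogeneous.eval_smul' {σ : Type} {p : MvPolynomial σ k} {d : ℕ}
    (hp : p.IsHomogeneous d) (c : k) (x : σ → k) :
    eval (fun i => c * x i) p = c ^ d * eval x p := by
  rw [eval_eq, eval_eq, Finset.mul_sum]
  refine Finset.sum_congr rfl fun m hm => ?_
  have hd : ∑ i ∈ m.support, m i = d := by
    have : m.degree = d := by
      rw [Finsupp.degree_eq_weight_one]
      exact hp (mem_support_iff.mp hm)
    exact this
  simp_rw [mul_pow]
  rw [Finset.prod_mul_distrib, Finset.prod_pow_eq_pow_sum, hd]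
  ring

theorem entryOk_of_isHomogeneous {d e c : ℕ} (hd : d = e + c) (hc : c ≠ 0) {q : R4 k}
    (hq : q.IsHomogeneous c) : EntryOk k d e q :=
  ⟨Or.inr ⟨c, hd, hq⟩, hq.coeff_eq_zero (by simpa using hc.symm)⟩

theorem entryOk_zero (d e : ℕ) : EntryOk k d e 0 := ⟨Or.inl rfl, by simp⟩

theorem eval_homogeneousComponent_eq_zero [Infinite k] {σ : Type} {p : MvPolynomial σ k} {x : σ → k}
    (h : ∀ c : k, c ≠ 0 → eval (fun i => c * x i) p = 0) (d : ℕ) :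
    eval x (homogeneousComponent d p) = 0 := by
  let P : Polynomial k := ∑ d ∈ Finset.range (p.totalDegree + 1),
    Polynomial.monomial d (eval x (homogeneousComponent d p))
  have hP : P = 0 := by
    refine Polynomial.eq_zero_of_infinite_isRoot P ?_
    refine Set.Infinite.mono ?_ (Set.Finite.infinite_compl (Set.finite_singleton (0 : k)))
    intro c hc
    have := h c hc
    rw [← sum_homogeneousComponent p, map_sum] at this
    change Polynomial.eval c P = 0
    rw [Polynomial.eval_finsetSum, ← this]
    refine Finset.sum_congr rfl fun e _ => ?_
    rw [(homogeneousComponent_isHomogeneous e p).eval_smul', Polynomial.eval_monomial, mul_comm]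
  have hc := congrArg (fun Q => Polynomial.coeff Q d) hP
  simp only [P, Polynomial.finsetSum_coeff, Polynomial.coeff_monomial, Polynomial.coeff_zero,
    Finset.sum_ite_eq'] at hc
  split_ifs at hc with hd
  · exact hc
  · rw [homogeneousComponent_eq_zero _ _ (by simpa using hd), map_zero]

variable {N : ℕ} {v : Fin N → Fin 4 → k} {lam : Fin 4 → k} {d : ℕ}

theorem mem_pointsIdeal_iff [Infinite k] {Z : Fin N → P3 k} (hv : ∀ i, v i ≠ 0)
    (hZ : ∀ i, Projectivization.mk k (v i) (hv i) = Z i) {p : R4 k} :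
    p ∈ pointsIdeal k (Set.range Z) ↔ ∀ e i, eval (v i) (homogeneousComponent e p) = 0 := by
  constructor
  · intro hp e i
    refine eval_homogeneousComponent_eq_zero (fun c hc => ?_) e
    have hcv : c • v i ≠ 0 := smul_ne_zero hc (hv i)
    refine hp (Z i) ⟨i, rfl⟩ (c • v i) hcv ?_
    rw [← hZ i, Projectivization.mk_eq_mk_iff]
    exact ⟨Units.mk0 c hc, rfl⟩
  · rintro hp _ ⟨i, rfl⟩ x hx hxZ
    rw [← hZ i, Projectivization.mk_eq_mk_iff] at hxZ
    obtain ⟨c, rfl⟩ := hxZ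
    rw [← sum_homogeneousComponent p, map_sum]
    refine Finset.sum_eq_zero fun e _ => ?_
    have := (homogeneousComponent_isHomogeneous e p).eval_smul' (c : k) (v i)
    rw [hp, mul_zero] at this
    exact this

theorem eq_zero_of_vanishing_of_le (h : ∀ q : R4 k, q.IsHomogeneous d →
    (∀ i, eval (v i) q = 0) → q = 0) {e : ℕ} (he : e ≤ d) {q : R4 k} (hq : q.IsHomogeneous e)
    (hqv : ∀ i, eval (v i) q = 0) : q = 0 := by
  have := h (X 0 ^ (d - e) * q) (by
    convert (isHomogeneous_X_pow (R := k) (0 : Fin 4) (d - e)).mul hq using 1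
    omega) (fun i => by simp [hqv])
  exact (mul_eq_zero.mp this).resolve_left (pow_ne_zero _ (X_ne_zero 0))

/-- Spanning forms generate the whole ideal of the points. -/
theorem KoszulCondition.exists_combination_of_components (hs : KoszulCondition v d)
    (hlam : ∀ i, ∑ m, lam m * v i m = 1)
    (h1 : ∀ q : R4 k, q.IsHomogeneous d → (∀ i, eval (v i) q = 0) → q = 0)
    {n : ℕ} (g : Fin n → R4 k)
    (hg : vanishingForms v (d + 1) ≤ Submodule.span k (Set.range g)) {p : R4 k}
    (hp : ∀ e i, eval (v i) (homogeneousComponent e p) = 0) :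
    ∃ w : Fin n → R4 k, p = ∑ j, w j * g j := by
  obtain ⟨w, hw⟩ := _root_.exists_combination_of_components (fun j (_ : Fin 1) => g j)
    (fun _ => p) (fun e => by
      rcases le_or_gt e d with he | he
      · refine ⟨0, fun _ => ?_⟩
        simpa using eq_zero_of_vanishing_of_le h1 he (homogeneousComponent_isHomogeneous e p) (hp e)
      · obtain ⟨e, rfl⟩ := Nat.exists_eq_add_of_lt he
        obtain ⟨w, -, hw⟩ := hs.exists_combination hlam g hg e
          (homogeneousComponent (d + 1 + e) p)
          (mem_vanishingForms.mpr ⟨homogeneousComponent_isHomogeneous _ _, hp _⟩)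
        refine ⟨w, fun _ => ?_⟩
        rw [← hw]
        congr 2
        ring)
  exact ⟨w, hw 0⟩

theorem choose_three_identity (e : ℕ) : 6 * (e + 3).choose 3 = (e + 1) * (e + 2) * (e + 3) := by
  have h := Nat.descFactorial_eq_factorial_mul_choose (e + 3) 3
  simp [Nat.descFactorial, Nat.factorial] at h
  rw [← h]
  ring

theorem betti_identity_five (e : ℕ) : 5 * (e + 3).choose 3 + (1 + e + 5).choose 3 =
    5 * (e + 4).choose 3 + 5 + 1 * (e + 1).choose 3 := by
  rcases e with _ | _ | e
  · rfl
  · rfl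
  · have h1 := choose_three_identity (e + 2)
    have h2 := choose_three_identity (e + 3)
    have h3 := choose_three_identity e
    have h4 := choose_three_identity (e + 5)
    rw [show 1 + (e + 1 + 1) + 5 = e + 5 + 3 by ring, show e + 1 + 1 + 4 = e + 3 + 3 by ring,
      show e + 1 + 1 + 3 = e + 2 + 3 by ring, show e + 1 + 1 + 1 = e + 3 by ring]
    nlinarith

theorem betti_identity_twelve (e : ℕ) : 9 * (e + 3).choose 3 + (2 + e + 5).choose 3 =
    8 * (e + 4).choose 3 + 12 + 2 * (e + 1).choose 3 := by
  rcases e with _ | _ | e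
  · rfl
  · rfl
  · have h1 := choose_three_identity (e + 2)
    have h2 := choose_three_identity (e + 3)
    have h3 := choose_three_identity e
    have h4 := choose_three_identity (e + 6)
    rw [show 2 + (e + 1 + 1) + 5 = e + 6 + 3 by ring, show e + 1 + 1 + 4 = e + 3 + 3 by ring,
      show e + 1 + 1 + 3 = e + 2 + 3 by ring, show e + 1 + 1 + 1 = e + 3 by ring]
    nlinarith

end Assembly

section Resolutions

variable {k : Type} [Field k] [Infinite k] {N : ℕ} {lam : Fin 4 → k}

/-- The forms of degree `d` impose independent conditions, in the strong sense that governs the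
linearity of the resolution. -/
structure PointsCondition (v : Fin N → Fin 4 → k) (d : ℕ) : Prop where
  eq_zero : ∀ q : R4 k, q.IsHomogeneous d → (∀ i, eval (v i) q = 0) → q = 0
  koszul : KoszulCondition v d

theorem PointsCondition.hasMinFreeRes_five {v : Fin 5 → Fin 4 → k} (h : PointsCondition v 1)
    (hlam : ∀ i, ∑ m, lam m * v i m = 1) {Z : Fin 5 → P3 k} (hv : ∀ i, v i ≠ 0)
    (hZ : ∀ i, Projectivization.mk k (v i) (hv i) = Z i) {f : R4 k} (hf : f.IsHomogeneous 3)
    (hf0 : f ≠ 0) (hfZ : ∀ i, VanishesAt k f (Z i)) :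
    HasMinFreeRes3 k (Ideal.span {f}) (pointsIdeal k (Set.range Z))
      (fun _ : Fin 5 => 2) (fun _ : Fin 6 => 3) (fun _ : Fin 1 => 5) := by
  have hs := h.koszul
  have hfin : Module.finrank k (vanishingForms v (1 + 1)) = 5 := by
    have := hs.finrank_vanishingForms hlam 0
    rw [add_zero, show Nat.choose (1 + 1 + 3) 3 = 10 from rfl] at this
    omega
  obtain ⟨g, hgv, hgspan, hgli⟩ := exists_basis_family _ hfin
  obtain ⟨M, κ, hM1, hκ2, hM0, hM, hκM, hκ, hinj⟩ := hs.exists_resolution hlam (n'' := 1)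
    (by norm_num) g hgv hgspan.le hgli betti_identity_five
  obtain ⟨l, hl, hfl⟩ := hs.exists_combination hlam g hgspan.le 1 f
    (mem_vanishingForms.mpr ⟨hf, fun i => hfZ i (v i) (hv i) (hZ i)⟩)
  have hM0' : ∀ u : Fin 5 → R4 k, ∑ j, (∑ i, u i * M i j) * g j = 0 := by
    intro u
    simp_rw [Finset.sum_mul]
    rw [Finset.sum_comm]
    refine Finset.sum_eq_zero fun i _ => ?_
    simp_rw [mul_assoc]
    rw [← Finset.mul_sum, hM0, mul_zero]
  refine ⟨g, (Fin.cons l M : Fin 6 → Fin 5 → R4 k), fun m => (Fin.cons 0 (κ m) : Fin 6 → R4 k),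
    fun j => ⟨?_, (mem_vanishingForms.mp (hgv j)).1⟩, fun x hx => ?_, fun i j => ?_,
    fun m i => ?_, fun w => ⟨fun hw => ?_, ?_⟩, fun u => ⟨fun hu => ?_, ?_⟩, fun t ht => ?_⟩
  · rw [mem_pointsIdeal_iff hv hZ]
    intro e i
    have := mem_vanishingForms.mp (hgv j)
    rw [homogeneousComponent_of_mem this.1]
    split_ifs
    · exact this.2 i
    · exact map_zero _
  · obtain ⟨w, hw⟩ := hs.exists_combination_of_components hlam h.eq_zero g hgspan.le
      ((mem_pointsIdeal_iff hv hZ).mp hx)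
    exact ⟨w, by rw [hw, sub_self]; exact Ideal.zero_mem _⟩
  · refine Fin.cases ?_ (fun i => ?_) i
    · exact entryOk_of_isHomogeneous (c := 1) rfl one_ne_zero (hl j)
    · exact entryOk_of_isHomogeneous (c := 1) rfl one_ne_zero (hM1 i j)
  · refine Fin.cases ?_ (fun i => ?_) i
    · exact entryOk_zero _ _
    · exact entryOk_of_isHomogeneous (c := 2) rfl two_ne_zero (hκ2 m i)
  · obtain ⟨c, hc⟩ := Ideal.mem_span_singleton'.mp hw
    obtain ⟨u, hu⟩ := hM (fun j => w j - c * l j) (by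
      simp_rw [sub_mul]
      rw [Finset.sum_sub_distrib, ← hc, hfl, Finset.mul_sum, sub_eq_zero]
      exact Finset.sum_congr rfl fun j _ => by ring)
    refine ⟨Fin.cons c u, fun j => ?_⟩
    rw [Fin.sum_univ_succ]
    simp only [Fin.cons_zero, Fin.cons_succ]
    rw [← hu j]
    ring
  · rintro ⟨u, hu⟩
    refine Ideal.mem_span_singleton'.mpr ⟨u 0, ?_⟩
    have h1 := hM0' (fun i => u i.succ)
    have h2 : ∀ j, w j * g j = u 0 * (l j * g j) + (∑ i, u i.succ * M i j) * g j := by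
      intro j
      rw [hu j, Fin.sum_univ_succ]
      simp only [Fin.cons_zero, Fin.cons_succ]
      ring
    simp_rw [h2]
    rw [Finset.sum_add_distrib, h1, add_zero, ← Finset.mul_sum, ← hfl]
  · have h2 : ∀ j, u 0 * l j + ∑ i : Fin 5, u i.succ * M i j = 0 := by
      intro j
      have := hu j
      rw [Fin.sum_univ_succ] at this
      simpa only [Fin.cons_zero, Fin.cons_succ] using this
    have h1 := hM0' (fun i => u i.succ)
    have h0 : u 0 = 0 := by
      have h3 : u 0 * f = 0 := by
        have h4 : ∑ j, (u 0 * l j + ∑ i : Fin 5, u i.succ * M i j) * g j = 0 :=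
          Finset.sum_eq_zero fun j _ => by rw [h2, zero_mul]
        simp_rw [add_mul] at h4
        rw [Finset.sum_add_distrib, h1, add_zero] at h4
        rw [hfl, Finset.mul_sum, ← h4]
        exact Finset.sum_congr rfl fun j _ => by ring
      exact (mul_eq_zero.mp h3).resolve_right hf0
    obtain ⟨t, ht⟩ := hκ (fun i => u i.succ) (fun j => by simpa [h0] using h2 j)
    refine ⟨t, fun i => ?_⟩
    refine Fin.cases ?_ (fun i => ?_) i
    · simp [h0]
    · simpa using ht i
  · rintro ⟨t, ht⟩ j
    rw [Fin.sum_univ_succ]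
    simp only [ht, Fin.cons_zero, Fin.cons_succ, mul_zero, Finset.sum_const_zero, zero_mul,
      zero_add, Finset.sum_mul]
    rw [Finset.sum_comm]
    refine Finset.sum_eq_zero fun m _ => ?_
    simp_rw [mul_assoc]
    rw [← Finset.mul_sum, hκM, mul_zero]
  · exact hinj t fun i => by simpa using ht i.succ

theorem PointsCondition.hasMinFreeRes_twelve {v : Fin 12 → Fin 4 → k} (h : PointsCondition v 2)
    (hlam : ∀ i, ∑ m, lam m * v i m = 1) {Z : Fin 12 → P3 k} (hv : ∀ i, v i ≠ 0)
    (hZ : ∀ i, Projectivization.mk k (v i) (hv i) = Z i) {f : R4 k} (hf : f.IsHomogeneous 3)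
    (hf0 : f ≠ 0) (hfZ : ∀ i, VanishesAt k f (Z i)) :
    HasMinFreeRes3 k (Ideal.span {f}) (pointsIdeal k (Set.range Z))
      (fun _ : Fin 7 => 3) (fun _ : Fin 9 => 4) (fun _ : Fin 2 => 6) := by
  have hs := h.koszul
  have hfin : Module.finrank k (vanishingForms v (2 + 1)) = 7 + 1 := by
    have := hs.finrank_vanishingForms hlam 0
    rw [add_zero, show Nat.choose (2 + 1 + 3) 3 = 20 from rfl] at this
    omega
  have hfv : f ∈ vanishingForms v (2 + 1) :=
    mem_vanishingForms.mpr ⟨hf, fun i => hfZ i (v i) (hv i) (hZ i)⟩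
  obtain ⟨g, hgv, hgspan, hgli⟩ := exists_basis_family_cons _ hfin hfv hf0
  obtain ⟨M, κ, hM1, hκ2, hM0, hM, hκM, hκ, hinj⟩ := hs.exists_resolution hlam (n'' := 2)
    le_rfl (Fin.cons f g : Fin 8 → R4 k) (fun j => Fin.cases hfv (fun j => hgv j) j) hgspan.le hgli
    betti_identity_twelve
  have hM0' : ∀ i, ∑ j : Fin 7, M i j.succ * g j = -(M i 0 * f) := by
    intro i
    have := hM0 i
    rw [Fin.sum_univ_succ] at this
    simp only [Fin.cons_zero, Fin.cons_succ] at this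
    linear_combination this
  have hsum : ∀ u : Fin 9 → R4 k,
      ∑ j : Fin 7, (∑ i, u i * M i j.succ) * g j = -(∑ i, u i * M i 0) * f := by
    intro u
    simp_rw [Finset.sum_mul]
    rw [Finset.sum_comm, neg_mul, Finset.sum_mul, ← Finset.sum_neg_distrib]
    refine Finset.sum_congr rfl fun i _ => ?_
    simp_rw [mul_assoc]
    rw [← Finset.mul_sum, hM0' i]
    ring
  refine ⟨g, fun i j => M i j.succ, κ,
    fun j => ⟨?_, (mem_vanishingForms.mp (hgv j)).1⟩, fun x hx => ?_, fun i j => ?_,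
    fun m i => ?_, fun w => ⟨fun hw => ?_, ?_⟩, fun u => ⟨fun hu => ?_, ?_⟩, fun t ht => ?_⟩
  · rw [mem_pointsIdeal_iff hv hZ]
    intro e i
    have := mem_vanishingForms.mp (hgv j)
    rw [homogeneousComponent_of_mem this.1]
    split_ifs
    · exact this.2 i
    · exact map_zero _
  · obtain ⟨w, hw⟩ := hs.exists_combination_of_components hlam h.eq_zero _ hgspan.le
      ((mem_pointsIdeal_iff hv hZ).mp hx)
    refine ⟨fun j => w j.succ, Ideal.mem_span_singleton'.mpr ⟨w 0, ?_⟩⟩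
    rw [hw, Fin.sum_univ_succ]
    simp
  · exact entryOk_of_isHomogeneous (c := 1) rfl one_ne_zero (hM1 i _)
  · exact entryOk_of_isHomogeneous (c := 2) rfl two_ne_zero (hκ2 m i)
  · obtain ⟨c, hc⟩ := Ideal.mem_span_singleton'.mp hw
    obtain ⟨u, hu⟩ := hM (Fin.cons (-c) w) (by
      rw [Fin.sum_univ_succ]
      simp only [Fin.cons_zero, Fin.cons_succ]
      rw [← hc]
      ring)
    exact ⟨u, fun j => by simpa using hu j.succ⟩
  · rintro ⟨u, hu⟩
    refine Ideal.mem_span_singleton'.mpr ⟨-∑ i, u i * M i 0, ?_⟩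
    rw [← hsum]
    exact Finset.sum_congr rfl fun j _ => by rw [hu j]
  · refine hκ u fun j => Fin.cases ?_ (fun j => hu j) j
    have := hsum u
    rw [Finset.sum_eq_zero fun j _ => by rw [hu j, zero_mul]] at this
    exact neg_eq_zero.mp ((mul_eq_zero.mp this.symm).resolve_right hf0)
  · rintro ⟨t, ht⟩ j
    simp only [ht, Finset.sum_mul]
    rw [Finset.sum_comm]
    refine Finset.sum_eq_zero fun m _ => ?_
    simp_rw [mul_assoc]
    rw [← Finset.mul_sum, hκM, mul_zero]
  · exact hinj t ht

end Resolutions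

section Openness

theorem exists_eval_ne_zero_imp_mulVec_injective {k σ ι κ : Type} [Field k] [Fintype ι]
    [Fintype κ] (A : Matrix ι κ (MvPolynomial σ k)) (x₀ : σ → k)
    (h : ∀ y, (A.map (eval x₀)).mulVec y = 0 → y = 0) :
    ∃ g : MvPolynomial σ k, eval x₀ g ≠ 0 ∧
      ∀ x, eval x g ≠ 0 → ∀ y, (A.map (eval x)).mulVec y = 0 → y = 0 := by
  classical
  obtain ⟨L, hL⟩ := LinearMap.exists_leftInverse_of_injective (A.map (eval x₀)).mulVecLin
    (LinearMap.ker_eq_bot'.mpr fun y hy => h y hy)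
  have hL' : LinearMap.toMatrix' L * A.map (eval x₀) = 1 := by
    have := congrArg LinearMap.toMatrix' hL
    rwa [LinearMap.toMatrix'_comp, ← Matrix.toLin'_apply', LinearMap.toMatrix'_toLin',
      LinearMap.toMatrix'_id] at this
  obtain ⟨B, hB⟩ : ∃ B : Matrix κ ι (MvPolynomial σ k), B = (LinearMap.toMatrix' L).map C :=
    ⟨_, rfl⟩
  have hdet : ∀ x, eval x (B * A).det = (LinearMap.toMatrix' L * A.map (eval x)).det := by
    intro x
    subst hB
    rw [RingHom.map_det, RingHom.mapMatrix_apply, Matrix.map_mul, Matrix.map_map]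
    congr 2
    ext i j
    simp
  refine ⟨(B * A).det, ?_, fun x hx y hy => ?_⟩
  · rw [hdet, hL', Matrix.det_one]
    exact one_ne_zero
  · rw [hdet] at hx
    refine Matrix.eq_zero_of_mulVec_eq_zero hx ?_
    rw [← Matrix.mulVec_mulVec, hy, Matrix.mulVec_zero]

variable {k : Type} [Field k] {N d : ℕ}

theorem MvPolynomial.IsHomogeneous.eval_eq_sum_finsuppAntidiag {q : R4 k} (hq : q.IsHomogeneous d)
    (x : Fin 4 → k) : eval x q =
      ∑ m : Finset.finsuppAntidiag (Finset.univ : Finset (Fin 4)) d,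
        (∏ j, x j ^ (m : Fin 4 →₀ ℕ) j) * coeff (m : Fin 4 →₀ ℕ) q := by
  rw [Finset.sum_coe_sort (Finset.finsuppAntidiag (Finset.univ : Finset (Fin 4)) d)
    (fun m => (∏ j, x j ^ m j) * coeff m q), eval_eq']
  simp_rw [mul_comm (coeff _ q)]
  refine Finset.sum_subset (fun m hm => ?_) fun m _ hm => ?_
  · rw [Finset.mem_finsuppAntidiag]
    refine ⟨?_, Finset.subset_univ _⟩
    have : m.degree = d := by
      rw [Finsupp.degree_eq_weight_one]
      exact hq (mem_support_iff.mp hm)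
    rw [← this, Finsupp.degree_eq_sum]
  · rw [notMem_support_iff.mp hm, mul_zero]

theorem isHomogeneous_monomial_of_mem_finsuppAntidiag
    (m : Finset.finsuppAntidiag (Finset.univ : Finset (Fin 4)) d) (c : k) :
    (monomial (m : Fin 4 →₀ ℕ) c).IsHomogeneous d := by
  refine isHomogeneous_monomial _ ?_
  rw [Finsupp.degree_eq_sum]
  exact (Finset.mem_finsuppAntidiag.mp m.2).1

theorem exists_eval_ne_zero_imp_eq_zero {v₀ : Fin N → Fin 4 → k}
    (h : ∀ q : R4 k, q.IsHomogeneous d → (∀ i, eval (v₀ i) q = 0) → q = 0) :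
    ∃ g : MvPolynomial (Fin N × Fin 4) k, eval (fun p => v₀ p.1 p.2) g ≠ 0 ∧
      ∀ v : Fin N → Fin 4 → k, eval (fun p => v p.1 p.2) g ≠ 0 →
        ∀ q : R4 k, q.IsHomogeneous d → (∀ i, eval (v i) q = 0) → q = 0 := by
  classical
  obtain ⟨g, hg, hgx⟩ := exists_eval_ne_zero_imp_mulVec_injective (k := k)
    (Matrix.of fun (i : Fin N) (m : Finset.finsuppAntidiag (Finset.univ : Finset (Fin 4)) d) =>
      ∏ j, (X (i, j) : MvPolynomial (Fin N × Fin 4) k) ^ (m : Fin 4 →₀ ℕ) j)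
    (fun p => v₀ p.1 p.2) (fun y hy => by
      have hq : (∑ m : Finset.finsuppAntidiag (Finset.univ : Finset (Fin 4)) d,
          monomial (m : Fin 4 →₀ ℕ) (y m) : R4 k).IsHomogeneous d :=
        IsHomogeneous.sum _ _ _ fun m _ => isHomogeneous_monomial_of_mem_finsuppAntidiag m _
      have hq0 := h _ hq fun i => by
        have := congrFun hy i
        simp only [Matrix.mulVec, dotProduct, Matrix.map_apply, Matrix.of_apply, map_prod, map_pow,
          eval_X, Pi.zero_apply] at this
        rw [map_sum, ← this]
        refine Finset.sum_congr rfl fun m _ => ?_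
        rw [eval_monomial, Finsupp.prod_fintype _ _ (by simp), mul_comm]
      funext m
      have := congrArg (coeff (m : Fin 4 →₀ ℕ)) hq0
      simpa [coeff_sum, coeff_monomial, Subtype.coe_inj] using this)
  refine ⟨g, hg, fun v hv q hq hqv => ?_⟩
  have := hgx _ hv (fun m => coeff (m : Fin 4 →₀ ℕ) q) (by
    funext i
    have := hqv i
    rw [hq.eval_eq_sum_finsuppAntidiag] at this
    simpa [Matrix.mulVec, dotProduct] using this)
  ext m
  rw [coeff_zero]
  by_cases hm : m ∈ Finset.finsuppAntidiag (Finset.univ : Finset (Fin 4)) d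
  · exact congrFun this ⟨m, hm⟩
  · refine hq.coeff_eq_zero ?_
    intro hd
    refine hm (Finset.mem_finsuppAntidiag.mpr ⟨?_, Finset.subset_univ _⟩)
    rw [← hd, Finsupp.degree_eq_sum]

theorem KoszulCondition.exists_eval_ne_zero_imp {v₀ : Fin N → Fin 4 → k}
    (h : KoszulCondition v₀ d) :
    ∃ g : MvPolynomial (Fin N × Fin 4) k, eval (fun p => v₀ p.1 p.2) g ≠ 0 ∧
      ∀ v : Fin N → Fin 4 → k, eval (fun p => v p.1 p.2) g ≠ 0 → KoszulCondition v d := by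
  classical
  obtain ⟨g, hg, hgx⟩ := exists_eval_ne_zero_imp_mulVec_injective (k := k)
    (Matrix.of fun (r : (Fin 4 × Finset.finsuppAntidiag (Finset.univ : Finset (Fin 4)) d) ⊕ Fin N)
      (c : Fin 4 × Fin N) =>
      (Sum.elim (fun a => if c.1 = a.1 then
        ∏ j, (X (c.2, j) : MvPolynomial (Fin N × Fin 4) k) ^ (a.2 : Fin 4 →₀ ℕ) j else 0)
        (fun i => if c.2 = i then X (i, c.1) else 0) r :
          MvPolynomial (Fin N × Fin 4) k))
    (fun p => v₀ p.1 p.2) (fun y hy => by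
      have := h (fun m i => y (m, i)) (fun m q hq => by
        simp_rw [hq.eval_eq_sum_finsuppAntidiag, Finset.mul_sum]
        rw [Finset.sum_comm]
        refine Finset.sum_eq_zero fun μ _ => ?_
        have := congrFun hy (Sum.inl (m, μ))
        simp only [Matrix.mulVec, dotProduct, Matrix.map_apply, Matrix.of_apply, Sum.elim_inl,
          apply_ite (eval _), map_prod, map_pow, eval_X, map_zero, Pi.zero_apply, ite_mul,
          zero_mul, Fintype.sum_prod_type] at this
        rw [Finset.sum_comm] at this
        simp only [Finset.sum_ite_eq', Finset.mem_univ, if_true] at this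
        calc _ = (∑ i, (∏ j, v₀ i j ^ (μ : Fin 4 →₀ ℕ) j) * y (m, i)) *
              coeff (μ : Fin 4 →₀ ℕ) q := by
              rw [Finset.sum_mul]
              exact Finset.sum_congr rfl fun i _ => by ring
          _ = 0 := by rw [this, zero_mul])
        (fun i => by
          have := congrFun hy (Sum.inr i)
          simpa [Matrix.mulVec, dotProduct, apply_ite (eval _), Fintype.sum_prod_type]
            using this)
      funext c
      exact congrFun (congrFun this c.1) c.2)
  refine ⟨g, hg, fun v hv w hw1 hw2 => ?_⟩
  have := hgx _ hv (fun c => w c.1 c.2) (by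
    funext r
    rcases r with ⟨m, μ⟩ | i
    · have := hw1 m _ (isHomogeneous_monomial_of_mem_finsuppAntidiag μ 1)
      simp only [Matrix.mulVec, dotProduct, Matrix.map_apply, Matrix.of_apply, Sum.elim_inl,
          apply_ite (eval _), map_prod, map_pow, eval_X, map_zero, Pi.zero_apply, ite_mul,
          zero_mul, Fintype.sum_prod_type]
      rw [Finset.sum_comm]
      simp only [Finset.sum_ite_eq', Finset.mem_univ, if_true]
      rw [← this]
      refine Finset.sum_congr rfl fun i _ => ?_
      rw [eval_monomial, Finsupp.prod_fintype _ _ (by simp), one_mul, mul_comm]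
    · simpa [Matrix.mulVec, dotProduct, apply_ite (eval _), Fintype.sum_prod_type] using hw2 i)
  funext m i
  exact congrFun this (m, i)

theorem PointsCondition.exists_eval_ne_zero_imp {v₀ : Fin N → Fin 4 → k}
    (h : PointsCondition v₀ d) :
    ∃ g : MvPolynomial (Fin N × Fin 4) k, eval (fun p => v₀ p.1 p.2) g ≠ 0 ∧
      ∀ v : Fin N → Fin 4 → k, eval (fun p => v p.1 p.2) g ≠ 0 → PointsCondition v d := by
  obtain ⟨g₁, hg₁, h₁⟩ := exists_eval_ne_zero_imp_eq_zero h.eq_zero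
  obtain ⟨g₂, hg₂, h₂⟩ := h.koszul.exists_eval_ne_zero_imp
  refine ⟨g₁ * g₂, by rw [map_mul]; exact mul_ne_zero hg₁ hg₂, fun v hv => ?_⟩
  rw [map_mul] at hv
  exact ⟨h₁ v (left_ne_zero_of_mul hv), h₂ v (right_ne_zero_of_mul hv)⟩

theorem PointsCondition.smul {v : Fin N → Fin 4 → k} (h : PointsCondition v d) {c : Fin N → k}
    (hc : ∀ i, c i ≠ 0) : PointsCondition (fun i m => c i * v i m) d where
  eq_zero q hq hqv := h.eq_zero q hq fun i => by
    have := hqv i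
    rw [hq.eval_smul'] at this
    exact (mul_eq_zero.mp this).resolve_left (pow_ne_zero _ (hc i))
  koszul w hw1 hw2 := by
    have := h.koszul (fun m i => c i ^ d * w m i) (fun m q hq => by
      rw [← hw1 m q hq]
      refine Finset.sum_congr rfl fun i _ => ?_
      rw [hq.eval_smul']
      ring) (fun i => by
      have := hw2 i
      simp_rw [mul_assoc] at this
      rw [← Finset.mul_sum] at this
      calc _ = c i ^ d * ∑ m, v i m * w m i := by
            rw [Finset.mul_sum]
            exact Finset.sum_congr rfl fun m _ => by ring
        _ = 0 := by rw [(mul_eq_zero.mp this).resolve_left (hc i), mul_zero])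
    funext m i
    exact (mul_eq_zero.mp (congrFun (congrFun this m) i)).resolve_left (pow_ne_zero _ (hc i))

theorem exists_sum_mul_ne_zero [Infinite k] {v : Fin N → Fin 4 → k} (hv : ∀ i, v i ≠ 0) :
    ∃ lam : Fin 4 → k, ∀ i, ∑ m, lam m * v i m ≠ 0 := by
  have hne : (∏ i, ∑ m, X m * C (v i m) : R4 k) ≠ 0 := by
    refine Finset.prod_ne_zero_iff.mpr fun i _ h => hv i ?_
    funext b
    have := congrArg (eval (Pi.single b (1 : k))) h
    simpa [Pi.single_apply] using this
  by_contra! hcon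
  refine hne (MvPolynomial.funext fun lam => ?_)
  obtain ⟨i, hi⟩ := hcon lam
  rw [map_prod, map_zero]
  exact Finset.prod_eq_zero (Finset.mem_univ i) (by simpa using hi)

/-- The points can be rescaled so that some linear form takes the value one at each of them. -/
theorem PointsCondition.exists_normalization [Infinite k] {v : Fin N → Fin 4 → k}
    (h : PointsCondition v d) {Z : Fin N → P3 k}
    (hZ : ∀ i, ∃ hv : v i ≠ 0, Projectivization.mk k (v i) hv = Z i) :
    ∃ (v' : Fin N → Fin 4 → k) (lam : Fin 4 → k) (hv : ∀ i, v' i ≠ 0), PointsCondition v' d ∧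
      (∀ i, ∑ m, lam m * v' i m = 1) ∧ ∀ i, Projectivization.mk k (v' i) (hv i) = Z i := by
  choose hv hZ using hZ
  obtain ⟨lam, hlam⟩ := exists_sum_mul_ne_zero hv
  have hc : ∀ i, (∑ m, lam m * v i m)⁻¹ ≠ 0 := fun i => inv_ne_zero (hlam i)
  refine ⟨fun i m => (∑ m, lam m * v i m)⁻¹ * v i m, lam, fun i => smul_ne_zero (hc i) (hv i),
    h.smul hc, fun i => ?_, fun i => ?_⟩
  · simp_rw [mul_left_comm (lam _)]
    rw [← Finset.mul_sum, inv_mul_cancel₀ (hlam i)]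
  · rw [← hZ i, Projectivization.mk_eq_mk_iff']
    exact ⟨_, rfl⟩

theorem KoszulCondition.injective {v : Fin N → Fin 4 → k} (h : KoszulCondition v d)
    (hv : ∀ i, v i ≠ 0) : Function.Injective fun i => Projectivization.mk k (v i) (hv i) := by
  intro j i hij
  by_contra hne
  obtain ⟨c, hc⟩ := (Projectivization.mk_eq_mk_iff' k _ _ (hv j) (hv i)).mp hij
  obtain ⟨b, hb⟩ := Function.ne_iff.mp (hv i)
  obtain ⟨a, hab⟩ := exists_ne b
  have hvj : v j = fun m => c * v i m := hc.symm
  let l : Fin 4 → k := fun m => if m = a then v i b else if m = b then -v i a else 0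
  have hl : ∑ m, v i m * l m = 0 := by
    have : ∀ m, v i m * l m = (if m = a then v i a * v i b else 0) +
        if m = b then -(v i a * v i b) else 0 := by
      intro m
      simp only [l]
      by_cases h1 : m = a
      · simp [h1, hab]
      · by_cases h2 : m = b
        · subst h2
          simp only [h1, if_false, if_true]
          ring
        · simp [h1, h2]
    simp [this, Finset.sum_add_distrib]
  have := h (fun m e => l m * ((if e = j then 1 else 0) + if e = i then -c ^ d else 0))
    (fun m q hq => by
      simp_rw [mul_assoc, add_mul]
      rw [← Finset.mul_sum, Finset.sum_add_distrib]
      simp [hvj, hq.eval_smul'])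
    (fun e => by
      simp_rw [← mul_assoc]
      rw [← Finset.sum_mul]
      by_cases hj : e = j
      · subst hj
        rw [hvj]
        simp_rw [mul_assoc]
        rw [← Finset.mul_sum, hl]
        simp
      · by_cases hi : e = i
        · subst hi
          rw [hl, zero_mul]
        · simp [hi, hj])
  have := congrFun (congrFun this a) j
  simp [l, hne] at this
  exact hb this

theorem PointsCondition.generalPointsSatisfy [Infinite k] {S : SmoothCubicSurface k}
    {v₀ : Fin N → Fin 4 → k} (h : PointsCondition v₀ d) (hv₀ : ∀ i, v₀ i ≠ 0)
    (hS : ∀ i, eval (v₀ i) S.f = 0) {P : (Fin N → P3 k) → Prop}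
    (hP : ∀ (v : Fin N → Fin 4 → k) (lam : Fin 4 → k), PointsCondition v d →
      (∀ i, ∑ m, lam m * v i m = 1) → ∀ (Z : Fin N → P3 k) (hv : ∀ i, v i ≠ 0),
      (∀ i, Projectivization.mk k (v i) (hv i) = Z i) → (∀ i, VanishesAt k S.f (Z i)) → P Z) :
    GeneralPointsSatisfy k S N P := by
  obtain ⟨g, hg, hgx⟩ := h.exists_eval_ne_zero_imp
  refine ⟨g, ⟨fun i => Projectivization.mk k (v₀ i) (hv₀ i), ⟨h.koszul.injective hv₀,
    fun i x hx hxv => ?_⟩, v₀, fun i => ⟨hv₀ i, rfl⟩, hg⟩, ?_⟩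
  · obtain ⟨c, hc⟩ := (Projectivization.mk_eq_mk_iff' k _ _ hx (hv₀ i)).mp hxv
    have hx' : x = fun m => c * v₀ i m := hc.symm
    rw [hx', S.homog.eval_smul', hS, mul_zero]
  · rintro Z ⟨-, hZS⟩ ⟨v, hvZ, hgv⟩
    obtain ⟨v', lam, hv', hpc, hlam, hZ⟩ := (hgx v hgv).exists_normalization hvZ
    exact hP v' lam hpc hlam Z hv' hZ hZS

end Openness

section LinearChange

variable {k : Type} [Field k] {N d : ℕ}

/-- The linear form with the given coefficients. -/
noncomputable def linearForm (c : Fin 4 → k) : R4 k := ∑ i, C (c i) * X i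

@[simp]
theorem eval_linearForm (c x : Fin 4 → k) : eval x (linearForm c) = ∑ i, c i * x i := by
  simp [linearForm]

theorem linearForm_isHomogeneous (c : Fin 4 → k) : (linearForm c).IsHomogeneous 1 :=
  IsHomogeneous.sum _ _ _ fun _ _ => isHomogeneous_C_mul_X _ _

theorem linearForm_ne_zero {c : Fin 4 → k} (hc : c ≠ 0) : linearForm c ≠ 0 := by
  intro h
  refine hc (funext fun b => ?_)
  simpa [Pi.single_apply] using congrArg (eval (Pi.single b (1 : k))) h

@[simp]
theorem linearForm_zero : linearForm (0 : Fin 4 → k) = 0 := by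
  simp [linearForm]

theorem MvPolynomial.IsHomogeneous.exists_eq_linearForm {q : R4 k} (hq : q.IsHomogeneous 1) :
    ∃ c : Fin 4 → k, q = linearForm c := by
  obtain ⟨p, hp, rfl⟩ := exists_eq_sum_X_mul (d := 0) hq
  refine ⟨fun i => coeff 0 (p i), Finset.sum_congr rfl fun i _ => ?_⟩
  rw [← totalDegree_eq_zero_iff_eq_C.mp (Nat.le_zero.mp (hp i).totalDegree_le), mul_comm]

theorem MvPolynomial.IsHomogeneous.exists_eq_sum_two {q : R4 k} (hq : q.IsHomogeneous 2) :
    ∃ c : Fin 4 → Fin 4 → k, q = ∑ i, X i * linearForm (c i) := by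
  obtain ⟨p, hp, rfl⟩ := exists_eq_sum_X_mul (d := 1) hq
  choose c hc using fun i => (hp i).exists_eq_linearForm
  exact ⟨c, Finset.sum_congr rfl fun i _ => by rw [hc]⟩

theorem MvPolynomial.IsHomogeneous.exists_eq_sum_three {q : R4 k} (hq : q.IsHomogeneous 3) :
    ∃ c : Fin 4 → Fin 4 → Fin 4 → k, q = ∑ i, X i * ∑ j, X j * linearForm (c i j) := by
  obtain ⟨p, hp, rfl⟩ := exists_eq_sum_X_mul (d := 2) hq
  choose c hc using fun i => (hp i).exists_eq_sum_two
  exact ⟨c, Finset.sum_congr rfl fun i _ => by rw [hc]⟩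

/-- Composition of a polynomial with the linear map `c ↦ c ᵥ* M`. -/
noncomputable def substMatrix (M : Matrix (Fin 4) (Fin 4) k) (q : R4 k) : R4 k :=
  aeval (fun i => linearForm fun j => M j i) q

theorem eval_substMatrix (M : Matrix (Fin 4) (Fin 4) k) (q : R4 k) (c : Fin 4 → k) :
    eval c (substMatrix M q) = eval (Matrix.vecMul c M) q := by
  rw [substMatrix, aeval_def, ← coe_eval₂Hom, ← RingHom.comp_apply]
  congr 1
  refine MvPolynomial.ringHom_ext (fun r => by simp) fun i => ?_
  simp [Matrix.vecMul, dotProduct, mul_comm]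

theorem MvPolynomial.IsHomogeneous.substMatrix {q : R4 k} (hq : q.IsHomogeneous d)
    (M : Matrix (Fin 4) (Fin 4) k) : (substMatrix M q).IsHomogeneous d := by
  have := hq.aeval (fun i => linearForm fun j => M j i) fun i => linearForm_isHomogeneous _
  rwa [one_mul] at this

theorem eq_zero_of_substMatrix_eq_zero [Infinite k] {M : Matrix (Fin 4) (Fin 4) k} (hM : IsUnit M)
    {q : R4 k} (hq : substMatrix M q = 0) : q = 0 := by
  refine MvPolynomial.funext fun x => ?_
  obtain ⟨c, rfl⟩ := Matrix.vecMul_surjective_iff_isUnit.mpr hM x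
  rw [← eval_substMatrix, hq, map_zero, map_zero]

theorem isUnit_of_vecMul_eq_zero {n : ℕ} {M : Matrix (Fin n) (Fin n) k}
    (h : ∀ y, Matrix.vecMul y M = 0 → y = 0) : IsUnit M := by
  rw [← Matrix.vecMul_injective_iff_isUnit]
  intro x y hxy
  refine sub_eq_zero.mp (h _ ?_)
  rw [Matrix.sub_vecMul, sub_eq_zero]
  exact hxy

theorem PointsCondition.vecMul [Infinite k] {v : Fin N → Fin 4 → k} (h : PointsCondition v d)
    {M : Matrix (Fin 4) (Fin 4) k} (hM : IsUnit M) :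
    PointsCondition (fun i => Matrix.vecMul (v i) M) d where
  eq_zero q hq hqv := eq_zero_of_substMatrix_eq_zero hM <|
    h.eq_zero _ (hq.substMatrix M) fun i => by rw [eval_substMatrix, hqv]
  koszul w hw1 hw2 := by
    have key := h.koszul (fun j i => ∑ m, M j m * w m i) (fun j q hq => by
      simp_rw [Finset.sum_mul]
      rw [Finset.sum_comm]
      refine Finset.sum_eq_zero fun m _ => ?_
      simp_rw [mul_assoc]
      rw [← Finset.mul_sum]
      have := hw1 m _ (hq.substMatrix M⁻¹)
      simp_rw [eval_substMatrix, Matrix.vecMul_vecMul,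
        Matrix.mul_nonsing_inv _ ((Matrix.isUnit_iff_isUnit_det M).mp hM), Matrix.vecMul_one] at this
      rw [this, mul_zero]) (fun i => by
      rw [← hw2 i]
      simp only [Matrix.vecMul, dotProduct, Finset.mul_sum, Finset.sum_mul]
      rw [Finset.sum_comm]
      exact Finset.sum_congr rfl fun m _ => Finset.sum_congr rfl fun j _ => by ring)
    funext m i
    have h0 : M.mulVec (fun m => w m i) = 0 := funext fun j => congrFun (congrFun key j) i
    exact congrFun (Matrix.mulVec_injective_iff_isUnit.mpr hM (h0.trans (Matrix.mulVec_zero M).symm)) m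

theorem KoszulCondition.ne_zero {v : Fin N → Fin 4 → k} (h : KoszulCondition v d) (hd : d ≠ 0)
    (i : Fin N) : v i ≠ 0 := by
  intro hi
  have h0 : ∀ q : R4 k, q.IsHomogeneous d → eval (v i) q = 0 := by
    intro q hq
    have := hq.eval_smul' 0 (v i)
    rw [zero_pow hd, zero_mul] at this
    rw [← this, hi]
    congr 2
    exact funext fun _ => (zero_mul _).symm
  have := h (fun _ => Pi.single i 1) (fun m q hq => by simp [Pi.single_apply, h0 q hq])
    (fun j => by
      by_cases hj : j = i
      · subst hj
        simp [hi]
      · simp [hj])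
  simpa using congrFun (congrFun this 0) i

end LinearChange

section GenericPoints

variable {k : Type} [Field k]

/-- No nonzero forms of degree at most two, finitely many, cover the set. -/
def MeetsLowDegreeComplements (Y : Set (Fin 4 → k)) : Prop :=
  ∀ l : List (R4 k), (∀ p ∈ l, p ≠ 0 ∧ ∃ d < 3, p.IsHomogeneous d) →
    ∃ x ∈ Y, ∀ p ∈ l, eval x p ≠ 0

theorem SmoothCubicSurface.meetsLowDegreeComplements [IsAlgClosed k] (S : SmoothCubicSurface k) :
    MeetsLowDegreeComplements {x | eval x S.f = 0} := by
  intro l hl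
  have hprime : (Ideal.span {S.f}).IsPrime :=
    (Ideal.span_singleton_prime S.irred.ne_zero).mpr S.irred.prime
  have hnot : ∀ p ∈ l, p ∉ Ideal.span {S.f} := by
    intro p hp hmem
    obtain ⟨hp0, d, hd, hpd⟩ := hl p hp
    obtain ⟨c, rfl⟩ := Ideal.mem_span_singleton'.mp hmem
    have h1 := hpd.totalDegree hp0
    rw [totalDegree_mul_of_isDomain (left_ne_zero_of_mul hp0) S.irred.ne_zero,
      S.homog.totalDegree S.irred.ne_zero] at h1
    omega
  have hprod : l.prod ∉ Ideal.span {S.f} := by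
    clear hl
    induction l with
    | nil => simpa using fun h => hprime.ne_top ((Ideal.eq_top_iff_one _).mpr h)
    | cons p l ih =>
      rw [List.prod_cons]
      intro h
      rcases hprime.mem_or_mem h with h | h
      · exact hnot p (by simp) h
      · exact ih (fun q hq => hnot q (by simp [hq])) h
  have hnull := vanishingIdeal_zeroLocus_eq_radical (K := k) (Ideal.span {S.f})
  rw [hprime.radical] at hnull
  rw [← hnull, mem_vanishingIdeal_iff] at hprod
  push Not at hprod
  obtain ⟨x, hx, hxp⟩ := hprod
  refine ⟨x, ?_, fun p hp h0 => hxp ?_⟩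
  · have := mem_zeroLocus_iff.mp hx S.f (Ideal.mem_span_singleton_self _)
    simpa using this
  · rw [map_list_prod]
    exact List.prod_eq_zero (List.mem_map.mpr ⟨p, hp, by simpa using h0⟩)

theorem MeetsLowDegreeComplements.vecMul_preimage [Infinite k] {Y : Set (Fin 4 → k)}
    (h : MeetsLowDegreeComplements Y) {M : Matrix (Fin 4) (Fin 4) k} (hM : IsUnit M) :
    MeetsLowDegreeComplements {c | Matrix.vecMul c M ∈ Y} := by
  intro l hl
  have hdet := (Matrix.isUnit_iff_isUnit_det M).mp hM
  obtain ⟨x, hx, hxl⟩ := h (l.map (substMatrix M⁻¹)) (by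
    intro p hp
    obtain ⟨q, hq, rfl⟩ := List.mem_map.mp hp
    obtain ⟨hq0, d, hd, hqd⟩ := hl q hq
    exact ⟨fun h0 => hq0 (eq_zero_of_substMatrix_eq_zero
      (Matrix.isUnit_nonsing_inv_iff.mpr hM) h0), d, hd, hqd.substMatrix _⟩)
  refine ⟨Matrix.vecMul x M⁻¹, ?_, fun p hp => ?_⟩
  · simpa [Matrix.nonsing_inv_mul _ hdet] using hx
  · rw [← eval_substMatrix]
    exact hxl _ (List.mem_map_of_mem hp)

theorem exists_orthogonal {m n : ℕ} (hmn : m < n) (y : Fin m → Fin n → k) :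
    ∃ c : Fin n → k, c ≠ 0 ∧ ∀ j, ∑ i, c i * y j i = 0 := by
  have := LinearMap.ker_ne_bot_of_finrank_lt (f := (Matrix.of y).mulVecLin) (by simpa using hmn)
  obtain ⟨c, hc, hc0⟩ := Submodule.exists_mem_ne_zero_of_ne_bot this
  refine ⟨c, hc0, fun j => ?_⟩
  have := congrFun (LinearMap.mem_ker.mp hc) j
  simpa [Matrix.mulVec, dotProduct, mul_comm] using this

theorem isUnit_of_triangular {t c : Fin 4 → Fin 4 → k} (hdiag : ∀ i, ∑ m, c i m * t i m ≠ 0)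
    (htri : ∀ i j, j < i → ∑ m, c i m * t j m = 0) : IsUnit (Matrix.of t) := by
  have hdet : (Matrix.of c * (Matrix.of t).transpose).det ≠ 0 := by
    rw [Matrix.det_of_isUpperTriangular (M := Matrix.of c * (Matrix.of t).transpose)
      fun i j hij => htri i j hij]
    exact Finset.prod_ne_zero_iff.mpr fun i _ => hdiag i
  rw [Matrix.det_mul, Matrix.det_transpose] at hdet
  rw [Matrix.isUnit_iff_isUnit_det]
  exact (right_ne_zero_of_mul hdet).isUnit

theorem isUnit_of_orthogonal {t₀ t₁ t₂ t₃ c₀ c₁ c₂ c₃ : Fin 4 → k}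
    (h₀ : ∑ m, c₀ m * t₀ m ≠ 0) (h₁ : ∑ m, c₁ m * t₁ m ≠ 0) (h₂ : ∑ m, c₂ m * t₂ m ≠ 0)
    (h₃ : ∑ m, c₃ m * t₃ m ≠ 0) (hk₁ : ∀ j, ∑ m, c₁ m * ![t₀] j m = 0)
    (hk₂ : ∀ j, ∑ m, c₂ m * ![t₀, t₁] j m = 0) (hk₃ : ∀ j, ∑ m, c₃ m * ![t₀, t₁, t₂] j m = 0) :
    IsUnit (Matrix.of ![t₀, t₁, t₂, t₃]) := by
  refine isUnit_of_triangular (c := ![c₀, c₁, c₂, c₃]) ?_ ?_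
  · intro i
    fin_cases i <;> assumption
  · intro i j hij
    fin_cases i <;> fin_cases j <;> first
      | exact absurd hij (by decide)
      | exact hk₁ 0
      | exact hk₂ 0
      | exact hk₂ 1
      | exact hk₃ 0
      | exact hk₃ 1
      | exact hk₃ 2

theorem MeetsLowDegreeComplements.exists_linearForm {Y : Set (Fin 4 → k)}
    (h : MeetsLowDegreeComplements Y) {c : Fin 4 → k} (hc : c ≠ 0) {l : List (R4 k)}
    (hl : ∀ p ∈ l, p ≠ 0 ∧ ∃ d < 3, p.IsHomogeneous d) :
    ∃ x ∈ Y, ∑ m, c m * x m ≠ 0 ∧ ∀ p ∈ l, eval x p ≠ 0 := by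
  obtain ⟨x, hx, hxl⟩ := h (linearForm c :: l) (by
    simp only [List.mem_cons, forall_eq_or_imp]
    exact ⟨⟨linearForm_ne_zero hc, 1, by norm_num, linearForm_isHomogeneous _⟩, hl⟩)
  simp only [List.mem_cons, forall_eq_or_imp, eval_linearForm] at hxl
  exact ⟨x, hx, hxl⟩

theorem MeetsLowDegreeComplements.exists_basis {Y : Set (Fin 4 → k)}
    (h : MeetsLowDegreeComplements Y) :
    ∃ M : Matrix (Fin 4) (Fin 4) k, IsUnit M ∧ ∀ i, M i ∈ Y := by
  obtain ⟨c₀, hc₀, -⟩ := exists_orthogonal (k := k) (m := 0) (n := 4) (by norm_num) Fin.elim0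
  obtain ⟨t₀, ht₀, h₀, -⟩ := h.exists_linearForm hc₀ (l := []) (by simp)
  obtain ⟨c₁, hc₁, hk₁⟩ := exists_orthogonal (k := k) (n := 4) (by norm_num) ![t₀]
  obtain ⟨t₁, ht₁, h₁, -⟩ := h.exists_linearForm hc₁ (l := []) (by simp)
  obtain ⟨c₂, hc₂, hk₂⟩ := exists_orthogonal (k := k) (n := 4) (by norm_num) ![t₀, t₁]
  obtain ⟨t₂, ht₂, h₂, -⟩ := h.exists_linearForm hc₂ (l := []) (by simp)
  obtain ⟨c₃, hc₃, hk₃⟩ := exists_orthogonal (k := k) (n := 4) (by norm_num) ![t₀, t₁, t₂]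
  obtain ⟨t₃, ht₃, h₃, -⟩ := h.exists_linearForm hc₃ (l := []) (by simp)
  refine ⟨Matrix.of ![t₀, t₁, t₂, t₃], isUnit_of_orthogonal h₀ h₁ h₂ h₃ hk₁ hk₂ hk₃, fun i => ?_⟩
  fin_cases i <;> assumption

/-- The coordinate points together with a point off the coordinate planes. -/
theorem pointsCondition_five {x : Fin 4 → k} (hx : ∀ i, x i ≠ 0) :
    PointsCondition (Fin.snoc (fun i : Fin 4 => Pi.single i 1) x : Fin 5 → Fin 4 → k) 1 where
  eq_zero q hq hqv := by
    obtain ⟨c, rfl⟩ := hq.exists_eq_linearForm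
    rw [← linearForm_zero]
    congr 1
    funext i
    have := hqv (Fin.castSucc i)
    rw [Fin.snoc_castSucc] at this
    simpa [Pi.single_apply] using this
  koszul w hw1 hw2 := by
    have h1 : ∀ m j, w m (Fin.castSucc j) + w m (Fin.last 4) * x j = 0 := by
      intro m j
      have := hw1 m (X j) (isHomogeneous_X _ _)
      rw [Fin.sum_univ_castSucc] at this
      simp only [Fin.snoc_castSucc, Fin.snoc_last] at this
      simpa [Pi.single_apply] using this
    have h2 : ∀ i, w i (Fin.castSucc i) = 0 := by
      intro i
      have := hw2 (Fin.castSucc i)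
      simp only [Fin.snoc_castSucc] at this
      simpa [Pi.single_apply] using this
    have h3 : ∀ i, w i (Fin.last 4) = 0 := by
      intro i
      have := h1 i i
      rw [h2, zero_add] at this
      exact (mul_eq_zero.mp this).resolve_right (hx i)
    funext m j
    refine Fin.lastCases (h3 m) (fun j => ?_) j
    have := h1 m j
    rwa [h3, zero_mul, add_zero] at this

theorem SmoothCubicSurface.exists_pointsCondition_five [IsAlgClosed k]
    (S : SmoothCubicSurface k) :
    ∃ v : Fin 5 → Fin 4 → k, PointsCondition v 1 ∧ ∀ i, eval (v i) S.f = 0 := by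
  obtain ⟨M, hM, hMS⟩ := S.meetsLowDegreeComplements.exists_basis
  obtain ⟨x, hx, hxl⟩ := (S.meetsLowDegreeComplements.vecMul_preimage hM)
    (List.ofFn fun i => X i) (by
      simp only [List.forall_mem_ofFn_iff]
      exact fun i => ⟨X_ne_zero i, 1, by norm_num, isHomogeneous_X _ _⟩)
  simp only [List.forall_mem_ofFn_iff, eval_X] at hxl
  refine ⟨_, (pointsCondition_five hxl).vecMul hM, fun i => ?_⟩
  refine Fin.lastCases ?_ (fun i => ?_) i
  · rw [Fin.snoc_last]
    exact hx
  · rw [Fin.snoc_castSucc, Matrix.single_one_vecMul]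
    exact hMS i

end GenericPoints

section TwelvePoints

variable {k : Type} [Field k]

/-- Eight points: three on each of two skew lines, and two on a transversal of these lines. -/
def eightPoints (ε α γ ε' α' γ' r s : k) : Fin 8 → Fin 4 → k :=
  ![![1, -ε, 0, 0], ![0, 1, 0, 0], ![α, γ, 0, 0], ![0, 0, 1, -ε'], ![0, 0, 0, 1], ![0, 0, α', γ'],
    ![r, 0, 1, 0], ![s, 0, 1, 0]]

/-- The values at a point of the quadrics through `eightPoints`. -/
def residualQuadrics (x : Fin 4 → k) : Fin 3 → k := ![x 0 * x 3, x 1 * x 2, x 1 * x 3]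

theorem isUnit_residualQuadrics {t : Fin 4 → Fin 4 → k}
    (ht : ∀ i (y : Fin 4 → k), y i = 0 → (∀ j, ∑ i, y i * residualQuadrics (t i) j = 0) → y = 0) :
    IsUnit (Matrix.of fun i : Fin 3 => residualQuadrics (t (Fin.castSucc i))) := by
  refine isUnit_of_vecMul_eq_zero fun y hy => ?_
  have := ht (Fin.last 3) (Fin.snoc y 0 : Fin 4 → k) (Fin.snoc_last (α := fun _ => k) _ _)
    fun j => by
      rw [Fin.sum_univ_castSucc]
      simp only [Fin.snoc_castSucc, Fin.snoc_last, zero_mul, add_zero]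
      exact congrFun hy j
  funext i
  have h := congrFun this (Fin.castSucc i)
  rwa [Fin.snoc_castSucc] at h

theorem pointsCondition_twelve {ε α γ ε' α' γ' r s : k} (hε : ε ≠ 0) (hα : α ≠ 0) (hγ : γ ≠ 0)
    (hβ : γ + α * ε ≠ 0) (hε' : ε' ≠ 0) (hα' : α' ≠ 0) (hγ' : γ' ≠ 0) (hβ' : γ' + α' * ε' ≠ 0)
    (hr : r ≠ 0) (hs : s ≠ 0) (hrs : r ≠ s) {t : Fin 4 → Fin 4 → k} (hunit : IsUnit (Matrix.of t))
    (ht : ∀ i (y : Fin 4 → k), y i = 0 → (∀ j, ∑ i, y i * residualQuadrics (t i) j = 0) → y = 0) :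
    PointsCondition (N := 12)
      (Fin.append (eightPoints ε α γ ε' α' γ' r s) t : Fin (8 + 4) → Fin 4 → k) 2 where
  eq_zero q hq hqv := by
    have h8 : ∀ i, eval (eightPoints ε α γ ε' α' γ' r s i) q = 0 := fun i => by
      have := hqv (Fin.castAdd 4 i)
      rwa [Fin.append_left] at this
    have h4 : ∀ i, eval (t i) q = 0 := fun i => by
      have := hqv (Fin.natAdd 8 i)
      rwa [Fin.append_right] at this
    obtain ⟨c, rfl⟩ := hq.exists_eq_sum_two
    have heval : ∀ x : Fin 4 → k, eval x (∑ i, X i * linearForm (c i)) =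
      c 0 0 * x 0 ^ 2 + c 1 1 * x 1 ^ 2 + c 2 2 * x 2 ^ 2 + c 3 3 * x 3 ^ 2 +
      (c 0 1 + c 1 0) * (x 0 * x 1) + (c 2 3 + c 3 2) * (x 2 * x 3) +
      (c 0 2 + c 2 0) * (x 0 * x 2) + (c 0 3 + c 3 0) * (x 0 * x 3) +
      (c 1 2 + c 2 1) * (x 1 * x 2) + (c 1 3 + c 3 1) * (x 1 * x 3) := by
      intro x
      rw [map_sum]
      simp only [map_mul, eval_X, eval_linearForm, Fin.sum_univ_four]
      ring
    simp only [heval] at h8 h4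
    have e0 := h8 0
    have e1 := h8 1
    have e2 := h8 2
    have e3 := h8 3
    have e4 := h8 4
    have e5 := h8 5
    have e6 := h8 6
    simp only [eightPoints, Matrix.cons_val] at e0 e1 e2 e3 e4 e5 e6
    have k11 : c 1 1 = 0 := by linear_combination e1
    have k33 : c 3 3 = 0 := by linear_combination e4
    have k01 : c 0 1 + c 1 0 = 0 := by
      refine (mul_eq_zero.mp (?_ : α * (γ + α * ε) * (c 0 1 + c 1 0) = 0)).resolve_left
        (mul_ne_zero hα hβ)
      linear_combination e2 - α ^ 2 * e0 + (α ^ 2 * ε ^ 2 - γ ^ 2) * k11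
    have k23 : c 2 3 + c 3 2 = 0 := by
      refine (mul_eq_zero.mp (?_ : α' * (γ' + α' * ε') * (c 2 3 + c 3 2) = 0)).resolve_left
        (mul_ne_zero hα' hβ')
      linear_combination e5 - α' ^ 2 * e3 + (α' ^ 2 * ε' ^ 2 - γ' ^ 2) * k33
    have k00 : c 0 0 = 0 := by linear_combination e0 - ε ^ 2 * k11 + ε * k01
    have k22 : c 2 2 = 0 := by linear_combination e3 - ε' ^ 2 * k33 + ε' * k23
    have k02 : c 0 2 + c 2 0 = 0 := by
      refine (mul_eq_zero.mp (?_ : r * (c 0 2 + c 2 0) = 0)).resolve_left hr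
      linear_combination e6 - r ^ 2 * k00 - k22
    have hz : ![c 0 3 + c 3 0, c 1 2 + c 2 1, c 1 3 + c 3 1] = 0 := by
      refine Matrix.mulVec_injective_iff_isUnit.mpr (isUnit_residualQuadrics ht) ?_
      refine Eq.trans (funext fun i => ?_) (Matrix.mulVec_zero _).symm
      have := h4 (Fin.castSucc i)
      simp only [k00, k11, k22, k33, k01, k23, k02] at this
      simp only [Matrix.mulVec, dotProduct, Fin.sum_univ_three, Matrix.of_apply, residualQuadrics,
        Matrix.cons_val, Pi.zero_apply]
      linear_combination this
    have k03 : c 0 3 + c 3 0 = 0 := congrFun hz 0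
    have k12 : c 1 2 + c 2 1 = 0 := congrFun hz 1
    have k13 : c 1 3 + c 3 1 = 0 := congrFun hz 2
    have hX : (∑ i, X i * linearForm (c i) : R4 k) =
      C (c 0 0) * X 0 ^ 2 + C (c 1 1) * X 1 ^ 2 + C (c 2 2) * X 2 ^ 2 + C (c 3 3) * X 3 ^ 2 +
      C (c 0 1 + c 1 0) * (X 0 * X 1) + C (c 2 3 + c 3 2) * (X 2 * X 3) +
      C (c 0 2 + c 2 0) * (X 0 * X 2) + C (c 0 3 + c 3 0) * (X 0 * X 3) +
      C (c 1 2 + c 2 1) * (X 1 * X 2) + C (c 1 3 + c 3 1) * (X 1 * X 3) := by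
      simp only [linearForm, Fin.sum_univ_four, C_add]
      ring
    rw [hX, k00, k11, k22, k33, k01, k23, k02, k03, k12, k13]
    simp
  koszul w hw1 hw2 := by
    obtain ⟨a, b, rfl⟩ : ∃ (a : Fin 4 → Fin 8 → k) (b : Fin 4 → Fin 4 → k),
        w = fun m => (Fin.append (a m) (b m) : Fin (8 + 4) → k) :=
      ⟨fun m i => w m (Fin.castAdd 4 i), fun m i => w m (Fin.natAdd 8 i),
        funext fun m => (Fin.append_castAdd_natAdd (m := 8) (n := 4) (f := w m)).symm⟩
    have key : ∀ m i j, ∑ e, a m e * (eightPoints ε α γ ε' α' γ' r s e i *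
        eightPoints ε α γ ε' α' γ' r s e j) + ∑ e, b m e * (t e i * t e j) = 0 := by
      intro m i j
      have := hw1 m (X i * X j) ((isHomogeneous_X _ _).mul (isHomogeneous_X _ _))
      rw [Fin.sum_univ_add (a := 8) (b := 4)] at this
      simpa only [Fin.append_left, Fin.append_right, map_mul, eval_X] using this
    have hw8 : ∀ e, ∑ m, eightPoints ε α γ ε' α' γ' r s e m * a m e = 0 := by
      intro e
      have := hw2 (Fin.castAdd 4 e)
      simpa only [Fin.append_left] using this
    have hw4 : ∀ e, ∑ m, t e m * b m e = 0 := by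
      intro e
      have := hw2 (Fin.natAdd 8 e)
      simpa only [Fin.append_right] using this
    simp only [Fin.sum_univ_eight, eightPoints, Matrix.cons_val] at key
    have hres : ∀ m j, ∑ e, b m e * residualQuadrics (t e) j = 0 := by
      intro m j
      fin_cases j
      · simpa [residualQuadrics] using key m 0 3
      · simpa [residualQuadrics] using key m 1 2
      · simpa [residualQuadrics] using key m 1 3
    have hb : b = 0 := by
      by_contra hb
      obtain ⟨m₀, hm₀⟩ := Function.ne_iff.mp hb
      obtain ⟨e₀, he₀⟩ := Function.ne_iff.mp hm₀
      simp only [Pi.zero_apply] at he₀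
      have hne : ∀ e, b m₀ e ≠ 0 := fun e he => hm₀ (ht e _ he (hres m₀))
      have hprop : ∀ m e, b m e = b m e₀ / b m₀ e₀ * b m₀ e := by
        intro m e
        have := ht e₀ (fun e => b m e - b m e₀ / b m₀ e₀ * b m₀ e) (by field_simp; ring) (fun j => by
          simp_rw [sub_mul, mul_assoc]
          rw [Finset.sum_sub_distrib, ← Finset.mul_sum, hres, hres, mul_zero, sub_zero])
        exact sub_eq_zero.mp (congrFun this e)
      have hlam : (fun m => b m e₀ / b m₀ e₀) = 0 := by
        refine Matrix.mulVec_injective_iff_isUnit.mpr hunit ?_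
        refine Eq.trans (funext fun e => ?_) (Matrix.mulVec_zero _).symm
        refine (mul_eq_zero.mp (?_ : (∑ m, t e m * (b m e₀ / b m₀ e₀)) * b m₀ e = 0)).resolve_right
          (hne e)
        rw [Finset.sum_mul, ← hw4 e]
        refine Finset.sum_congr rfl fun m _ => ?_
        rw [mul_assoc, ← hprop]
      have := congrFun hlam m₀
      simp only [div_self he₀, Pi.zero_apply, one_ne_zero] at this
    subst hb
    simp only [Pi.zero_apply, zero_mul, Finset.sum_const_zero, add_zero] at key
    have f0 : ∀ m, a m 0 + α ^ 2 * a m 2 + r ^ 2 * a m 6 + s ^ 2 * a m 7 = 0 := fun m => by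
      have := key m 0 0
      simp only [Matrix.cons_val] at this
      linear_combination this
    have f1 : ∀ m, α * γ * a m 2 = ε * a m 0 := fun m => by
      have := key m 0 1
      simp only [Matrix.cons_val] at this
      linear_combination this
    have f2 : ∀ m, ε ^ 2 * a m 0 + a m 1 + γ ^ 2 * a m 2 = 0 := fun m => by
      have := key m 1 1
      simp only [Matrix.cons_val] at this
      linear_combination this
    have g0 : ∀ m, a m 3 + α' ^ 2 * a m 5 + a m 6 + a m 7 = 0 := fun m => by
      have := key m 2 2
      simp only [Matrix.cons_val] at this
      linear_combination this
    have g1 : ∀ m, α' * γ' * a m 5 = ε' * a m 3 := fun m => by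
      have := key m 2 3
      simp only [Matrix.cons_val] at this
      linear_combination this
    have g2 : ∀ m, ε' ^ 2 * a m 3 + a m 4 + γ' ^ 2 * a m 5 = 0 := fun m => by
      have := key m 3 3
      simp only [Matrix.cons_val] at this
      linear_combination this
    have hpq : ∀ m, r * a m 6 + s * a m 7 = 0 := fun m => by
      have := key m 0 2
      simp only [Matrix.cons_val] at this
      linear_combination this
    have A0 : ∀ m, (γ + α * ε) * a m 0 = -(γ * r * (r - s)) * a m 6 := fun m => by
      linear_combination γ * f0 m - α * f1 m - γ * s * hpq m
    have A2 : ∀ m, α * (γ + α * ε) * a m 2 = -(ε * r * (r - s)) * a m 6 := fun m => by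
      refine mul_left_cancel₀ hγ ?_
      linear_combination (γ + α * ε) * f1 m + ε * A0 m
    have B0 : ∀ m, s * (γ' + α' * ε') * a m 3 = -(γ' * (s - r)) * a m 6 := fun m => by
      linear_combination γ' * s * g0 m - α' * s * g1 m - γ' * hpq m
    have B2 : ∀ m, α' * s * (γ' + α' * ε') * a m 5 = -(ε' * (s - r)) * a m 6 := fun m => by
      refine mul_left_cancel₀ hγ' ?_
      linear_combination s * (γ' + α' * ε') * g1 m + ε' * B0 m
    have hrs' : r - s ≠ 0 := sub_ne_zero.mpr hrs
    have o0 := hw8 0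
    have o2 := hw8 2
    have o3 := hw8 3
    have o5 := hw8 5
    simp only [Fin.sum_univ_four, eightPoints, Matrix.cons_val] at o0 o2 o3 o5
    have p01 : a 0 6 = ε * a 1 6 := by
      refine sub_eq_zero.mp ((mul_eq_zero.mp (?_ : γ * r * (r - s) * _ = 0)).resolve_left
        (mul_ne_zero (mul_ne_zero hγ hr) hrs'))
      linear_combination A0 0 - ε * A0 1 - (γ + α * ε) * o0
    have p1 : a 1 6 = 0 := by
      refine (mul_eq_zero.mp (?_ : ε * r * (r - s) * (γ + α * ε) * _ = 0)).resolve_left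
        (mul_ne_zero (mul_ne_zero (mul_ne_zero hε hr) hrs') hβ)
      linear_combination α * A2 0 + γ * A2 1 - α * (γ + α * ε) * o2 -
        ε * r * (r - s) * α * p01
    have p23 : a 2 6 = ε' * a 3 6 := by
      refine sub_eq_zero.mp ((mul_eq_zero.mp (?_ : γ' * (r - s) * _ = 0)).resolve_left
        (mul_ne_zero hγ' hrs'))
      linear_combination -B0 2 + ε' * B0 3 + s * (γ' + α' * ε') * o3
    have p3 : a 3 6 = 0 := by
      refine (mul_eq_zero.mp (?_ : ε' * (r - s) * (γ' + α' * ε') * _ = 0)).resolve_left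
        (mul_ne_zero (mul_ne_zero hε' hrs') hβ')
      linear_combination -α' * B2 2 - γ' * B2 3 + α' * s * (γ' + α' * ε') * o5 -
        ε' * (r - s) * α' * p23
    have p : ∀ m, a m 6 = 0 := by
      intro m
      fin_cases m
      · exact p01.trans (by rw [p1, mul_zero])
      · exact p1
      · exact p23.trans (by rw [p3, mul_zero])
      · exact p3
    have a0 : ∀ m, a m 0 = 0 := fun m =>
      (mul_eq_zero.mp ((A0 m).trans (by rw [p, mul_zero]))).resolve_left hβ
    have a2 : ∀ m, a m 2 = 0 := fun m =>
      (mul_eq_zero.mp ((A2 m).trans (by rw [p, mul_zero]))).resolve_left (mul_ne_zero hα hβ)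
    have a3 : ∀ m, a m 3 = 0 := fun m =>
      (mul_eq_zero.mp ((B0 m).trans (by rw [p, mul_zero]))).resolve_left (mul_ne_zero hs hβ')
    have a5 : ∀ m, a m 5 = 0 := fun m =>
      (mul_eq_zero.mp ((B2 m).trans (by rw [p, mul_zero]))).resolve_left
        (mul_ne_zero (mul_ne_zero hα' hs) hβ')
    have a1 : ∀ m, a m 1 = 0 := fun m => by linear_combination f2 m - ε ^ 2 * a0 m - γ ^ 2 * a2 m
    have a4 : ∀ m, a m 4 = 0 := fun m => by
      linear_combination g2 m - ε' ^ 2 * a3 m - γ' ^ 2 * a5 m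
    have a7 : ∀ m, a m 7 = 0 := fun m => by
      refine (mul_eq_zero.mp (?_ : s * _ = 0)).resolve_left hs
      linear_combination hpq m - r * p m
    have ha : a = 0 := by
      funext m e
      fin_cases e
      exacts [a0 m, a1 m, a2 m, a3 m, a4 m, a5 m, p m, a7 m]
    subst ha
    funext m i
    refine Fin.addCases (m := 8) (n := 4) (fun i => ?_) (fun i => ?_) i
    · exact Fin.append_left _ _ i
    · exact Fin.append_right _ _ i

end TwelvePoints

section ResidualGeneric

variable {k : Type} [Field k]

/-- A linear combination of the quadrics through `eightPoints`. -/
noncomputable def residualForm (c : Fin 3 → k) : R4 k :=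
  C (c 0) * (X 0 * X 3) + C (c 1) * (X 1 * X 2) + C (c 2) * (X 1 * X 3)

theorem eval_residualForm (c : Fin 3 → k) (x : Fin 4 → k) :
    eval x (residualForm c) = ∑ j, c j * residualQuadrics x j := by
  simp [residualForm, residualQuadrics, Fin.sum_univ_three]

theorem residualForm_isHomogeneous (c : Fin 3 → k) : (residualForm c).IsHomogeneous 2 := by
  have h : ∀ (r : k) (i j : Fin 4), (C r * (X i * X j) : R4 k).IsHomogeneous 2 := fun r i j =>
    ((isHomogeneous_X _ _).mul (isHomogeneous_X _ _)).C_mul r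
  exact ((h _ _ _).add (h _ _ _)).add (h _ _ _)

theorem residualForm_ne_zero {c : Fin 3 → k} (hc : c ≠ 0) : residualForm c ≠ 0 := by
  intro h
  refine hc (funext fun j => ?_)
  fin_cases j
  · simpa [residualForm] using congrArg (eval ![1, 0, 0, 1]) h
  · simpa [residualForm] using congrArg (eval ![0, 1, 1, 0]) h
  · simpa [residualForm] using congrArg (eval ![0, 1, 0, 1]) h

theorem MeetsLowDegreeComplements.exists_residual_generic {Y : Set (Fin 4 → k)}
    (h : MeetsLowDegreeComplements Y) :
    ∃ t : Fin 4 → Fin 4 → k, (∀ i, t i ∈ Y) ∧ IsUnit (Matrix.of t) ∧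
      ∀ i (y : Fin 4 → k), y i = 0 → (∀ j, ∑ i, y i * residualQuadrics (t i) j = 0) → y = 0 := by
  have hok : ∀ c : Fin 3 → k, c ≠ 0 →
      residualForm c ≠ 0 ∧ ∃ d < 3, (residualForm c).IsHomogeneous d := fun c hc =>
    ⟨residualForm_ne_zero hc, 2, by norm_num, residualForm_isHomogeneous c⟩
  obtain ⟨d₀, hd₀, -⟩ := exists_orthogonal (k := k) (m := 0) (n := 4) (by norm_num) Fin.elim0
  obtain ⟨c₀, hc₀, -⟩ := exists_orthogonal (k := k) (m := 0) (n := 3) (by norm_num) Fin.elim0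
  obtain ⟨t₀, ht₀, h₀, r₀⟩ := h.exists_linearForm hd₀ (l := [residualForm c₀])
    (by simpa using hok c₀ hc₀)
  obtain ⟨d₁, hd₁, hk₁⟩ := exists_orthogonal (k := k) (n := 4) (by norm_num) ![t₀]
  obtain ⟨c₁, hc₁, hn₁⟩ := exists_orthogonal (k := k) (n := 3) (by norm_num) ![residualQuadrics t₀]
  obtain ⟨t₁, ht₁, h₁, r₁⟩ := h.exists_linearForm hd₁ (l := [residualForm c₁])
    (by simpa using hok c₁ hc₁)
  obtain ⟨d₂, hd₂, hk₂⟩ := exists_orthogonal (k := k) (n := 4) (by norm_num) ![t₀, t₁]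
  obtain ⟨c₂, hc₂, hn₂⟩ := exists_orthogonal (k := k) (n := 3) (by norm_num)
    ![residualQuadrics t₀, residualQuadrics t₁]
  obtain ⟨t₂, ht₂, h₂, r₂⟩ := h.exists_linearForm hd₂ (l := [residualForm c₂])
    (by simpa using hok c₂ hc₂)
  obtain ⟨d₃, hd₃, hk₃⟩ := exists_orthogonal (k := k) (n := 4) (by norm_num) ![t₀, t₁, t₂]
  obtain ⟨c₃, hc₃, hn₃⟩ := exists_orthogonal (k := k) (n := 3) (by norm_num)
    ![residualQuadrics t₀, residualQuadrics t₂]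
  obtain ⟨c₄, hc₄, hn₄⟩ := exists_orthogonal (k := k) (n := 3) (by norm_num)
    ![residualQuadrics t₁, residualQuadrics t₂]
  obtain ⟨t₃, ht₃, h₃, r₃⟩ := h.exists_linearForm hd₃
    (l := [residualForm c₂, residualForm c₃, residualForm c₄])
    (by simpa using ⟨hok c₂ hc₂, hok c₃ hc₃, hok c₄ hc₄⟩)
  simp only [List.mem_cons, List.not_mem_nil, or_false, forall_eq_or_imp, forall_eq,
    eval_residualForm] at r₀ r₁ r₂ r₃
  refine ⟨![t₀, t₁, t₂, t₃], fun i => by fin_cases i <;> assumption,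
    isUnit_of_orthogonal h₀ h₁ h₂ h₃ hk₁ hk₂ hk₃, fun i y hy hsum => ?_⟩
  have hfun : ∀ c : Fin 3 → k, y 0 * ∑ j, c j * residualQuadrics t₀ j +
      y 1 * ∑ j, c j * residualQuadrics t₁ j + y 2 * ∑ j, c j * residualQuadrics t₂ j +
      y 3 * ∑ j, c j * residualQuadrics t₃ j = 0 := by
    intro c
    have e0 := hsum 0
    have e1 := hsum 1
    have e2 := hsum 2
    simp only [Fin.sum_univ_four, Matrix.cons_val] at e0 e1 e2
    simp only [Fin.sum_univ_three]
    linear_combination c 0 * e0 + c 1 * e1 + c 2 * e2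
  have f0 := hfun c₀
  have f1 := hfun c₁
  have f2 := hfun c₂
  have f3 := hfun c₃
  have f4 := hfun c₄
  have z₁ : ∑ j, c₁ j * residualQuadrics t₀ j = 0 := hn₁ 0
  have z₂ : ∑ j, c₂ j * residualQuadrics t₀ j = 0 := hn₂ 0
  have z₂' : ∑ j, c₂ j * residualQuadrics t₁ j = 0 := hn₂ 1
  have z₃ : ∑ j, c₃ j * residualQuadrics t₀ j = 0 := hn₃ 0
  have z₃' : ∑ j, c₃ j * residualQuadrics t₂ j = 0 := hn₃ 1
  have z₄ : ∑ j, c₄ j * residualQuadrics t₁ j = 0 := hn₄ 0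
  have z₄' : ∑ j, c₄ j * residualQuadrics t₂ j = 0 := hn₄ 1
  rw [z₁] at f1
  rw [z₂, z₂'] at f2
  rw [z₃, z₃'] at f3
  rw [z₄, z₄'] at f4
  suffices h4 : y 0 = 0 ∧ y 1 = 0 ∧ y 2 = 0 ∧ y 3 = 0 by
    funext i
    fin_cases i
    exacts [h4.1, h4.2.1, h4.2.2.1, h4.2.2.2]
  have a1 : y 2 = 0 → y 3 = 0 → y 1 = 0 := fun e2 e3 => by simpa [e2, e3, r₁] using f1
  have a2 : y 3 = 0 → y 2 = 0 := fun e3 => by simpa [e3, r₂] using f2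
  have a0 : y 1 = 0 → y 2 = 0 → y 3 = 0 → y 0 = 0 := fun e1 e2 e3 => by
    simpa [e1, e2, e3, r₀] using f0
  suffices h3 : y 3 = 0 from ⟨a0 (a1 (a2 h3) h3) (a2 h3) h3, a1 (a2 h3) h3, a2 h3, h3⟩
  fin_cases i
  · have e : y 0 = 0 := hy
    simpa [e, r₃.2.2] using f4
  · have e : y 1 = 0 := hy
    simpa [e, r₃.2.1] using f3
  · have e : y 2 = 0 := hy
    simpa [e, r₃.1] using f2
  · exact hy

end ResidualGeneric

section Polar

variable {k : Type} [Field k]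

/-- The polar of `f` with respect to the point `b`. -/
noncomputable def polarForm (f : R4 k) (b : Fin 4 → k) : R4 k := ∑ i, C (b i) * pderiv i f

/-- The gradient of `f` at the point `a`. -/
noncomputable def gradientAt (f : R4 k) (a : Fin 4 → k) : Fin 4 → k := fun i => eval a (pderiv i f)

theorem eval_polarForm (f : R4 k) (a b : Fin 4 → k) :
    eval a (polarForm f b) = ∑ i, gradientAt f a i * b i := by
  simp [polarForm, gradientAt, mul_comm]

theorem MvPolynomial.IsHomogeneous.polarForm {f : R4 k} (hf : f.IsHomogeneous 3) (b : Fin 4 → k) :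
    (polarForm f b).IsHomogeneous 2 :=
  IsHomogeneous.sum _ _ _ fun _ _ => hf.pderiv.C_mul _

theorem polarForm_sum {ι : Type} (s : Finset ι) (f : ι → R4 k) (b : Fin 4 → k) :
    polarForm (∑ i ∈ s, f i) b = ∑ i ∈ s, polarForm (f i) b := by
  simp only [polarForm, map_sum, Finset.mul_sum]
  exact Finset.sum_comm

theorem polarForm_X_mul (i : Fin 4) (f : R4 k) (b : Fin 4 → k) :
    polarForm (X i * f) b = X i * polarForm f b + C (b i) * f := by
  have h : ∀ j, C (b j) * pderiv j (X i * f) =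
      X i * (C (b j) * pderiv j f) + if j = i then C (b i) * f else 0 := by
    intro j
    rw [Derivation.leibniz, smul_eq_mul, smul_eq_mul]
    split_ifs with hj
    · subst hj
      rw [pderiv_X_self]
      ring
    · rw [pderiv_X_of_ne (Ne.symm hj)]
      ring
  simp only [polarForm, h, Finset.sum_add_distrib, Finset.mul_sum, Finset.sum_ite_eq',
    Finset.mem_univ, if_true]

theorem polarForm_linearForm (c b : Fin 4 → k) :
    polarForm (linearForm c) b = C (∑ i, c i * b i) := by
  have h : ∀ j, pderiv j (linearForm c) = C (c j) := by
    intro j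
    simp [linearForm, pderiv_X, Pi.single_apply]
  simp only [polarForm, h, map_sum, map_mul, mul_comm]

theorem MvPolynomial.IsHomogeneous.eval_mul_add_mul {f : R4 k} (hf : f.IsHomogeneous 3)
    (a b : Fin 4 → k) (x y : k) :
    eval (fun i => x * a i + y * b i) f = x ^ 3 * eval a f +
      x ^ 2 * y * ∑ i, gradientAt f a i * b i + x * y ^ 2 * ∑ i, gradientAt f b i * a i +
      y ^ 3 * eval b f := by
  rw [← eval_polarForm, ← eval_polarForm]
  obtain ⟨c, rfl⟩ := hf.exists_eq_sum_three
  simp only [polarForm_sum, polarForm_X_mul, polarForm_linearForm, map_sum, map_mul, map_add,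
    eval_X, eval_C, eval_linearForm, Finset.mul_sum, ← Finset.sum_add_distrib]
  refine Finset.sum_congr rfl fun i _ => Finset.sum_congr rfl fun j _ =>
    Finset.sum_congr rfl fun l _ => ?_
  ring

theorem SmoothCubicSurface.gradientAt_ne_zero (S : SmoothCubicSurface k) {a : Fin 4 → k}
    (ha : a ≠ 0) (haS : eval a S.f = 0) : gradientAt S.f a ≠ 0 := by
  obtain ⟨i, hi⟩ := S.smooth a ha haS
  exact fun h => hi (congrFun h i)

theorem exists_two_roots [IsAlgClosed k] {A B C E : k} (hA : A ≠ 0) (hE : E ≠ 0)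
    (hdisc : B * C ≠ 9 * A * E) : ∃ r s : k, r ≠ 0 ∧ s ≠ 0 ∧ r ≠ s ∧
      A * r ^ 3 + B * r ^ 2 + C * r + E = 0 ∧ A * s ^ 3 + B * s ^ 2 + C * s + E = 0 := by
  obtain ⟨r, hr⟩ := IsAlgClosed.exists_root
    (Polynomial.C A * Polynomial.X ^ 3 + Polynomial.C B * Polynomial.X ^ 2 +
      Polynomial.C C * Polynomial.X + Polynomial.C E) (by
        rw [Polynomial.degree_cubic hA]; norm_num)
  simp only [Polynomial.IsRoot, Polynomial.eval_add, Polynomial.eval_mul, Polynomial.eval_C,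
    Polynomial.eval_pow, Polynomial.eval_X] at hr
  have hne : ∀ x, A * x ^ 3 + B * x ^ 2 + C * x + E = 0 → x ≠ 0 := by
    rintro x hx rfl
    exact hE (by simpa using hx)
  by_contra! hcon
  have huniq : ∀ x, A * x ^ 3 + B * x ^ 2 + C * x + E = 0 → x = r := by
    intro x hx
    by_contra hxr
    exact hcon r x (hne r hr) (hne x hx) (Ne.symm hxr) hr hx
  obtain ⟨s, hs⟩ := IsAlgClosed.exists_root
    (Polynomial.C A * Polynomial.X ^ 2 + Polynomial.C (B + A * r) * Polynomial.X +
      Polynomial.C (C + B * r + A * r ^ 2)) (by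
        rw [Polynomial.degree_quadratic hA]; norm_num)
  simp only [Polynomial.IsRoot, Polynomial.eval_add, Polynomial.eval_mul, Polynomial.eval_C,
    Polynomial.eval_pow, Polynomial.eval_X] at hs
  obtain rfl : s = r := huniq s (by linear_combination hr + (s - r) * hs)
  have ht : -B / A - 2 * s = s := by
    refine huniq _ ?_
    have hB : A * (-B / A) = -B := mul_div_cancel₀ _ hA
    generalize -B / A = w at hB ⊢
    obtain rfl : B = -(A * w) := by rw [hB, neg_neg]
    linear_combination hr + (w - 3 * s) * hs
  have hB : B = -(3 * A * s) := by
    have : A * (-B / A) = -B := mul_div_cancel₀ _ hA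
    linear_combination -A * ht + this
  refine hdisc ?_
  subst hB
  have hC : C = 3 * A * s ^ 2 := by linear_combination hs
  subst hC
  linear_combination -9 * A * hr

end Polar

section CubicSurface

variable {k : Type} [Field k]

theorem SmoothCubicSurface.exists_frame [IsAlgClosed k] (S : SmoothCubicSurface k) :
    ∃ a a' b b' : Fin 4 → k, IsUnit (Matrix.of ![a, a', b, b']) ∧
      (eval a S.f = 0 ∧ eval a' S.f = 0 ∧ eval b S.f = 0 ∧ eval b' S.f = 0) ∧
      (∑ i, gradientAt S.f a i * a' i ≠ 0 ∧ ∑ i, gradientAt S.f a' i * a i ≠ 0) ∧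
      (∑ i, gradientAt S.f a i * b i ≠ 0 ∧ ∑ i, gradientAt S.f b i * a i ≠ 0) ∧
      ∑ i, gradientAt S.f b i * b' i ≠ 0 ∧ ∑ i, gradientAt S.f b' i * b i ≠ 0 := by
  have h := S.meetsLowDegreeComplements
  have hlin : ∀ c : Fin 4 → k, c ≠ 0 →
      linearForm c ≠ 0 ∧ ∃ d < 3, (linearForm c).IsHomogeneous d := fun c hc =>
    ⟨linearForm_ne_zero hc, 1, by norm_num, linearForm_isHomogeneous c⟩
  have hpol : ∀ u b : Fin 4 → k, ∑ i, gradientAt S.f u i * b i ≠ 0 →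
      polarForm S.f b ≠ 0 ∧ ∃ d < 3, (polarForm S.f b).IsHomogeneous d := fun u b hub =>
    ⟨fun h0 => hub (by rw [← eval_polarForm, h0, map_zero]), 2, by norm_num, S.homog.polarForm b⟩
  have hne : ∀ c x : Fin 4 → k, ∑ i, c i * x i ≠ 0 → x ≠ 0 := by
    rintro c x hcx rfl
    exact hcx (by simp)
  obtain ⟨c, hc, -⟩ := exists_orthogonal (k := k) (m := 0) (n := 4) (by norm_num) Fin.elim0
  obtain ⟨u, hu, hcu, -⟩ := h.exists_linearForm hc (l := []) (by simp)
  have hgu := S.gradientAt_ne_zero (hne _ _ hcu) hu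
  obtain ⟨a, ha, hua, -⟩ := h.exists_linearForm hgu (l := []) (by simp)
  have hga := S.gradientAt_ne_zero (hne _ _ hua) ha
  obtain ⟨c₁, hc₁, hk₁⟩ := exists_orthogonal (k := k) (n := 4) (by norm_num) ![a]
  obtain ⟨a', ha', h₁, r₁⟩ := h.exists_linearForm hc₁
    (l := [linearForm (gradientAt S.f a), polarForm S.f a])
    (by simpa using ⟨hlin _ hga, hpol _ _ hua⟩)
  obtain ⟨c₂, hc₂, hk₂⟩ := exists_orthogonal (k := k) (n := 4) (by norm_num) ![a, a']
  obtain ⟨b, hb, h₂, r₂⟩ := h.exists_linearForm hc₂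
    (l := [linearForm (gradientAt S.f u), linearForm (gradientAt S.f a), polarForm S.f a])
    (by simpa using ⟨hlin _ hgu, hlin _ hga, hpol _ _ hua⟩)
  simp only [List.mem_cons, List.not_mem_nil, or_false, forall_eq_or_imp, forall_eq,
    eval_linearForm, eval_polarForm] at r₁ r₂
  have hgb := S.gradientAt_ne_zero (hne _ _ h₂) hb
  obtain ⟨c₃, hc₃, hk₃⟩ := exists_orthogonal (k := k) (n := 4) (by norm_num) ![a, a', b]
  obtain ⟨b', hb', h₃, r₃⟩ := h.exists_linearForm hc₃
    (l := [linearForm (gradientAt S.f b), polarForm S.f b])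
    (by simpa using ⟨hlin _ hgb, hpol _ _ r₂.1⟩)
  simp only [List.mem_cons, List.not_mem_nil, or_false, forall_eq_or_imp, forall_eq,
    eval_linearForm, eval_polarForm] at r₃
  exact ⟨a, a', b, b', isUnit_of_orthogonal hua h₁ h₂ h₃ hk₁ hk₂ hk₃, ⟨ha, ha', hb, hb'⟩,
    r₁, r₂.2, r₃⟩

/-- The restriction of a polynomial to the line through `a` in the direction `b`. -/
noncomputable def restrictLine (a b : Fin 4 → k) (p : R4 k) : Polynomial k :=
  aeval (fun i => Polynomial.C (a i) + Polynomial.X * Polynomial.C (b i)) p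

theorem eval_restrictLine (a b : Fin 4 → k) (p : R4 k) (x : k) :
    (restrictLine a b p).eval x = eval (fun i => a i + x * b i) p := by
  rw [restrictLine, aeval_def, ← coe_eval₂Hom, ← Polynomial.coe_evalRingHom, ← RingHom.comp_apply]
  congr 1
  refine MvPolynomial.ringHom_ext (fun r => by simp) fun i => ?_
  simp
  exact mul_comm _ _

theorem exists_generic_shift [Infinite k] {f : R4 k} (hf : f.IsHomogeneous 3)
    {a a' b b' : Fin 4 → k} (ha : eval a f = 0) (ha' : eval a' f = 0) (hb : eval b f = 0)
    (hb' : eval b' f = 0) (haa' : ∑ i, gradientAt f a i * a' i ≠ 0)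
    (hbb' : ∑ i, gradientAt f b i * b' i ≠ 0) (hab : ∑ i, gradientAt f a i * b i ≠ 0)
    (hba : ∑ i, gradientAt f b i * a i ≠ 0) :
    ∃ (ε : k) (m n : Fin 4 → k), ε ≠ 0 ∧ (m = fun i => a i + ε * a' i) ∧
      (n = fun i => b i + ε * b' i) ∧ eval m f ≠ 0 ∧ eval n f ≠ 0 ∧
      (∑ i, gradientAt f m i * n i) * ∑ i, gradientAt f n i * m i ≠ 9 * eval m f * eval n f := by
  have hline : ∀ a a' : Fin 4 → k, eval a f = 0 → eval a' f = 0 → ∀ x,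
      eval (fun i => a i + x * a' i) f =
        x * (∑ i, gradientAt f a i * a' i + x * ∑ i, gradientAt f a' i * a i) := by
    intro a a' ha ha' x
    have := hf.eval_mul_add_mul a a' 1 x
    simp only [one_mul] at this
    rw [this, ha, ha']
    ring
  let D : Polynomial k :=
    (∑ i, restrictLine a a' (pderiv i f) *
      (Polynomial.C (b i) + Polynomial.X * Polynomial.C (b' i))) *
    (∑ i, restrictLine b b' (pderiv i f) *
      (Polynomial.C (a i) + Polynomial.X * Polynomial.C (a' i))) -
    9 * restrictLine a a' f * restrictLine b b' f
  let L : (Fin 4 → k) → (Fin 4 → k) → Polynomial k := fun a a' =>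
    Polynomial.C (∑ i, gradientAt f a i * a' i) +
      Polynomial.X * Polynomial.C (∑ i, gradientAt f a' i * a i)
  have hL : ∀ a a' x, (L a a').eval x =
      ∑ i, gradientAt f a i * a' i + x * ∑ i, gradientAt f a' i * a i := by
    intro a a' x
    simp only [L, Polynomial.eval_add, Polynomial.eval_mul, Polynomial.eval_C, Polynomial.eval_X]
  have hL0 : ∀ a a', ∑ i, gradientAt f a i * a' i ≠ 0 → L a a' ≠ 0 := by
    intro a a' h h0
    have := hL a a' 0
    rw [h0, Polynomial.eval_zero, zero_mul, add_zero] at this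
    exact h this.symm
  have hD : ∀ x, D.eval x = (∑ i, gradientAt f (fun i => a i + x * a' i) i * (b i + x * b' i)) *
      (∑ i, gradientAt f (fun i => b i + x * b' i) i * (a i + x * a' i)) -
      9 * eval (fun i => a i + x * a' i) f * eval (fun i => b i + x * b' i) f := by
    intro x
    simp only [D, Polynomial.eval_sub, Polynomial.eval_mul, Polynomial.eval_finsetSum,
      Polynomial.eval_add, Polynomial.eval_C, Polynomial.eval_X, eval_restrictLine,
      Polynomial.eval_ofNat, gradientAt]
  have hD0 : D ≠ 0 := by
    intro h0
    have := hD 0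
    simp only [h0, Polynomial.eval_zero, zero_mul, add_zero, ha, mul_zero, sub_zero] at this
    exact mul_ne_zero hab hba this.symm
  have hP : Polynomial.X * L a a' * L b b' * D ≠ 0 :=
    mul_ne_zero (mul_ne_zero (mul_ne_zero Polynomial.X_ne_zero (hL0 _ _ haa')) (hL0 _ _ hbb')) hD0
  obtain ⟨x, hx⟩ : ∃ x, (Polynomial.X * L a a' * L b b' * D).eval x ≠ 0 := by
    by_contra! hcon
    exact hP (Polynomial.funext fun x => by rw [hcon, Polynomial.eval_zero])
  simp only [Polynomial.eval_mul, Polynomial.eval_X, hL, mul_ne_zero_iff, hD, sub_ne_zero] at hx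
  obtain ⟨⟨⟨hx0, hxa⟩, hxb⟩, hxD⟩ := hx
  refine ⟨x, _, _, hx0, rfl, rfl, ?_, ?_, hxD⟩
  · rw [hline a a' ha ha']
    exact mul_ne_zero hx0 hxa
  · rw [hline b b' hb hb']
    exact mul_ne_zero hx0 hxb

end CubicSurface

section TwelvePointsOnCubic

variable {k : Type} [Field k]

theorem vecMul_of_four (y a b c d : Fin 4 → k) : Matrix.vecMul y (Matrix.of ![a, b, c, d]) =
    fun i => y 0 * a i + y 1 * b i + y 2 * c i + y 3 * d i := by
  funext i
  simp [Matrix.vecMul, dotProduct, Fin.sum_univ_four]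

theorem isUnit_of_shift {a a' b b' m n : Fin 4 → k} (h : IsUnit (Matrix.of ![a, a', b, b']))
    {ε : k} (hm : m = fun i => a i + ε * a' i) (hn : n = fun i => b i + ε * b' i) :
    IsUnit (Matrix.of ![m, a', n, b']) := by
  refine isUnit_of_vecMul_eq_zero fun y hy => ?_
  have h0 : (![y 0, ε * y 0 + y 1, y 2, ε * y 2 + y 3] : Fin 4 → k) = 0 := by
    refine Matrix.vecMul_injective_of_isUnit h ?_
    rw [vecMul_of_four] at hy
    simp only [vecMul_of_four, Matrix.cons_val, Matrix.zero_vecMul]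
    rw [← hy, hm, hn]
    funext i
    ring
  have e0 : y 0 = 0 := congrFun h0 0
  have e1 : ε * y 0 + y 1 = 0 := congrFun h0 1
  have e2 : y 2 = 0 := congrFun h0 2
  have e3 : ε * y 2 + y 3 = 0 := congrFun h0 3
  rw [e0, mul_zero, zero_add] at e1
  rw [e2, mul_zero, zero_add] at e3
  funext i
  fin_cases i <;> assumption

theorem MvPolynomial.IsHomogeneous.eval_third_point {f : R4 k} (hf : f.IsHomogeneous 3)
    {a b : Fin 4 → k} (ha : eval a f = 0) (hb : eval b f = 0) :
    eval (fun i => (∑ j, gradientAt f b j * a j) * a i +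
      (-∑ j, gradientAt f a j * b j) * b i) f = 0 := by
  rw [hf.eval_mul_add_mul, ha, hb]
  ring

theorem SmoothCubicSurface.exists_pointsCondition_twelve [IsAlgClosed k]
    (S : SmoothCubicSurface k) :
    ∃ v : Fin 12 → Fin 4 → k, PointsCondition v 2 ∧ ∀ i, eval (v i) S.f = 0 := by
  obtain ⟨a, a', b, b', hunit, ⟨ha, ha', hb, hb'⟩, ⟨haa', ha'a⟩, ⟨hab, hba⟩, hbb', hb'b⟩ :=
    S.exists_frame
  obtain ⟨ε, m, n, hε, hm, hn, hfm, hfn, hdisc⟩ :=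
    exists_generic_shift S.homog ha ha' hb hb' haa' hbb' hab hba
  obtain ⟨r, s, hr, hs, hrs, hrf, hsf⟩ := exists_two_roots hfm hfn hdisc
  have hM := isUnit_of_shift hunit hm hn
  obtain ⟨t, htS, ht, htq⟩ :=
    (S.meetsLowDegreeComplements.vecMul_preimage hM).exists_residual_generic
  have hline : ∀ {a a' m : Fin 4 → k}, eval a S.f = 0 → eval a' S.f = 0 →
      (m = fun i => a i + ε * a' i) → eval m S.f ≠ 0 →
      -∑ i, gradientAt S.f a i * a' i - (∑ i, gradientAt S.f a' i * a i) * ε ≠ 0 := by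
    intro a a' m ha ha' hm hfm h0
    refine hfm ?_
    have := S.homog.eval_mul_add_mul a a' 1 ε
    simp only [one_mul] at this
    rw [hm, this, ha, ha']
    linear_combination -ε * h0
  refine ⟨_, (pointsCondition_twelve (α := ∑ i, gradientAt S.f a' i * a i)
    (α' := ∑ i, gradientAt S.f b' i * b i) hε ha'a (hline ha ha' hm hfm)
    (by rwa [sub_add_cancel, neg_ne_zero]) hε hb'b (hline hb hb' hn hfn)
    (by rwa [sub_add_cancel, neg_ne_zero]) hr hs hrs ht htq).vecMul hM, ?_⟩
  have hthird := S.homog.eval_third_point ha ha'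
  have hthird' := S.homog.eval_third_point hb hb'
  have hroot : ∀ x, eval m S.f * x ^ 3 + (∑ i, gradientAt S.f m i * n i) * x ^ 2 +
      (∑ i, gradientAt S.f n i * m i) * x + eval n S.f = 0 →
      eval (fun i => x * m i + 1 * n i) S.f = 0 := by
    intro x hx
    rw [S.homog.eval_mul_add_mul]
    linear_combination hx
  refine Fin.addCases (m := 8) (n := 4) (fun i => ?_) fun i => ?_
  · rw [Fin.append_left, vecMul_of_four]
    have hpt : ∀ {x y : Fin 4 → k}, eval x S.f = 0 → (∀ i, y i = x i) → eval y S.f = 0 :=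
      fun hx hyx => by rwa [_root_.funext hyx]
    fin_cases i <;> simp only [eightPoints, Fin.zero_eta, Fin.mk_one, Fin.reduceFinMk,
      Matrix.cons_val]
    · exact hpt ha fun i => by rw [hm]; ring
    · exact hpt ha' fun i => by ring
    · exact hpt hthird fun i => by rw [hm]; ring
    · exact hpt hb fun i => by rw [hn]; ring
    · exact hpt hb' fun i => by ring
    · exact hpt hthird' fun i => by rw [hn]; ring
    · exact hpt (hroot r hrf) fun i => by ring
    · exact hpt (hroot s hsf) fun i => by ring
  · rw [Fin.append_right]
    exact htS i

end TwelvePointsOnCubic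

/-- base cases.  On a smooth cubic surface `X`, the ideal `I_(Z,X)` of a
general set of 5 points has graded minimal free resolution
`0 → R(-5) → R(-3)^6 → R(-2)^5 → I_(Z,X) → 0`, and the ideal `I_(Z',X)` of a general set of
12 points has graded minimal free resolution `0 → R(-6)² → R(-4)^9 → R(-3)^7 → I_(Z',X) → 0`. -/
theorem base_cases_5_and_12_points (k : Type) [Field k] [IsAlgClosed k]
    (S : SmoothCubicSurface k) :
    GeneralPointsSatisfy k S 5 (fun Z =>
      HasMinFreeRes3 k (Ideal.span {S.f}) (pointsIdeal k (Set.range Z))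
        (fun _ : Fin (5) => 2) (fun _ : Fin (6) => 3) (fun _ : Fin (1) => 5)) ∧
    GeneralPointsSatisfy k S 12 (fun Z =>
      HasMinFreeRes3 k (Ideal.span {S.f}) (pointsIdeal k (Set.range Z))
        (fun _ : Fin (7) => 3) (fun _ : Fin (9) => 4) (fun _ : Fin (2) => 6)) := by
  obtain ⟨v, hv, hvS⟩ := S.exists_pointsCondition_five
  obtain ⟨w, hw, hwS⟩ := S.exists_pointsCondition_twelve
  exact ⟨hv.generalPointsSatisfy (hv.koszul.ne_zero one_ne_zero) hvS
      fun _ _ h hlam _ hu hZ hfZ => h.hasMinFreeRes_five hlam hu hZ S.homog S.irred.ne_zero hfZ,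
    hw.generalPointsSatisfy (hw.koszul.ne_zero two_ne_zero) hwS
      fun _ _ h hlam _ hu hZ hfZ => h.hasMinFreeRes_twelve hlam hu hZ S.homog S.irred.ne_zero hfZ⟩
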